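/- arXiv:1701.07131 — 4 statements merged into one kernel-verified Lean document; each statement's English description precedes it below -/
import Mathlib

section
/- Let u₁, u₂ be two distinct bounded classical solutions of the scalar reaction-diffusion equation uₜ = uₓₓ + g(t,u,uₓ) on the circle. If t₀ > 0 is such that the function x ↦ u₁(t₀,x) − u₂(t₀,x) has a multiple zero (i.e. there exists x₀ with u₁(t₀,x₀) − u₂(t₀,x₀) = 0 and ∂ₓu₁(t₀,x₀) − ∂ₓu₂(t₀,x₀) = 0), then the zero number strictly decreases at t₀: for all s, t with 0 < s < t₀ < t one has z(u₁(t,·) − u₂(t,·)) < z(u₁(s,·) − u₂(s,·)). -/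
open Real Set Filter

noncomputable def zeroNum (u : ℝ → ℝ) : ℕ∞ :=
  {x ∈ Set.Ico (0 : ℝ) (2 * Real.pi) | u x = 0}.encard

def Admissible (h : ℝ → ℝ → ℝ → ℝ) : Prop :=
  ∀ K : Set (ℝ × ℝ), IsCompact K →
    (∃ M : ℝ, ∀ t : ℝ, ∀ q ∈ K, |h t q.1 q.2| ≤ M) ∧
    UniformContinuousOn (fun p : ℝ × ℝ × ℝ => h p.1 p.2.1 p.2.2) (Set.univ ×ˢ K)


section
open Real Set Filter MeasureTheory Topology

/-- gaussian weight -/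
noncomputable def gam (y : ℝ) : ℝ := (Real.sqrt (2 * Real.pi))⁻¹ * Real.exp (-(y ^ 2) / 2)

def PG (f : ℝ → ℝ) : Prop := Continuous f ∧ ∃ C : ℝ, ∃ n : ℕ, 0 ≤ C ∧ ∀ y, |f y| ≤ C * (1 + |y|) ^ n

theorem gam_pos (y : ℝ) : 0 < gam y := by
  unfold gam; positivity

theorem gam_cont : Continuous gam := by
  unfold gam; fun_prop

theorem gam_deriv (y : ℝ) : HasDerivAt gam (-(y * gam y)) y := by
  have h : HasDerivAt (fun y : ℝ => -(y ^ 2) / 2) (-y) y :=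
    (((hasDerivAt_pow 2 y).neg).div_const 2).congr_deriv (by simp; ring)
  have := (h.exp).const_mul ((Real.sqrt (2 * Real.pi))⁻¹)
  exact this.congr_deriv (by unfold gam; ring)

theorem PG.cont {f : ℝ → ℝ} (h : PG f) : Continuous f := h.1

theorem PG.const (c : ℝ) : PG (fun _ => c) := ⟨continuous_const, |c|, 0, abs_nonneg _, by simp⟩

theorem PG.id : PG (fun y => y) := ⟨continuous_id, 1, 1, zero_le_one, by intro y; simp⟩

theorem PG.of_bdd {f : ℝ → ℝ} (hf : Continuous f) (M : ℝ) (h : ∀ y, |f y| ≤ M) : PG f :=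
  ⟨hf, M, 0, (abs_nonneg _).trans (h 0), by simpa using h⟩

theorem PG.of_lin {f : ℝ → ℝ} (hf : Continuous f) (M : ℝ) (h : ∀ y, |f y| ≤ M * (1 + |y|)) : PG f :=
  ⟨hf, M, 1, by have := (abs_nonneg _).trans (h 0); simpa using this, by simpa using h⟩

theorem PG.mul {f g : ℝ → ℝ} (hf : PG f) (hg : PG g) : PG (fun y => f y * g y) := by
  obtain ⟨cf, C, n, hC, h1⟩ := hf
  obtain ⟨cg, D, m, hD, h2⟩ := hg
  refine ⟨cf.mul cg, C * D, n + m, mul_nonneg hC hD, fun y => ?_⟩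
  rw [abs_mul]
  calc |f y| * |g y| ≤ (C * (1 + |y|) ^ n) * (D * (1 + |y|) ^ m) :=
        mul_le_mul (h1 y) (h2 y) (abs_nonneg _) ((abs_nonneg _).trans (h1 y))
    _ = _ := by ring

theorem PG.add {f g : ℝ → ℝ} (hf : PG f) (hg : PG g) : PG (fun y => f y + g y) := by
  obtain ⟨cf, C, n, hC, h1⟩ := hf
  obtain ⟨cg, D, m, hD, h2⟩ := hg
  refine ⟨cf.add cg, C + D, n + m, add_nonneg hC hD, fun y => ?_⟩
  have h0 : (1:ℝ) ≤ 1 + |y| := by linarith [abs_nonneg y]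
  have e1 : (1 + |y|) ^ n ≤ (1 + |y|) ^ (n + m) := pow_le_pow_right₀ h0 (by omega)
  have e2 : (1 + |y|) ^ m ≤ (1 + |y|) ^ (n + m) := pow_le_pow_right₀ h0 (by omega)
  calc |f y + g y| ≤ |f y| + |g y| := abs_add_le _ _
    _ ≤ C * (1 + |y|) ^ n + D * (1 + |y|) ^ m := add_le_add (h1 y) (h2 y)
    _ ≤ C * (1 + |y|) ^ (n+m) + D * (1 + |y|) ^ (n+m) := by gcongr
    _ = _ := by ring

theorem PG.neg {f : ℝ → ℝ} (hf : PG f) : PG (fun y => - f y) := by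
  obtain ⟨cf, C, n, hC, h1⟩ := hf
  exact ⟨cf.neg, C, n, hC, by simpa using h1⟩

theorem PG.sub {f g : ℝ → ℝ} (hf : PG f) (hg : PG g) : PG (fun y => f y - g y) := by
  simpa [sub_eq_add_neg] using hf.add hg.neg

theorem PG.sq {f : ℝ → ℝ} (hf : PG f) : PG (fun y => f y ^ 2) := by
  simpa [pow_two] using hf.mul hf

theorem PG.cmul {f : ℝ → ℝ} (c : ℝ) (hf : PG f) : PG (fun y => c * f y) := (PG.const c).mul hf

theorem poly_le_exp (n : ℕ) : ∃ K : ℝ, 0 < K ∧ ∀ y : ℝ, (1 + |y|) ^ n ≤ K * Real.exp (y ^ 2 / 4) := by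
  refine ⟨n.factorial * Real.exp 2, by positivity, fun y => ?_⟩
  have h0 : (0:ℝ) ≤ 1 + |y| := by positivity
  have h1 := Real.pow_div_factorial_le_exp (1 + |y|) h0 n
  rw [div_le_iff₀ (by positivity)] at h1
  refine h1.trans ?_
  have : Real.exp (1 + |y|) ≤ Real.exp (2 + y ^ 2 / 4) := by
    apply Real.exp_le_exp.2
    rw [← sq_abs y]
    nlinarith [sq_nonneg (|y| / 2 - 1)]
  rw [Real.exp_add 2] at this
  have hf : (0:ℝ) < n.factorial := by positivity
  nlinarith

theorem integrable_poly_gam (n : ℕ) : Integrable (fun y : ℝ => (1 + |y|) ^ n * gam y) := by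
  obtain ⟨K, hK, h⟩ := poly_le_exp n
  have hi := (integrable_exp_neg_mul_sq (b := 1/4) (by norm_num)).const_mul
    (K * (Real.sqrt (2 * Real.pi))⁻¹)
  refine hi.mono' (by have := gam_cont; fun_prop) (ae_of_all _ fun y => ?_)
  rw [Real.norm_of_nonneg (mul_nonneg (by positivity) (gam_pos y).le)]
  unfold gam
  calc (1 + |y|) ^ n * ((√(2 * π))⁻¹ * rexp (-y ^ 2 / 2)) ≤
      (K * Real.exp (y ^ 2 / 4)) * ((√(2 * π))⁻¹ * rexp (-y ^ 2 / 2)) := by gcongr; exact h y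
    _ = K * (√(2 * π))⁻¹ * (Real.exp (y ^ 2 / 4) * rexp (-y ^ 2 / 2)) := by ring
    _ = _ := by rw [← Real.exp_add]; congr 2; ring

theorem PG.integrable {f : ℝ → ℝ} (hf : PG f) : Integrable (fun y => f y * gam y) := by
  obtain ⟨cf, C, n, hC, h1⟩ := hf
  refine ((integrable_poly_gam n).const_mul C).mono' (by have := gam_cont; fun_prop) (ae_of_all _ fun y => ?_)
  rw [norm_mul, Real.norm_eq_abs, Real.norm_of_nonneg (gam_pos y).le, ← mul_assoc]
  exact mul_le_mul_of_nonneg_right (h1 y) (gam_pos y).le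

/-- weighted integral -/
noncomputable def J (f : ℝ → ℝ) : ℝ := ∫ y, f y * gam y

theorem J_add {f g : ℝ → ℝ} (hf : PG f) (hg : PG g) : J (fun y => f y + g y) = J f + J g := by
  unfold J; rw [← integral_add hf.integrable hg.integrable]; simp only [add_mul]

theorem J_sub {f g : ℝ → ℝ} (hf : PG f) (hg : PG g) : J (fun y => f y - g y) = J f - J g := by
  unfold J; rw [← integral_sub hf.integrable hg.integrable]; simp only [sub_mul]

theorem J_cmul (c : ℝ) (f : ℝ → ℝ) : J (fun y => c * f y) = c * J f := by
  unfold J; rw [← integral_const_mul]; simp only [mul_assoc]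

theorem J_mono {f g : ℝ → ℝ} (hf : PG f) (hg : PG g) (h : ∀ y, f y ≤ g y) : J f ≤ J g :=
  integral_mono hf.integrable hg.integrable fun y => mul_le_mul_of_nonneg_right (h y) (gam_pos y).le

theorem J_nonneg {f : ℝ → ℝ} (h : ∀ y, 0 ≤ f y) : 0 ≤ J f :=
  integral_nonneg fun y => mul_nonneg (h y) (gam_pos y).le

theorem J_pos {f : ℝ → ℝ} (hf : PG f) (h : ∀ y, 0 ≤ f y) (h' : ∃ y, f y ≠ 0) : 0 < J f := by
  obtain ⟨y, hy⟩ := h'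
  unfold J
  rw [integral_pos_iff_support_of_nonneg (fun y => mul_nonneg (h y) (gam_pos y).le) hf.integrable]
  have : IsOpen (Function.support fun y => f y * gam y) := (hf.cont.mul gam_cont).isOpen_support
  exact this.measure_pos _ ⟨y, mul_ne_zero hy (gam_pos y).ne'⟩

theorem J_ibp {f f' : ℝ → ℝ} (hd : ∀ y, HasDerivAt f (f' y) y) (hf : PG f) (hf' : PG f') :
    J f' = J (fun y => y * f y) := by
  have h : ∫ y, (f' y * gam y + f y * (-(y * gam y))) = 0 := by
    apply integral_eq_zero_of_hasDerivAt_of_integrable (f := fun y => f y * gam y)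
    · intro y; exact (hd y).mul (gam_deriv y)
    · have := (hf'.sub (PG.id.mul hf)).integrable
      refine this.congr (ae_of_all _ fun y => ?_)
      simp only; ring
    · exact hf.integrable
  have h2 : J (fun y => f' y - y * f y) = 0 := by
    unfold J; rw [← h]; congr 1; ext y; ring
  rw [J_sub hf' (PG.id.mul hf)] at h2
  linarith

theorem J_cs {f g : ℝ → ℝ} (hf : PG f) (hg : PG g) :
    (J fun y => f y * g y) ^ 2 ≤ (J fun y => f y ^ 2) * (J fun y => g y ^ 2) := by
  have key : ∀ t : ℝ, 0 ≤ (J fun y => g y ^ 2) * (t * t) + (2 * J fun y => f y * g y) * t + (J fun y => f y ^ 2) := by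
    intro t
    have h0 : 0 ≤ J (fun y => (t * g y + f y) ^ 2) := J_nonneg fun y => sq_nonneg _
    have : (fun y => (t * g y + f y) ^ 2) = fun y => ((t * t) * g y ^ 2 + (2 * t) * (f y * g y)) + f y ^ 2 := by
      ext y; ring
    rw [this, J_add ((hg.sq.cmul _).add ((hf.mul hg).cmul _)) hf.sq, J_add (hg.sq.cmul _) ((hf.mul hg).cmul _),
      J_cmul, J_cmul] at h0
    linarith
  have := discrim_le_zero key
  unfold discrim at this
  nlinarith

end

section
open Real Set Filter MeasureTheory Topology

noncomputable def hP : ℕ → ℝ → ℝ → ℝ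
  | 0, _, _ => 1
  | 1, _, y => y
  | (n + 2), s, y => y * hP (n + 1) s y + 2 * s * ((n : ℝ) + 1) * hP n s y

theorem hP_rec (n : ℕ) (s y : ℝ) : hP (n + 1) s y = y * hP n s y + 2 * s * n * hP (n - 1) s y := by
  cases n with
  | zero => simp [hP]
  | succ n => simp [hP]

theorem hP_dy (n : ℕ) (s y : ℝ) : HasDerivAt (fun z => hP n s z) (n * hP (n - 1) s y) y := by
  induction n using Nat.strong_induction_on with
  | _ n ih =>
    match n, ih with
    | 0, _ => simpa [hP] using hasDerivAt_const y (1:ℝ)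
    | 1, _ => simpa [hP] using hasDerivAt_id' y
    | n + 2, ih =>
      have h1 := ih (n + 1) (by omega)
      have h0 := ih n (by omega)
      have := ((hasDerivAt_id y).mul h1).add (h0.const_mul (2 * s * ((n:ℝ) + 1)))
      refine (this.congr_deriv ?_)
      have hr := hP_rec n s y
      simp only [Nat.add_sub_cancel, id, show n + 2 - 1 = n + 1 by omega]
      rw [hr]; push_cast; ring

theorem hP_ds (n : ℕ) (s y : ℝ) : HasDerivAt (fun r => hP n r y) (n * ((n:ℝ) - 1) * hP (n - 2) s y) s := by
  induction n using Nat.strong_induction_on with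
  | _ n ih =>
    match n, ih with
    | 0, _ => simpa [hP] using hasDerivAt_const s (1:ℝ)
    | 1, _ => simpa [hP] using hasDerivAt_const s y
    | n + 2, ih =>
      have h1 := ih (n + 1) (by omega)
      have h0 := ih n (by omega)
      have := (h1.const_mul y).add (((((hasDerivAt_id s).const_mul 2).mul_const ((n:ℝ) + 1))).mul h0)
      refine (this.congr_deriv ?_)
      simp only [Nat.add_sub_cancel, id, show n + 1 - 2 = n - 1 by omega]
      rcases n with _ | n
      · simp [hP]; norm_num
      · have hr := hP_rec n s y
        simp only [Nat.add_sub_cancel, show n + 1 - 2 = n - 1 by omega]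
        rw [hr]; push_cast; ring

theorem hP_zero (n : ℕ) (y : ℝ) : hP n 0 y = y ^ n := by
  induction n with
  | zero => simp [hP]
  | succ n ih => rw [hP_rec, ih]; ring

theorem hP_cont (n : ℕ) : Continuous (fun p : ℝ × ℝ => hP n p.1 p.2) := by
  induction n using Nat.strong_induction_on with
  | _ n ih =>
    match n, ih with
    | 0, _ => simpa [hP] using continuous_const
    | 1, _ => simpa [hP] using continuous_snd
    | n + 2, ih =>
      have h1 := ih (n + 1) (by omega)
      have h0 := ih n (by omega)
      simp only [hP]; fun_prop

theorem hP_growth (n : ℕ) : ∃ C : ℝ, 0 ≤ C ∧ ∀ s y, |s| ≤ 1/2 → |hP n s y| ≤ C * (1 + |y|) ^ n := by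
  induction n using Nat.strong_induction_on with
  | _ n ih =>
    match n, ih with
    | 0, _ => exact ⟨1, by norm_num, by simp [hP]⟩
    | 1, _ => exact ⟨1, by norm_num, by intro s y _; simp [hP]⟩
    | n + 2, ih =>
      obtain ⟨C, hC, h1⟩ := ih (n + 1) (by omega)
      obtain ⟨D, hD, h0⟩ := ih n (by omega)
      refine ⟨C + (n + 1) * D, by positivity, fun s y hs => ?_⟩
      have a1 := h1 s y hs
      have a0 := h0 s y hs
      have hy : |y| ≤ 1 + |y| := by linarith
      have hy1 : 1 ≤ (1 + |y|) ^ 2 := by nlinarith [abs_nonneg y]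
      simp only [hP]
      calc |y * hP (n + 1) s y + 2 * s * (↑n + 1) * hP n s y|
          ≤ |y| * |hP (n+1) s y| + 2 * |s| * (n + 1) * |hP n s y| := by
            refine (abs_add_le _ _).trans (le_of_eq ?_)
            rw [abs_mul, abs_mul, abs_mul, abs_mul, abs_of_pos (show (0:ℝ) < n + 1 by positivity)]
            simp
        _ ≤ (1 + |y|) * (C * (1 + |y|) ^ (n + 1)) + 1 * (n + 1) * ((D * (1 + |y|) ^ n) * (1 + |y|)^2) := by
            have : |hP n s y| ≤ (D * (1 + |y|) ^ n) * (1 + |y|)^2 :=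
              a0.trans (le_mul_of_one_le_right (by positivity) hy1)
            gcongr
            linarith
        _ = _ := by ring

/-- Hermite functions -/
noncomputable def hn (n : ℕ) (y : ℝ) : ℝ := hP n (-1/2) y

theorem hn_zero : hn 0 = fun _ => 1 := by ext; simp [hn, hP]
theorem hn_one : hn 1 = fun y => y := by ext; simp [hn, hP]

theorem hn_rec (n : ℕ) (y : ℝ) : hn (n + 1) y = y * hn n y - n * hn (n - 1) y := by
  unfold hn; rw [hP_rec]; ring

theorem hn_deriv (n : ℕ) (y : ℝ) : HasDerivAt (hn n) (n * hn (n - 1) y) y := hP_dy n _ y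

theorem hn_PG (n : ℕ) : PG (hn n) := by
  obtain ⟨C, hC, h⟩ := hP_growth n
  exact ⟨(hP_cont n).comp (by fun_prop : Continuous fun y : ℝ => ((-1/2 : ℝ), y)), C, n, hC,
    fun y => h _ y (by norm_num [abs_of_neg])⟩

theorem J_hn_ibp {f f' : ℝ → ℝ} (hd : ∀ y, HasDerivAt f (f' y) y) (hf : PG f) (hf' : PG f') (n : ℕ) :
    J (fun y => f' y * hn n y) = J (fun y => f y * hn (n + 1) y) := by
  have h := J_ibp (f := fun y => f y * hn n y) (fun y => (hd y).mul (hn_deriv n y))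
    (hf.mul (hn_PG n)) ((hf'.mul (hn_PG n)).add (hf.mul ((hn_PG (n-1)).cmul n)))
  have e : (fun y => f y * hn (n+1) y) = fun y => y * (f y * hn n y) - f y * (n * hn (n-1) y) := by
    ext y; rw [hn_rec]; ring
  rw [J_add (hf'.mul (hn_PG n)) (hf.mul ((hn_PG (n-1)).cmul n))] at h
  rw [e, J_sub (PG.id.mul (hf.mul (hn_PG n))) (hf.mul ((hn_PG (n-1)).cmul n))]
  linarith

theorem gam_eq (y : ℝ) : gam y = ProbabilityTheory.gaussianPDFReal 0 1 y := by
  simp [gam, ProbabilityTheory.gaussianPDFReal]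

theorem J_one : J (fun _ => 1) = 1 := by
  unfold J
  simp only [one_mul, gam_eq]
  exact ProbabilityTheory.integral_gaussianPDFReal_eq_one 0 (by norm_num)

theorem J_hn_hn (m n : ℕ) : J (fun y => hn m y * hn n y) = if m = n then (n.factorial : ℝ) else 0 := by
  induction m generalizing n with
  | zero =>
    cases n with
    | zero => simp [hn_zero, J_one]
    | succ n =>
      rw [← J_hn_ibp (f' := fun _ => 0) (fun y => by rw [hn_zero]; exact hasDerivAt_const y 1) (hn_PG 0) (PG.const 0)]
      simp [J]
  | succ m ih =>
    cases n with
    | zero =>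
      have : (fun y => hn (m+1) y * hn 0 y) = fun y => hn 0 y * hn (m+1) y := by ext; ring
      rw [this, ← J_hn_ibp (f' := fun _ => 0) (fun y => by rw [hn_zero]; exact hasDerivAt_const y 1) (hn_PG 0) (PG.const 0)]
      simp [J]
    | succ n =>
      rw [← J_hn_ibp (hn_deriv (m+1)) (hn_PG _) ((hn_PG _).cmul _)]
      simp only [mul_assoc, Nat.add_sub_cancel]
      rw [J_cmul, ih]
      by_cases h : m = n
      · subst h; simp [Nat.factorial_succ]
      · simp [h]

open ProbabilityTheory in
theorem int_gauss (f : ℝ → ℝ) : ∫ y, f y ∂(gaussianReal 0 1) = J f := by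
  rw [integral_gaussianReal_eq_integral_smul (by norm_num)]
  unfold J
  congr 1; ext y; rw [gam_eq]; simp [mul_comm]

theorem char_zero {μ : Measure ℝ} [IsFiniteMeasure μ] {g : ℝ → ℝ} (hg : Integrable g μ)
    (h : ∀ ξ : ℝ, ∫ y, Complex.exp (ξ * y * Complex.I) * (g y : ℂ) ∂μ = 0) : g =ᵐ[μ] 0 := by
  set ν₁ := μ.withDensity (fun y => ENNReal.ofReal (g y))
  set ν₂ := μ.withDensity (fun y => ENNReal.ofReal (- g y))
  have : IsFiniteMeasure ν₁ := isFiniteMeasure_withDensity_ofReal hg.2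
  have : IsFiniteMeasure ν₂ := isFiniteMeasure_withDensity_ofReal hg.neg.2
  have hm : AEMeasurable g μ := hg.1.aemeasurable
  have hm' : AEMeasurable (fun y => - g y) μ := hm.neg
  have e : ν₁ = ν₂ := by
    apply Measure.ext_of_charFun
    ext ξ
    rw [charFun_apply_real, charFun_apply_real]
    have hi : ∀ f : ℝ → ℝ, Integrable f μ → Integrable (fun y => (ENNReal.ofReal (f y)).toReal •
        Complex.exp (ξ * y * Complex.I)) μ := by
      intro f hf
      have hfm : AEMeasurable f μ := hf.1.aemeasurable
      refine hf.norm.mono' ?_ (ae_of_all _ fun y => ?_)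
      · exact hfm.ennreal_ofReal.ennreal_toReal.aestronglyMeasurable.smul
          (by fun_prop : Continuous fun y : ℝ => Complex.exp (ξ * y * Complex.I)).aestronglyMeasurable
      · rw [norm_smul, ← Complex.ofReal_mul, Complex.norm_exp_ofReal_mul_I, mul_one, ENNReal.toReal_ofReal',
          Real.norm_of_nonneg (le_max_right _ _)]
        exact max_le (le_abs_self _) (abs_nonneg _)
    rw [integral_withDensity_eq_integral_toReal_smul₀ hm.ennreal_ofReal (by simp),
      integral_withDensity_eq_integral_toReal_smul₀ hm'.ennreal_ofReal (by simp)]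
    rw [← sub_eq_zero, ← integral_sub (hi g hg) (hi (fun y => - g y) hg.neg), ← h ξ]
    congr 1; ext y
    simp only [ENNReal.toReal_ofReal']
    rw [← sub_smul]
    have : max (g y) 0 - max (-g y) 0 = g y := by
      rcases le_total 0 (g y) with h0 | h0 <;> simp [h0]
    rw [this]; simp [mul_comm]
  replace e := (withDensity_eq_iff_of_sigmaFinite hm.ennreal_ofReal hm'.ennreal_ofReal).1 e
  filter_upwards [e] with y hy
  rcases lt_trichotomy (g y) 0 with h0 | h0 | h0
  · rw [ENNReal.ofReal_of_nonpos h0.le] at hy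
    have := ENNReal.ofReal_pos.2 (show 0 < - g y by linarith)
    simp at hy; linarith
  · simpa using h0
  · simp [ENNReal.ofReal_of_nonpos (show - g y ≤ 0 by linarith)] at hy; linarith

open ProbabilityTheory in
theorem exp_abs_memLp (ξ : ℝ) : MemLp (fun y : ℝ => Real.exp |ξ * y|) 2 (gaussianReal 0 1) := by
  rw [memLp_two_iff_integrable_sq (by fun_prop)]
  have h1 := integrable_exp_mul_gaussianReal (μ := 0) (v := 1) (2 * ξ)
  have h2 := integrable_exp_mul_gaussianReal (μ := 0) (v := 1) (-(2 * ξ))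
  refine (h1.add h2).mono' (by fun_prop) (ae_of_all _ fun y => ?_)
  rw [Real.norm_of_nonneg (by positivity), ← Real.exp_nat_mul]
  simp only [Pi.add_apply]
  rcases abs_cases (ξ * y) with ⟨h, _⟩ | ⟨h, _⟩ <;> rw [h]
  · have := Real.exp_pos (-(2 * ξ) * y)
    have e : ((2:ℕ):ℝ) * (ξ * y) = 2 * ξ * y := by push_cast; ring
    rw [e]; linarith
  · have := Real.exp_pos ((2 * ξ) * y)
    have e : ((2:ℕ):ℝ) * (-(ξ * y)) = -(2 * ξ) * y := by push_cast; ring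
    rw [e]; linarith

open ProbabilityTheory in
theorem poly_complete {f : ℝ → ℝ} (hf : MemLp f 2 (gaussianReal 0 1))
    (h : ∀ n : ℕ, ∫ y, f y * y ^ n ∂(gaussianReal 0 1) = 0) : f =ᵐ[gaussianReal 0 1] 0 := by
  have hint : Integrable f (gaussianReal 0 1) := hf.integrable (by norm_num)
  apply char_zero hint
  intro ξ
  have hb : Integrable (fun y => |f y| * Real.exp |ξ * y|) (gaussianReal 0 1) :=
    hf.norm.integrable_mul (exp_abs_memLp ξ)
  have hs := hasSum_integral_of_dominated_convergence (μ := gaussianReal 0 1)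
    (F := fun (n : ℕ) (y : ℝ) => ((ξ * y * Complex.I) ^ n / (n.factorial : ℂ)) * (f y : ℂ))
    (f := fun y => Complex.exp (ξ * y * Complex.I) * (f y : ℂ))
    (bound := fun n y => |f y| * (|ξ * y| ^ n / n.factorial))
    (fun n => by
      refine AEStronglyMeasurable.mul (by fun_prop) ?_
      exact Complex.continuous_ofReal.comp_aestronglyMeasurable hf.1)
    (fun n => ae_of_all _ fun y => by
      simp [abs_mul, mul_comm, mul_pow])
    (ae_of_all _ fun y => (Real.summable_pow_div_factorial _).mul_left _)
    (by
      refine hb.congr (ae_of_all _ fun y => ?_)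
      simp only
      rw [tsum_mul_left, Real.exp_eq_exp_ℝ, NormedSpace.exp_eq_tsum_div])
    (ae_of_all _ fun y => by
      apply HasSum.mul_right
      rw [Complex.exp_eq_exp_ℂ]
      exact NormedSpace.expSeries_div_hasSum_exp _)
  have hz : ∀ n : ℕ, ∫ y, ((ξ * y * Complex.I) ^ n / (n.factorial : ℂ)) * (f y : ℂ) ∂(gaussianReal 0 1) = 0 := by
    intro n
    have : (fun y : ℝ => ((ξ * y * Complex.I) ^ n / (n.factorial : ℂ)) * (f y : ℂ)) =
        fun y => ((ξ * Complex.I) ^ n / (n.factorial : ℂ)) * ((f y * y ^ n : ℝ) : ℂ) := by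
      ext y; push_cast; ring
    rw [this, integral_const_mul, integral_complex_ofReal, h n]; simp
  simp only [hz] at hs
  exact hs.unique hasSum_zero

end

section
open Real Set Filter MeasureTheory Topology ProbabilityTheory

theorem PG.int_gauss {f : ℝ → ℝ} (hf : PG f) : Integrable f (gaussianReal 0 1) := by
  rw [gaussianReal_of_var_ne_zero _ (by norm_num),
    integrable_withDensity_iff_integrable_smul' (by fun_prop) (ae_of_all _ fun _ => gaussianPDF_lt_top)]
  refine hf.integrable.congr (ae_of_all _ fun y => ?_)
  simp [gaussianPDF, gam_eq, ENNReal.toReal_ofReal (gaussianPDFReal_nonneg _ _ _), mul_comm]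

theorem PG.memLp {f : ℝ → ℝ} (hf : PG f) : MemLp f 2 (gaussianReal 0 1) :=
  (memLp_two_iff_integrable_sq hf.cont.aestronglyMeasurable).2 hf.sq.int_gauss

noncomputable def toL {f : ℝ → ℝ} (hf : PG f) : Lp ℝ 2 (gaussianReal 0 1) := hf.memLp.toLp f

theorem inner_toL {f g : ℝ → ℝ} (hf : PG f) (hg : PG g) :
    inner ℝ (toL hf) (toL hg) = J (fun y => f y * g y) := by
  rw [L2.inner_def, ← int_gauss]
  apply integral_congr_ae
  filter_upwards [hf.memLp.coeFn_toLp, hg.memLp.coeFn_toLp] with y h1 h2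
  simp [toL, h1, h2, mul_comm]

noncomputable def eb (n : ℕ) : Lp ℝ 2 (gaussianReal 0 1) := (Real.sqrt n.factorial)⁻¹ • toL (hn_PG n)

theorem eb_ortho : Orthonormal ℝ eb := by
  rw [orthonormal_iff_ite]
  intro i j
  unfold eb
  rw [inner_smul_left, inner_smul_right, inner_toL, J_hn_hn]
  split_ifs with h
  · subst h
    have : (0:ℝ) < (i.factorial : ℝ) := by positivity
    have h2 := Real.mul_self_sqrt this.le
    have h3 := Real.sqrt_pos.2 this
    simp
    field_simp
    nlinarith
  · simp

theorem eb_complete : (Submodule.span ℝ (Set.range eb))ᗮ = ⊥ := by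
  rw [Submodule.eq_bot_iff]
  intro x hx
  rw [Submodule.mem_orthogonal] at hx
  have hxm : MemLp x 2 (gaussianReal 0 1) := Lp.memLp x
  have hxi : ∀ f : ℝ → ℝ, PG f → Integrable (fun y => x y * f y) (gaussianReal 0 1) :=
    fun f hf => hxm.integrable_mul hf.memLp
  have h1 : ∀ m, ∫ y, x y * hn m y ∂(gaussianReal 0 1) = 0 := by
    intro m
    have := hx (eb m) (Submodule.subset_span ⟨m, rfl⟩)
    unfold eb at this
    rw [inner_smul_left] at this
    have h0 : (0:ℝ) < (m.factorial : ℝ) := by positivity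
    have h3 := Real.sqrt_pos.2 h0
    rcases mul_eq_zero.1 this with h | h
    · simp at h; exact absurd h (by positivity)
    · rw [L2.inner_def] at h
      refine Eq.trans ?_ h
      apply integral_congr_ae
      filter_upwards [(hn_PG m).memLp.coeFn_toLp] with y h1
      simp [toL, h1]
  have pw : ∀ n m, PG (fun y => y ^ n * hn m y) := by
    intro n m
    refine PG.mul ?_ (hn_PG m)
    induction n with
    | zero => simpa using PG.const 1
    | succ n ih => simpa [pow_succ] using ih.mul PG.id
  have h2 : ∀ n m, ∫ y, x y * (y ^ n * hn m y) ∂(gaussianReal 0 1) = 0 := by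
    intro n
    induction n with
    | zero => intro m; simpa using h1 m
    | succ n ih =>
      intro m
      have e : (fun y => x y * (y ^ (n+1) * hn m y)) = fun y => x y * (y ^ n * hn (m+1) y) +
          m * (x y * (y ^ n * hn (m-1) y)) := by
        ext y; rw [hn_rec]; ring
      rw [e, integral_add (hxi _ (pw _ _)) ((hxi _ (pw _ _)).const_mul _), integral_const_mul, ih, ih]
      simp
  have h3 := poly_complete hxm (fun n => by simpa [hn_zero] using h2 n 0)
  exact (Lp.eq_zero_iff_ae_eq_zero).2 h3

theorem parseval {f : ℝ → ℝ} (hf : PG f) :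
    HasSum (fun j : ℕ => (J fun y => f y * hn j y) ^ 2 / j.factorial) (J fun y => f y ^ 2) := by
  have h := (HilbertBasis.mkOfOrthogonalEqBot eb_ortho eb_complete).hasSum_inner_mul_inner (toL hf) (toL hf)
  rw [inner_toL] at h
  have e2 : (fun y => f y ^ 2) = fun y => f y * f y := by ext y; ring
  rw [e2]
  suffices e1 : ∀ j : ℕ, (J fun y => f y * hn j y) ^ 2 / j.factorial = inner ℝ (toL hf) ((HilbertBasis.mkOfOrthogonalEqBot eb_ortho eb_complete) j) * inner ℝ ((HilbertBasis.mkOfOrthogonalEqBot eb_ortho eb_complete) j) (toL hf) by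
    simpa only [e1] using h
  intro j
  rw [HilbertBasis.coe_mkOfOrthogonalEqBot]
  unfold eb
  rw [inner_smul_left, inner_smul_right, inner_toL, inner_toL]
  have h0 : (0:ℝ) < (j.factorial : ℝ) := by positivity
  have h2 := Real.mul_self_sqrt h0.le
  have h3 := Real.sqrt_pos.2 h0
  have e : (fun y => hn j y * f y) = fun y => f y * hn j y := by ext; ring
  rw [e]
  simp only [RCLike.conj_to_real]
  rw [← h2]
  field_simp
  simp [h2]

theorem gap {f f' : ℝ → ℝ} (hd : ∀ y, HasDerivAt f (f' y) y) (hf : PG f) (hf' : PG f') (n : ℕ) :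
    (J fun y => f y ^ 2) - ∑ j ∈ Finset.range (n + 1), (J fun y => f y * hn j y) ^ 2 / j.factorial
      ≤ (J fun y => f' y ^ 2) / (n + 1) := by
  have h1 := parseval hf
  have h2 := parseval hf'
  simp only [J_hn_ibp hd hf hf'] at h2
  have h3 := (hasSum_nat_add_iff' (n+1)).2 h1
  have h4 := (h2.div_const ((n:ℝ)+1))
  have h5 : ∀ j : ℕ, 0 ≤ (J fun y => f y * hn (j + 1) y) ^ 2 / j.factorial / ((n:ℝ)+1) := fun j => by positivity
  have h6 : ∑ j ∈ Finset.range n, (J fun y => f y * hn (j + 1) y) ^ 2 / j.factorial / ((n:ℝ)+1) ≥ 0 :=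
    Finset.sum_nonneg fun j _ => h5 j
  have h7 := (hasSum_nat_add_iff' n).2 h4
  have h8 := hasSum_le (fun j => ?_) h3 h7
  · linarith
  · rw [show j + (n + 1) = (j + n) + 1 by ring, Nat.factorial_succ, div_div]
    apply div_le_div_of_nonneg_left (sq_nonneg _) (by positivity)
    push_cast
    have : (0:ℝ) < (j+n).factorial := by positivity
    have : (0:ℝ) ≤ j := by positivity
    nlinarith

end

section
open Real Set Filter MeasureTheory Topology

theorem J_hasDerivAt {F F' : ℝ → ℝ → ℝ} {τ0 τ C : ℝ} {n : ℕ} (hτ : τ0 < τ)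
    (hF : ∀ σ > τ0, PG (F σ)) (hF' : Continuous (F' τ))
    (hd : ∀ σ > τ0, ∀ y, HasDerivAt (fun s => F s y) (F' σ y) σ)
    (hb : ∀ σ > τ0, ∀ y, |F' σ y| ≤ C * (1 + |y|) ^ n) :
    HasDerivAt (fun σ => J (F σ)) (J (F' τ)) τ := by
  refine (hasDerivAt_integral_of_dominated_loc_of_deriv_le (μ := volume) (F := fun σ y => F σ y * gam y)
    (F' := fun σ y => F' σ y * gam y) (s := Ioi τ0) (bound := fun y => C * ((1 + |y|) ^ n * gam y))
    (Ioi_mem_nhds hτ) ?_ ?_ ?_ ?_ ?_ ?_).2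
  · filter_upwards [Ioi_mem_nhds hτ] with σ hσ
    exact (hF σ hσ).integrable.aestronglyMeasurable
  · exact (hF τ hτ).integrable
  · exact (hF'.mul gam_cont).aestronglyMeasurable
  · refine ae_of_all _ fun y σ hσ => ?_
    rw [norm_mul, Real.norm_eq_abs, Real.norm_of_nonneg (gam_pos y).le, ← mul_assoc]
    exact mul_le_mul_of_nonneg_right (hb σ hσ y) (gam_pos y).le
  · exact (integrable_poly_gam n).const_mul C
  · exact ae_of_all _ fun y σ hσ => (hd σ hσ y).mul_const _

structure RS (v vy vyy vt : ℝ → ℝ → ℝ) (τ0 M L : ℝ) : Prop where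
  h0 : 0 ≤ τ0
  hM : 0 ≤ M
  hL : 0 ≤ L
  dt : ∀ τ > τ0, ∀ y, HasDerivAt (fun σ => v σ y) (vt τ y) τ
  dy : ∀ τ > τ0, ∀ y, HasDerivAt (v τ) (vy τ y) y
  dyy : ∀ τ > τ0, ∀ y, HasDerivAt (vy τ) (vyy τ y) y
  ct : ∀ τ > τ0, Continuous (vt τ)
  cyy : ∀ τ > τ0, Continuous (vyy τ)
  cy1 : ∀ τ > τ0, ∀ y, ContinuousAt (fun σ => vy σ y) τ
  cyy1 : ∀ τ > τ0, ∀ y, ContinuousAt (fun σ => vyy σ y) τ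
  b : ∀ τ > τ0, ∀ y, |v τ y| ≤ M
  by' : ∀ τ > τ0, ∀ y, |vy τ y| ≤ M
  byy : ∀ τ > τ0, ∀ y, |vyy τ y| ≤ M
  bt : ∀ τ > τ0, ∀ y, |vt τ y| ≤ M * (1 + |y|)
  bφ : ∀ τ > τ0, ∀ y, |vt τ y - (vyy τ y - y * vy τ y)| ≤ L * exp (-τ) * (|v τ y| + |vy τ y|)
  nz : ∀ τ > τ0, ∃ y, v τ y ≠ 0
  dec : ∀ τ > τ0, ∀ y, |v τ y| ≤ M * exp (-(2 * τ)) * (1 + |y|) ^ 2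

namespace RS
variable {v vy vyy vt : ℝ → ℝ → ℝ} {τ0 M L : ℝ}

theorem pv (h : RS v vy vyy vt τ0 M L) {τ : ℝ} (hτ : τ0 < τ) : PG (v τ) :=
  PG.of_bdd (continuous_iff_continuousAt.2 fun y => (h.dy τ hτ y).continuousAt) M (h.b τ hτ)
theorem pvy (h : RS v vy vyy vt τ0 M L) {τ : ℝ} (hτ : τ0 < τ) : PG (vy τ) :=
  PG.of_bdd (continuous_iff_continuousAt.2 fun y => (h.dyy τ hτ y).continuousAt) M (h.by' τ hτ)
theorem pvyy (h : RS v vy vyy vt τ0 M L) {τ : ℝ} (hτ : τ0 < τ) : PG (vyy τ) :=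
  PG.of_bdd (h.cyy τ hτ) M (h.byy τ hτ)
theorem pvt (h : RS v vy vyy vt τ0 M L) {τ : ℝ} (hτ : τ0 < τ) : PG (vt τ) :=
  PG.of_lin (h.ct τ hτ) M (h.bt τ hτ)
theorem pLv (h : RS v vy vyy vt τ0 M L) {τ : ℝ} (hτ : τ0 < τ) : PG (fun y => vyy τ y - y * vy τ y) :=
  (h.pvyy hτ).sub (PG.id.mul (h.pvy hτ))
theorem pφ (h : RS v vy vyy vt τ0 M L) {τ : ℝ} (hτ : τ0 < τ) :
    PG (fun y => vt τ y - (vyy τ y - y * vy τ y)) := (h.pvt hτ).sub (h.pLv hτ)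
end RS

theorem J_weak {f f' g' g'' : ℝ → ℝ} (hf : ∀ y, HasDerivAt f (f' y) y) (hg : ∀ y, HasDerivAt g' (g'' y) y)
    (p1 : PG f) (p2 : PG f') (p3 : PG g') (p4 : PG g'') :
    J (fun y => f y * (g'' y - y * g' y)) = - J (fun y => f' y * g' y) := by
  have h := J_ibp (f := fun y => f y * g' y) (fun y => (hf y).mul (hg y)) (p1.mul p3)
    ((p2.mul p3).add (p1.mul p4))
  rw [J_add (p2.mul p3) (p1.mul p4)] at h
  have e : (fun y => f y * (g'' y - y * g' y)) = fun y => f y * g'' y - y * (f y * g' y) := by ext; ring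
  rw [e, J_sub (p1.mul p4) (PG.id.mul (p1.mul p3))]
  linarith

/-- energy quantities -/
noncomputable def HH (v : ℝ → ℝ → ℝ) (τ : ℝ) : ℝ := J (fun y => v τ y ^ 2)
noncomputable def aa (v : ℝ → ℝ → ℝ) (j : ℕ) (τ : ℝ) : ℝ := J (fun y => v τ y * hn j y)

namespace RS
variable {v vy vyy vt : ℝ → ℝ → ℝ} {τ0 M L : ℝ}

theorem Hpos (h : RS v vy vyy vt τ0 M L) {τ : ℝ} (hτ : τ0 < τ) : 0 < HH v τ := by
  obtain ⟨y, hy⟩ := h.nz τ hτ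
  exact J_pos (h.pv hτ).sq (fun y => sq_nonneg _) ⟨y, by positivity⟩

theorem dH (h : RS v vy vyy vt τ0 M L) {τ : ℝ} (hτ : τ0 < τ) :
    HasDerivAt (HH v) (2 * J (fun y => v τ y * vt τ y)) τ := by
  have := J_hasDerivAt (F := fun σ y => v σ y ^ 2) (F' := fun σ y => 2 * (v σ y * vt σ y)) (C := 2 * (M * M)) (n := 1)
    hτ (fun σ hσ => (h.pv hσ).sq) (((h.pv hτ).mul (h.pvt hτ)).cmul 2).cont
    (fun σ hσ y => ((h.dt σ hσ y).pow 2).congr_deriv (by simp; ring)) (fun σ hσ y => by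
      rw [abs_mul, abs_mul, abs_two, mul_assoc, mul_assoc]
      have := mul_le_mul (h.b σ hσ y) (h.bt σ hσ y) (abs_nonneg _) h.hM
      simp only [pow_one]
      linarith)
  rw [J_cmul] at this
  exact this

theorem da (h : RS v vy vyy vt τ0 M L) (j : ℕ) {τ : ℝ} (hτ : τ0 < τ) :
    HasDerivAt (aa v j) (J (fun y => vt τ y * hn j y)) τ := by
  obtain ⟨cj, C, n, hC, hb⟩ := hn_PG j
  refine J_hasDerivAt (F := fun σ y => v σ y * hn j y) (F' := fun σ y => vt σ y * hn j y) (C := M * C) (n := n + 1)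
    hτ (fun σ hσ => (h.pv hσ).mul (hn_PG j)) ((h.pvt hτ).mul (hn_PG j)).cont
    (fun σ hσ y => (h.dt σ hσ y).mul_const _) (fun σ hσ y => ?_)
  rw [abs_mul]
  have := mul_le_mul (h.bt σ hσ y) (hb y) (abs_nonneg _) (mul_nonneg h.hM (by positivity))
  calc _ ≤ _ := this
    _ = _ := by ring

theorem Ddiff (h : RS v vy vyy vt τ0 M L) {τ σ : ℝ} (hτ : τ0 < τ) (hσ : τ0 < σ) :
    HH vy σ - HH vy τ = - J (fun y => (v σ y - v τ y) *
      ((vyy σ y - y * vy σ y) + (vyy τ y - y * vy τ y))) := by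
  have p1 := (h.pv hσ).sub (h.pv hτ)
  have p2 := (h.pvy hσ).sub (h.pvy hτ)
  have p3 := (h.pvy hσ).add (h.pvy hτ)
  have p4 := (h.pvyy hσ).add (h.pvyy hτ)
  have := J_weak (f := fun y => v σ y - v τ y) (g' := fun y => vy σ y + vy τ y) (fun y => (h.dy σ hσ y).sub (h.dy τ hτ y)) (fun y => (h.dyy σ hσ y).add (h.dyy τ hτ y)) p1 p2 p3 p4
  have e : (fun y => (v σ y - v τ y) *
      ((vyy σ y - y * vy σ y) + (vyy τ y - y * vy τ y))) = fun y => (v σ y - v τ y) * (vyy σ y + vyy τ y - y * (vy σ y + vy τ y)) := by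
    ext; ring
  rw [e]
  unfold HH
  rw [← J_sub (h.pvy hσ).sq (h.pvy hτ).sq]
  have e3 : (fun y => vy σ y ^ 2 - vy τ y ^ 2) = fun y => (vy σ y - vy τ y) * (vy σ y + vy τ y) := by ext; ring
  rw [e3]
  linarith

theorem vlip (h : RS v vy vyy vt τ0 M L) {τ σ : ℝ} (hτ : τ0 < τ) (hσ : τ0 < σ) (y : ℝ) :
    |v σ y - v τ y| ≤ M * (1 + |y|) * |σ - τ| := by
  have := (convex_Ioi τ0).norm_image_sub_le_of_norm_hasDerivWithin_le (f := fun s => v s y) (f' := fun s => vt s y)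
    (C := M * (1 + |y|)) (x := τ) (y := σ) (fun x hx => (h.dt x hx y).hasDerivWithinAt) (fun x hx => h.bt x hx y) hτ hσ
  simpa using this

theorem dD (h : RS v vy vyy vt τ0 M L) {τ : ℝ} (hτ : τ0 < τ) :
    HasDerivAt (HH vy) (-2 * J (fun y => (vyy τ y - y * vy τ y) * vt τ y)) τ := by
  rw [hasDerivAt_iff_tendsto_slope]
  have key : Tendsto (fun σ => J (fun y => ((σ - τ)⁻¹ * (v σ y - v τ y)) *
      ((vyy σ y - y * vy σ y) + (vyy τ y - y * vy τ y)))) (𝓝[≠] τ)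
      (𝓝 (J (fun y => vt τ y * ((vyy τ y - y * vy τ y) + (vyy τ y - y * vy τ y))))) := by
    have hev : ∀ᶠ σ in 𝓝[≠] τ, τ0 < σ ∧ σ ≠ τ := by
      refine Filter.Eventually.and ?_ self_mem_nhdsWithin
      exact mem_nhdsWithin_of_mem_nhds (Ioi_mem_nhds hτ)
    refine tendsto_integral_filter_of_dominated_convergence (fun y => (2 * (M * M)) * ((1 + |y|) ^ 2 * gam y)) ?_ ?_ ?_ ?_
    · filter_upwards [hev] with σ hσ
      exact ((((h.pv hσ.1).sub (h.pv hτ)).cmul _).mul ((h.pLv hσ.1).add (h.pLv hτ))).integrable.aestronglyMeasurable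
    · filter_upwards [hev] with σ hσ
      refine ae_of_all _ fun y => ?_
      rw [norm_mul, Real.norm_of_nonneg (gam_pos y).le, ← mul_assoc]
      refine mul_le_mul_of_nonneg_right ?_ (gam_pos y).le
      rw [Real.norm_eq_abs, abs_mul, abs_mul, abs_inv]
      have h1 : |σ - τ|⁻¹ * |v σ y - v τ y| ≤ M * (1 + |y|) := by
        have h2 : 0 < |σ - τ| := abs_pos.2 (sub_ne_zero.2 hσ.2)
        rw [inv_mul_le_iff₀ h2]
        linarith [h.vlip hτ hσ.1 y]
      have h3 : ∀ s > τ0, |vyy s y - y * vy s y| ≤ M * (1 + |y|) := by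
        intro s hs
        have := abs_sub (vyy s y) (y * vy s y)
        rw [abs_mul] at this
        have := h.byy s hs y
        have := mul_le_mul_of_nonneg_left (h.by' s hs y) (abs_nonneg y)
        linarith
      have h4 : |vyy σ y - y * vy σ y + (vyy τ y - y * vy τ y)| ≤ 2 * (M * (1 + |y|)) := by
        have := abs_add_le (vyy σ y - y * vy σ y) (vyy τ y - y * vy τ y)
        linarith [h3 σ hσ.1, h3 τ hτ]
      calc _ ≤ _ := mul_le_mul h1 h4 (abs_nonneg _) (mul_nonneg h.hM (by positivity))
        _ = _ := by ring
    · exact (integrable_poly_gam 2).const_mul _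
    · refine ae_of_all _ fun y => ?_
      refine Tendsto.mul_const _ (Tendsto.mul ?_ (Tendsto.add_const _ ?_))
      · have := (hasDerivAt_iff_tendsto_slope.1 (h.dt τ hτ y))
        refine this.congr fun σ => ?_
        rw [slope_def_field]; ring
      · exact (((h.cyy1 τ hτ y).sub ((h.cy1 τ hτ y).const_mul y)).tendsto).mono_left nhdsWithin_le_nhds
  have e : -2 * J (fun y => (vyy τ y - y * vy τ y) * vt τ y) =
      -(J (fun y => vt τ y * ((vyy τ y - y * vy τ y) + (vyy τ y - y * vy τ y)))) := by
    rw [← J_cmul, ← neg_one_mul (J _), ← J_cmul]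
    congr 1; ext y; ring
  rw [e]
  refine key.neg.congr' ?_
  filter_upwards [self_mem_nhdsWithin, mem_nhdsWithin_of_mem_nhds (Ioi_mem_nhds hτ)] with σ h1 h2
  rw [slope_def_field, h.Ddiff hτ h2, div_eq_inv_mul, mul_neg, ← J_cmul]
  congr 2; ext y; ring

end RS

end

section
open Real Set Filter MeasureTheory Topology

namespace RS
variable {v vy vyy vt : ℝ → ℝ → ℝ} {τ0 M L : ℝ}

theorem Dnn (vy : ℝ → ℝ → ℝ) (τ : ℝ) : 0 ≤ HH vy τ := J_nonneg fun y => sq_nonneg _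

theorem FF_le (h : RS v vy vyy vt τ0 M L) {τ : ℝ} (hτ : τ0 < τ) :
    J (fun y => (vt τ y - (vyy τ y - y * vy τ y)) ^ 2) ≤ 2 * L ^ 2 * exp (-(2 * τ)) * (HH v τ + HH vy τ) := by
  unfold HH
  rw [← J_add (h.pv hτ).sq (h.pvy hτ).sq, ← J_cmul]
  refine J_mono (h.pφ hτ).sq (((h.pv hτ).sq.add (h.pvy hτ).sq).cmul _) fun y => ?_
  have h1 := h.bφ τ hτ y
  rw [← sq_abs]
  have h2 : exp (-(2 * τ)) = exp (-τ) ^ 2 := by rw [← exp_nat_mul]; congr 1; push_cast; ring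
  rw [h2]
  calc |vt τ y - (vyy τ y - y * vy τ y)| ^ 2 ≤ (L * exp (-τ) * (|v τ y| + |vy τ y|)) ^ 2 :=
        pow_le_pow_left₀ (abs_nonneg _) h1 2
    _ = (L * exp (-τ)) ^ 2 * (|v τ y| + |vy τ y|) ^ 2 := by ring
    _ ≤ (L * exp (-τ)) ^ 2 * (2 * (v τ y ^ 2 + vy τ y ^ 2)) := by
        refine mul_le_mul_of_nonneg_left ?_ (sq_nonneg _)
        rw [← sq_abs (v τ y), ← sq_abs (vy τ y)]
        nlinarith [sq_nonneg (|v τ y| - |vy τ y|)]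
    _ = _ := by ring

theorem vLv (h : RS v vy vyy vt τ0 M L) {τ : ℝ} (hτ : τ0 < τ) :
    J (fun y => v τ y * (vyy τ y - y * vy τ y)) = - HH vy τ := by
  rw [J_weak (h.dy τ hτ) (h.dyy τ hτ) (h.pv hτ) (h.pvy hτ) (h.pvy hτ) (h.pvyy hτ)]
  simp only [HH, pow_two]

theorem dH2 (h : RS v vy vyy vt τ0 M L) {τ : ℝ} (hτ : τ0 < τ) :
    HasDerivAt (HH v) (-2 * HH vy τ + 2 * J (fun y => v τ y * (vt τ y - (vyy τ y - y * vy τ y)))) τ := by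
  refine (h.dH hτ).congr_deriv ?_
  have e : (fun y => v τ y * vt τ y) = fun y => v τ y * (vyy τ y - y * vy τ y) +
    v τ y * (vt τ y - (vyy τ y - y * vy τ y)) := by ext; ring
  rw [e, J_add ((h.pv hτ).mul (h.pLv hτ)) ((h.pv hτ).mul (h.pφ hτ)), h.vLv hτ]
  ring

theorem E_le (h : RS v vy vyy vt τ0 M L) {τ : ℝ} (hτ : τ0 < τ) :
    (J (fun y => v τ y * (vt τ y - (vyy τ y - y * vy τ y)))) ^ 2 ≤
      HH v τ * (2 * L ^ 2 * exp (-(2 * τ)) * (HH v τ + HH vy τ)) :=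
  (J_cs (h.pv hτ) (h.pφ hτ)).trans (mul_le_mul_of_nonneg_left (h.FF_le hτ) (h.Hpos hτ).le)

theorem dN (h : RS v vy vyy vt τ0 M L) {τ : ℝ} (hτ : τ0 < τ) :
    ∃ d, HasDerivAt (fun σ => HH vy σ / HH v σ) d τ ∧ d ≤ L ^ 2 * exp (-(2 * τ)) * (1 + HH vy τ / HH v τ) := by
  have hH := h.Hpos hτ
  refine ⟨_, (h.dD hτ).div (h.dH2 hτ) hH.ne', ?_⟩
  set φ := fun y => vt τ y - (vyy τ y - y * vy τ y) with hφ
  set l := fun y => vyy τ y - y * vy τ y with hl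
  have pφ : PG φ := h.pφ hτ
  have pl : PG l := h.pLv hτ
  have pv := h.pv hτ
  have hF := h.FF_le hτ
  set H := HH v τ with hHdef
  set D := HH vy τ with hDdef
  have e1 : (fun y => (vyy τ y - y * vy τ y) * vt τ y) = fun y => l y ^ 2 + l y * φ y := by
    ext y; simp only [hφ, hl]; ring
  set N := D / H with hN
  have hD : D = N * H := by rw [hN]; field_simp
  have e2 : J (fun y => (l y + N * v τ y) ^ 2) = J (fun y => l y ^ 2) - N * D := by
    have e : (fun y => (l y + N * v τ y) ^ 2) = fun y => l y ^ 2 + ((2 * N) * (v τ y * l y) + N ^ 2 * v τ y ^ 2) := by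
      ext y; ring
    rw [e, J_add pl.sq (((pv.mul pl).cmul _).add (pv.sq.cmul _)), J_add ((pv.mul pl).cmul _) (pv.sq.cmul _),
      J_cmul, J_cmul]
    have := h.vLv hτ
    change J (fun y => v τ y * l y) = _ at this
    rw [this]
    change _ + (_ + N ^ 2 * H) = _
    change _ + (2 * N * -D + N ^ 2 * H) = _
    rw [hD]; ring
  have e3 : J (fun y => (l y + N * v τ y) * φ y) = J (fun y => l y * φ y) + N * J (fun y => v τ y * φ y) := by
    have e : (fun y => (l y + N * v τ y) * φ y) = fun y => l y * φ y + N * (v τ y * φ y) := by ext; ring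
    rw [e, J_add (pl.mul pφ) ((pv.mul pφ).cmul _), J_cmul]
  have cs := J_cs (pl.add (pv.cmul N)) pφ
  rw [e2, e3] at cs
  rw [e1, J_add pl.sq (pl.mul pφ)]
  change J (fun y => φ y ^ 2) ≤ _ at hF
  have X0 : 0 ≤ J (fun y => l y ^ 2) - N * D := by rw [← e2]; exact J_nonneg fun y => sq_nonneg _
  have F0 : 0 ≤ J (fun y => φ y ^ 2) := J_nonneg fun y => sq_nonneg _
  set A := J (fun y => l y ^ 2)
  set B := J (fun y => l y * φ y)
  set F := J (fun y => φ y ^ 2)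
  change (-2 * (A + B) * H - D * (-2 * D + 2 * J (fun y => v τ y * φ y))) / H ^ 2 ≤ _
  set E := J (fun y => v τ y * φ y)
  have key : -(B + N * E) ≤ (A - N * D) + F / 4 := by
    have := abs_le_of_sq_le_sq (a := B + N * E) (b := (A - N * D) + F / 4)
      (by nlinarith [sq_nonneg ((A - N * D) - F / 4)]) (by positivity)
    linarith [neg_abs_le (B + N * E)]
  have e4 : (-2 * (A + B) * H - D * (-2 * D + 2 * E)) / H ^ 2 = -2 * ((A - N * D) + (B + N * E)) / H := by
    rw [div_eq_div_iff (by positivity) (by positivity), hD]; ring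
  rw [e4, div_le_iff₀ hH]
  have : L ^ 2 * exp (-(2 * τ)) * (1 + N) * H = L ^ 2 * exp (-(2 * τ)) * (H + D) := by rw [hD]; ring
  rw [this]
  linarith

theorem Nlim (h : RS v vy vyy vt τ0 M L) :
    ∃ N0 : ℝ, Tendsto (fun τ => HH vy τ / HH v τ) atTop (𝓝 N0) := by
  set N := fun τ => HH vy τ / HH v τ with hN
  have hN0 : ∀ τ > τ0, 0 ≤ N τ := fun τ hτ => div_nonneg (Dnn _ _) (h.Hpos hτ).le
  set G := fun τ => (1 + N τ) * exp (L ^ 2 / 2 * exp (-(2 * τ))) with hG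
  have dG : ∀ τ > τ0, ∃ d, HasDerivAt G d τ ∧ d ≤ 0 := by
    intro τ hτ
    obtain ⟨d, hd, hle⟩ := h.dN hτ
    have h1 : HasDerivAt (fun τ => exp (L ^ 2 / 2 * exp (-(2 * τ))))
        (exp (L ^ 2 / 2 * exp (-(2 * τ))) * (L ^ 2 / 2 * (exp (-(2 * τ)) * (-2)))) τ := by
      have h2 : HasDerivAt (fun τ : ℝ => -(2 * τ)) (-2) τ := by
        exact ((hasDerivAt_id τ).const_mul 2).neg.congr_deriv (by simp)
      exact (h2.exp.const_mul _).exp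
    refine ⟨_, (hd.const_add 1).mul h1, ?_⟩
    have : 0 < exp (L ^ 2 / 2 * exp (-(2 * τ))) := exp_pos _
    have e : d * exp (L ^ 2 / 2 * exp (-(2 * τ))) + (1 + N τ) * (exp (L ^ 2 / 2 * exp (-(2 * τ))) * (L ^ 2 / 2 * (exp (-(2 * τ)) * (-2))))
      = exp (L ^ 2 / 2 * exp (-(2 * τ))) * (d - L ^ 2 * exp (-(2 * τ)) * (1 + N τ)) := by ring
    change d * exp (L ^ 2 / 2 * exp (-(2 * τ))) + (1 + N τ) * (exp (L ^ 2 / 2 * exp (-(2 * τ))) * (L ^ 2 / 2 * (exp (-(2 * τ)) * (-2)))) ≤ 0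
    rw [e]
    exact mul_nonpos_of_nonneg_of_nonpos this.le (sub_nonpos.2 hle)
  have anti : AntitoneOn G (Ioi τ0) := by
    refine antitoneOn_of_deriv_nonpos (convex_Ioi _) ?_ ?_ ?_
    · intro τ hτ; obtain ⟨d, hd, _⟩ := dG τ hτ; exact hd.continuousAt.continuousWithinAt
    · intro τ hτ; rw [interior_Ioi] at hτ; obtain ⟨d, hd, _⟩ := dG τ hτ; exact hd.differentiableAt.differentiableWithinAt
    · intro τ hτ; rw [interior_Ioi] at hτ; obtain ⟨d, hd, hle⟩ := dG τ hτ; rwa [hd.deriv]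
  have anti2 : Antitone (fun τ => G (max τ (τ0 + 1))) := by
    intro a b hab
    exact anti (lt_of_lt_of_le (lt_add_one τ0) (le_max_right _ _)) (lt_of_lt_of_le (lt_add_one τ0) (le_max_right _ _))
      (max_le_max_right _ hab)
  have lim := tendsto_atTop_ciInf anti2 ⟨0, by
    rintro _ ⟨τ, rfl⟩
    have := hN0 (max τ (τ0 + 1)) (lt_of_lt_of_le (by linarith) (le_max_right _ _))
    exact mul_nonneg (by linarith) (exp_pos _).le⟩
  have lim2 : Tendsto G atTop (𝓝 (⨅ i, G (max i (τ0 + 1)))) := by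
    refine lim.congr' ?_
    filter_upwards [eventually_ge_atTop (τ0 + 1)] with τ hτ
    rw [max_eq_left hτ]
  have lim3 : Tendsto (fun τ : ℝ => exp (L ^ 2 / 2 * exp (-(2 * τ)))) atTop (𝓝 1) := by
    have h1 : Tendsto (fun τ : ℝ => exp (-(2 * τ))) atTop (𝓝 0) :=
      tendsto_exp_neg_atTop_nhds_zero.comp (tendsto_id.const_mul_atTop (by norm_num))
    have := (h1.const_mul (L ^ 2 / 2)).rexp
    simpa using this
  have lim4 := (lim2.div lim3 one_ne_zero).sub_const 1
  refine ⟨_, lim4.congr fun τ => ?_⟩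
  have : 0 < exp (L ^ 2 / 2 * exp (-(2 * τ))) := exp_pos _
  simp only [hG, Pi.div_apply]
  field_simp
  ring

end RS

theorem ode_zero {β m r : ℝ → ℝ} {τ0 B m0 : ℝ} (hm0 : m0 ≠ 0)
    (hd : ∀ τ > τ0, HasDerivAt β (m τ * β τ + r τ) τ) (hb : ∀ τ > τ0, 0 ≤ β τ ∧ β τ ≤ B)
    (hm : Tendsto m atTop (𝓝 m0)) (hr : Tendsto r atTop (𝓝 0)) : Tendsto β atTop (𝓝 0) := by
  rcases lt_or_gt_of_ne hm0 with hneg | hpos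
  · -- decaying
    set μ := -m0 / 2 with hμ
    have hμ0 : 0 < μ := by rw [hμ]; linarith
    rw [Metric.tendsto_atTop]
    intro ε hε
    set δ := ε / 2 with hδ
    obtain ⟨T, hT⟩ := eventually_atTop.1 ((hm.eventually (gt_mem_nhds (show m0 < -μ by rw [hμ]; linarith))).and
      ((hr.eventually (gt_mem_nhds (show 0 < μ * δ by positivity))).and (eventually_gt_atTop τ0)))
    have anti : AntitoneOn (fun τ => (β τ - δ) * exp (μ * τ)) (Ici T) := by
      have dd : ∀ τ ≥ T, HasDerivAt (fun τ => (β τ - δ) * exp (μ * τ))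
          ((m τ * β τ + r τ) * exp (μ * τ) + (β τ - δ) * (exp (μ * τ) * μ)) τ := by
        intro τ hτ
        have h2 : HasDerivAt (fun τ : ℝ => μ * τ) μ τ := by simpa using (hasDerivAt_id τ).const_mul μ
        exact ((hd τ (hT τ hτ).2.2).sub_const δ).mul h2.exp
      refine antitoneOn_of_deriv_nonpos (convex_Ici _) (fun τ hτ => (dd τ hτ).continuousAt.continuousWithinAt)
        (fun τ hτ => (dd τ (interior_subset hτ)).differentiableAt.differentiableWithinAt) (fun τ hτ => ?_)
      have hτ' := interior_subset hτ
      rw [(dd τ hτ').deriv]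
      obtain ⟨h1, h2, h3⟩ := hT τ hτ'
      have h4 := (hb τ h3).1
      have : (m τ * β τ + r τ) + (β τ - δ) * μ ≤ 0 := by nlinarith
      have h5 := mul_nonpos_of_nonneg_of_nonpos (exp_pos (μ * τ)).le this
      linarith
    have lim : Tendsto (fun τ : ℝ => B * exp (μ * T) * exp (-(μ * τ))) atTop (𝓝 0) := by
      have := (tendsto_exp_neg_atTop_nhds_zero.comp (tendsto_id.const_mul_atTop hμ0)).const_mul (B * exp (μ * T))
      simpa using this
    obtain ⟨T2, hT2⟩ := eventually_atTop.1 (lim.eventually (gt_mem_nhds (show 0 < δ by positivity)))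
    refine ⟨max T T2, fun τ hτ => ?_⟩
    have t1 : T ≤ τ := (le_max_left _ _).trans hτ
    have t2 := hT2 τ ((le_max_right _ _).trans hτ)
    have a := anti (mem_Ici.2 le_rfl) (mem_Ici.2 t1) t1
    have b1 := hb T (hT T le_rfl).2.2
    have b2 := hb τ (hT τ t1).2.2
    simp only at a
    have : (β τ - δ) ≤ B * exp (μ * T) * exp (-(μ * τ)) := by
      rw [exp_neg, ← div_eq_mul_inv, le_div_iff₀ (exp_pos _)]
      refine a.trans (mul_le_mul_of_nonneg_right ?_ (exp_pos _).le)
      have : 0 < δ := by positivity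
      linarith [b1.2]
    rw [Real.dist_eq, sub_zero, abs_of_nonneg b2.1]
    linarith
  · set μ := m0 / 2 with hμ
    have hμ0 : 0 < μ := by rw [hμ]; linarith
    rw [Metric.tendsto_atTop]
    intro ε hε
    set δ := ε / 2 with hδ
    obtain ⟨T, hT⟩ := eventually_atTop.1 ((hm.eventually (lt_mem_nhds (show μ < m0 by rw [hμ]; linarith))).and
      ((hr.eventually (lt_mem_nhds (show -(μ * δ) < 0 by simp; positivity))).and (eventually_gt_atTop τ0)))
    have mono : MonotoneOn (fun τ => (β τ - δ) * exp (-(μ * τ))) (Ici T) := by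
      have dd : ∀ τ ≥ T, HasDerivAt (fun τ => (β τ - δ) * exp (-(μ * τ)))
          ((m τ * β τ + r τ) * exp (-(μ * τ)) + (β τ - δ) * (exp (-(μ * τ)) * (-μ))) τ := by
        intro τ hτ
        have h2 : HasDerivAt (fun τ : ℝ => -(μ * τ)) (-μ) τ := ((hasDerivAt_id τ).const_mul μ).neg.congr_deriv (by simp)
        exact ((hd τ (hT τ hτ).2.2).sub_const δ).mul h2.exp
      refine monotoneOn_of_deriv_nonneg (convex_Ici _) (fun τ hτ => (dd τ hτ).continuousAt.continuousWithinAt)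
        (fun τ hτ => (dd τ (interior_subset hτ)).differentiableAt.differentiableWithinAt) (fun τ hτ => ?_)
      have hτ' := interior_subset hτ
      rw [(dd τ hτ').deriv]
      obtain ⟨h1, h2, h3⟩ := hT τ hτ'
      have h4 := (hb τ h3).1
      have : 0 ≤ (m τ * β τ + r τ) + (β τ - δ) * (-μ) := by nlinarith
      have h5 := mul_nonneg (exp_pos (-(μ * τ))).le this
      linarith
    have lim : Tendsto (fun τ : ℝ => B * exp (-(μ * τ))) atTop (𝓝 0) := by
      have := (tendsto_exp_neg_atTop_nhds_zero.comp (tendsto_id.const_mul_atTop hμ0)).const_mul B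
      simpa using this
    refine ⟨T, fun τ t1 => ?_⟩
    have b2 := hb τ (hT τ t1).2.2
    have : (β τ - δ) * exp (-(μ * τ)) ≤ 0 := by
      refine ge_of_tendsto lim ?_
      filter_upwards [eventually_ge_atTop τ] with s hs
      refine (mono t1 (mem_Ici.2 (le_trans t1 hs)) hs).trans (mul_le_mul_of_nonneg_right ?_ (exp_pos _).le)
      have := (hb s (hT s (le_trans t1 hs)).2.2).2
      have : 0 < δ := by positivity
      linarith
    have : β τ - δ ≤ 0 := by
      by_contra hc
      push Not at hc
      have := mul_pos hc (exp_pos (-(μ * τ)))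
      linarith
    rw [Real.dist_eq, sub_zero, abs_of_nonneg b2.1]
    linarith

end

section
open Real Set Filter MeasureTheory Topology

namespace RS
variable {v vy vyy vt : ℝ → ℝ → ℝ} {τ0 M L : ℝ}

theorem da2 (h : RS v vy vyy vt τ0 M L) (j : ℕ) {τ : ℝ} (hτ : τ0 < τ) :
    HasDerivAt (aa v j) (-j * aa v j τ + J (fun y => (vt τ y - (vyy τ y - y * vy τ y)) * hn j y)) τ := by
  refine (h.da j hτ).congr_deriv ?_
  have e : (fun y => vt τ y * hn j y) = fun y => hn j y * (vyy τ y - y * vy τ y) +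
    (vt τ y - (vyy τ y - y * vy τ y)) * hn j y := by ext; ring
  rw [e, J_add ((hn_PG j).mul (h.pLv hτ)) ((h.pφ hτ).mul (hn_PG j))]
  rw [J_weak (hn_deriv j) (h.dyy τ hτ) (hn_PG j) ((hn_PG (j-1)).cmul j) (h.pvy hτ) (h.pvyy hτ)]
  have e2 : (fun y => j * hn (j-1) y * vy τ y) = fun y => (j:ℝ) * (vy τ y * hn (j-1) y) := by ext; ring
  rw [e2, J_cmul, J_hn_ibp (h.dy τ hτ) (h.pv hτ) (h.pvy hτ)]
  cases j with
  | zero => simp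
  | succ j => simp [aa]; ring

theorem hn_norm (j : ℕ) : J (fun y => hn j y ^ 2) = j.factorial := by
  have := J_hn_hn j j
  simpa [pow_two] using this

theorem a_le (h : RS v vy vyy vt τ0 M L) (j : ℕ) {τ : ℝ} (hτ : τ0 < τ) :
    aa v j τ ^ 2 ≤ HH v τ * j.factorial := by
  have := J_cs (h.pv hτ) (hn_PG j)
  rwa [hn_norm] at this

theorem qlim {N : ℝ → ℝ} {N0 : ℝ} (hN : Tendsto N atTop (𝓝 N0)) (C L : ℝ) :
    Tendsto (fun τ => C * (Real.sqrt (2 * L ^ 2 * (1 + N τ)) * exp (-τ))) atTop (𝓝 0) := by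
  have h1 : Tendsto (fun τ => Real.sqrt (2 * L ^ 2 * (1 + N τ))) atTop (𝓝 (Real.sqrt (2 * L ^ 2 * (1 + N0)))) :=
    ((hN.const_add 1).const_mul _).sqrt
  simpa using (h1.mul tendsto_exp_neg_atTop_nhds_zero).const_mul C

theorem q_sq (h : RS v vy vyy vt τ0 M L) {τ : ℝ} (hτ : τ0 < τ) :
    2 * L ^ 2 * exp (-(2 * τ)) * (HH v τ + HH vy τ) =
     (Real.sqrt (2 * L ^ 2 * (1 + HH vy τ / HH v τ)) * exp (-τ)) ^ 2 * HH v τ := by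
  have hH := h.Hpos hτ
  have hD := Dnn vy τ
  rw [mul_pow, Real.sq_sqrt (by positivity)]
  have h2 : exp (-(2 * τ)) = exp (-τ) ^ 2 := by rw [← exp_nat_mul]; congr 1; push_cast; ring
  rw [h2]; field_simp

theorem E_abs (h : RS v vy vyy vt τ0 M L) {τ : ℝ} (hτ : τ0 < τ) :
    |J (fun y => v τ y * (vt τ y - (vyy τ y - y * vy τ y)))| ≤
      (Real.sqrt (2 * L ^ 2 * (1 + HH vy τ / HH v τ)) * exp (-τ)) * HH v τ := by
  refine abs_le_of_sq_le_sq ?_ (mul_nonneg (by positivity) (h.Hpos hτ).le)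
  have := h.E_le hτ
  rw [h.q_sq hτ] at this
  linarith

theorem beta_zero (h : RS v vy vyy vt τ0 M L) {N0 : ℝ}
    (hN : Tendsto (fun τ => HH vy τ / HH v τ) atTop (𝓝 N0)) (j : ℕ) (hj : N0 ≠ j) :
    Tendsto (fun τ => aa v j τ ^ 2 / HH v τ) atTop (𝓝 0) := by
  set c := fun τ => J (fun y => (vt τ y - (vyy τ y - y * vy τ y)) * hn j y)
  set E := fun τ => J (fun y => v τ y * (vt τ y - (vyy τ y - y * vy τ y)))
  refine ode_zero (β := fun τ => aa v j τ ^ 2 / HH v τ) (m := fun τ => 2 * (HH vy τ / HH v τ - j))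
    (r := fun τ => 2 * (aa v j τ * c τ) / HH v τ - 2 * (aa v j τ ^ 2 / HH v τ) * E τ / HH v τ)
    (τ0 := τ0) (B := j.factorial) (m0 := 2 * (N0 - j)) ?_ ?_ ?_ ?_ ?_
  · exact mul_ne_zero two_ne_zero (sub_ne_zero.2 hj)
  · intro τ hτ
    have hH := h.Hpos hτ
    refine (((h.da2 j hτ).pow 2).div (h.dH2 hτ) hH.ne').congr_deriv ?_
    simp only [Nat.cast_ofNat, Nat.add_one_sub_one, pow_one, Pi.pow_apply]
    change (2 * aa v j τ * (-j * aa v j τ + c τ) * HH v τ - aa v j τ ^ 2 * (-2 * HH vy τ + 2 * E τ)) / HH v τ ^ 2 = _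
    field_simp
    ring
  · intro τ hτ
    have hH := h.Hpos hτ
    refine ⟨by positivity, ?_⟩
    rw [div_le_iff₀ hH]
    linarith [h.a_le j hτ]
  · exact (hN.sub_const _).const_mul 2
  · refine squeeze_zero_norm' ?_ (qlim hN (4 * j.factorial) L)
    filter_upwards [eventually_gt_atTop τ0] with τ hτ
    have hH := h.Hpos hτ
    set q := Real.sqrt (2 * L ^ 2 * (1 + HH vy τ / HH v τ)) * exp (-τ) with hq
    have hq0 : 0 ≤ q := by positivity
    have hE : |E τ| ≤ q * HH v τ := h.E_abs hτ
    have hF := h.FF_le hτ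
    rw [h.q_sq hτ] at hF
    have ha := h.a_le j hτ
    have hc : c τ ^ 2 ≤ (q ^ 2 * HH v τ) * j.factorial := by
      have := J_cs (h.pφ hτ) (hn_PG j)
      rw [hn_norm] at this
      exact this.trans (mul_le_mul_of_nonneg_right hF (by positivity))
    have hac : |aa v j τ * c τ| ≤ j.factorial * q * HH v τ := by
      refine abs_le_of_sq_le_sq ?_ (by positivity)
      rw [mul_pow]
      calc _ ≤ _ := mul_le_mul ha hc (sq_nonneg _) (by positivity)
        _ = _ := by ring
    have h1 : |2 * (aa v j τ * c τ) / HH v τ| ≤ 2 * (j.factorial * q) := by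
      rw [abs_div, abs_mul, abs_two, abs_of_pos hH, div_le_iff₀ hH]; linarith
    have h2 : |2 * (aa v j τ ^ 2 / HH v τ) * E τ / HH v τ| ≤ 2 * (j.factorial * q) := by
      have hb : aa v j τ ^ 2 / HH v τ ≤ j.factorial := by rw [div_le_iff₀ hH]; linarith
      have hb0 : 0 ≤ aa v j τ ^ 2 / HH v τ := by positivity
      rw [abs_div, abs_mul, abs_mul, abs_two, abs_of_pos hH, abs_of_nonneg hb0, div_le_iff₀ hH]
      have := mul_le_mul hb hE (abs_nonneg _) (by positivity)
      linarith
    rw [Real.norm_eq_abs]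
    have := abs_sub (2 * (aa v j τ * c τ) / HH v τ) (2 * (aa v j τ ^ 2 / HH v τ) * E τ / HH v τ)
    linarith

theorem N0_ge (h : RS v vy vyy vt τ0 M L) {N0 : ℝ}
    (hN : Tendsto (fun τ => HH vy τ / HH v τ) atTop (𝓝 N0)) : 2 ≤ N0 := by
  by_contra hc
  push Not at hc
  set c := N0 + 2 with hcdef
  have hc4 : c < 4 := by linarith
  obtain ⟨T, hT⟩ := eventually_atTop.1 ((hN.eventually (gt_mem_nhds (show N0 < N0 + (2 - N0) / 4 by linarith))).and
      (((qlim hN 1 L).eventually (gt_mem_nhds (show 0 < (2 - N0) / 4 by linarith))).and (eventually_gt_atTop τ0)))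
  have mono : MonotoneOn (fun τ => HH v τ * exp (c * τ)) (Ici T) := by
    have dd : ∀ τ ≥ T, HasDerivAt (fun τ => HH v τ * exp (c * τ))
        ((-2 * HH vy τ + 2 * J (fun y => v τ y * (vt τ y - (vyy τ y - y * vy τ y)))) * exp (c * τ)
          + HH v τ * (exp (c * τ) * c)) τ := by
      intro τ hτ
      have h2 : HasDerivAt (fun τ : ℝ => c * τ) c τ := by simpa using (hasDerivAt_id τ).const_mul c
      exact (h.dH2 (hT τ hτ).2.2).mul h2.exp
    refine monotoneOn_of_deriv_nonneg (convex_Ici _) (fun τ hτ => (dd τ hτ).continuousAt.continuousWithinAt)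
      (fun τ hτ => (dd τ (interior_subset hτ)).differentiableAt.differentiableWithinAt) (fun τ hτ => ?_)
    have hτ' := interior_subset hτ
    rw [(dd τ hτ').deriv]
    obtain ⟨h1, h2, h3⟩ := hT τ hτ'
    have hH := h.Hpos h3
    have hE := h.E_abs h3
    rw [one_mul] at h2
    have hE2 := neg_abs_le (J (fun y => v τ y * (vt τ y - (vyy τ y - y * vy τ y))))
    have h4 := mul_lt_mul_of_pos_right h2 hH
    rw [div_lt_iff₀ hH] at h1
    have : 0 ≤ (-2 * HH vy τ + 2 * J (fun y => v τ y * (vt τ y - (vyy τ y - y * vy τ y)))) + HH v τ * c := by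
      rw [hcdef]
      nlinarith
    have h5 := mul_nonneg (exp_pos (c * τ)).le this
    linarith
  have hTT := (hT T le_rfl).2.2
  set K := J (fun y => (1 + |y|) ^ 4)
  have pk : ∀ n : ℕ, PG (fun y => (1 + |y|) ^ n) := fun n => ⟨by fun_prop, 1, n, zero_le_one, fun y => by
    rw [one_mul, abs_of_nonneg (by positivity)]⟩
  have lim : Tendsto (fun τ : ℝ => M ^ 2 * K * exp (-((4 - c) * τ))) atTop (𝓝 0) := by
    have := (tendsto_exp_neg_atTop_nhds_zero.comp (tendsto_id.const_mul_atTop (show 0 < 4 - c by linarith))).const_mul (M ^ 2 * K)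
    simpa using this
  have : HH v T * exp (c * T) ≤ 0 := by
    refine ge_of_tendsto lim ?_
    filter_upwards [eventually_ge_atTop T] with τ hτ
    refine (mono (mem_Ici.2 le_rfl) (mem_Ici.2 hτ) hτ).trans ?_
    have h3 := (hT τ hτ).2.2
    have : HH v τ ≤ M ^ 2 * exp (-(4 * τ)) * K := by
      rw [← J_cmul]
      refine J_mono (h.pv h3).sq ((pk 4).cmul _) fun y => ?_
      have := pow_le_pow_left₀ (abs_nonneg _) (h.dec τ h3 y) 2
      rw [sq_abs] at this
      refine this.trans (le_of_eq ?_)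
      have h2 : exp (-(4 * τ)) = exp (-(2 * τ)) ^ 2 := by rw [← exp_nat_mul]; congr 1; push_cast; ring
      rw [h2]; ring
    calc HH v τ * exp (c * τ) ≤ M ^ 2 * exp (-(4 * τ)) * K * exp (c * τ) :=
          mul_le_mul_of_nonneg_right this (exp_pos _).le
      _ = M ^ 2 * K * (exp (-(4 * τ)) * exp (c * τ)) := by ring
      _ = _ := by rw [← exp_add]; congr 2; ring
  have := mul_pos (h.Hpos hTT) (exp_pos (c * T))
  linarith

theorem gapN (h : RS v vy vyy vt τ0 M L) (n : ℕ) {τ : ℝ} (hτ : τ0 < τ) :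
    1 - ∑ j ∈ Finset.range (n + 1), (aa v j τ ^ 2 / HH v τ) / j.factorial ≤ (HH vy τ / HH v τ) / (n + 1) := by
  have hH := h.Hpos hτ
  have := gap (h.dy τ hτ) (h.pv hτ) (h.pvy hτ) n
  change HH v τ - ∑ j ∈ Finset.range (n+1), aa v j τ ^ 2 / j.factorial ≤ HH vy τ / (n + 1) at this
  have h2 := div_le_div_of_nonneg_right this hH.le
  rw [sub_div, div_self hH.ne', Finset.sum_div] at h2
  calc _ = 1 - ∑ j ∈ Finset.range (n+1), aa v j τ ^ 2 / j.factorial / HH v τ := by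
        congr 1; refine Finset.sum_congr rfl fun j _ => ?_; rw [div_right_comm]
    _ ≤ _ := h2
    _ = _ := by rw [div_right_comm]

theorem main_lim (h : RS v vy vyy vt τ0 M L) :
    ∃ k : ℕ, 2 ≤ k ∧ Tendsto (fun τ => HH vy τ / HH v τ) atTop (𝓝 k) ∧
      Tendsto (fun τ => aa v k τ ^ 2 / HH v τ) atTop (𝓝 k.factorial) := by
  obtain ⟨N0, hN⟩ := h.Nlim
  have hN2 := h.N0_ge hN
  have hk : ∃ k : ℕ, N0 = k := by
    by_contra hc
    push Not at hc
    obtain ⟨n, hn⟩ := exists_nat_gt N0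
    have l1 : Tendsto (fun τ => 1 - ∑ j ∈ Finset.range (n + 1), (aa v j τ ^ 2 / HH v τ) / j.factorial) atTop
        (𝓝 (1 - ∑ j ∈ Finset.range (n + 1), 0 / (j.factorial : ℝ))) :=
      (tendsto_finsetSum _ fun j _ => (h.beta_zero hN j (hc j)).div_const _).const_sub 1
    have l2 := hN.div_const ((n:ℝ) + 1)
    have := le_of_tendsto_of_tendsto l1 l2 (by
      filter_upwards [eventually_gt_atTop τ0] with τ hτ using h.gapN n hτ)
    simp only [zero_div, Finset.sum_const_zero, sub_zero] at this
    rw [le_div_iff₀ (by positivity)] at this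
    linarith
  obtain ⟨k, rfl⟩ := hk
  refine ⟨k, by exact_mod_cast hN2, hN, ?_⟩
  have hf : (0:ℝ) < k.factorial := by positivity
  rw [Metric.tendsto_atTop]
  intro ε hε
  obtain ⟨n0, hn0⟩ := exists_nat_gt ((k:ℝ) / (ε / (k.factorial) / 2))
  set n := max n0 k with hn
  have hnk : k < n + 1 := Nat.lt_succ_of_le (le_max_right _ _)
  have hnn : (k:ℝ) / (n + 1) < ε / k.factorial / 2 := by
    have : (n0:ℝ) ≤ n := by exact_mod_cast le_max_left _ _
    rw [div_lt_iff₀ (by positivity)] at hn0 ⊢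
    have : 0 < ε / k.factorial / 2 := by positivity
    nlinarith
  have l1 : Tendsto (fun τ => ∑ j ∈ (Finset.range (n + 1)).erase k, (aa v j τ ^ 2 / HH v τ) / j.factorial) atTop
        (𝓝 (∑ j ∈ (Finset.range (n + 1)).erase k, 0 / (j.factorial : ℝ))) :=
    tendsto_finsetSum _ fun j hj => (h.beta_zero hN j (by
      have := (Finset.mem_erase.1 hj).1
      exact_mod_cast this.symm)).div_const _
  have l2 := l1.add (hN.div_const ((n:ℝ) + 1))
  simp only [zero_div, Finset.sum_const_zero, zero_add] at l2
  obtain ⟨T, hT⟩ := eventually_atTop.1 ((l2.eventually (gt_mem_nhds (show (k:ℝ) / (n + 1) < ε / k.factorial by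
    have : 0 < ε / k.factorial := by positivity
    linarith))).and (eventually_gt_atTop τ0))
  refine ⟨T, fun τ hτ => ?_⟩
  obtain ⟨h1, h2⟩ := hT τ hτ
  have hH := h.Hpos h2
  have g := h.gapN n h2
  rw [← Finset.add_sum_erase _ _ (Finset.mem_range.2 hnk)] at g
  have hb : aa v k τ ^ 2 / HH v τ ≤ k.factorial := by rw [div_le_iff₀ hH]; linarith [h.a_le k h2]
  rw [Real.dist_eq, abs_sub_comm, abs_of_nonneg (by linarith)]
  have : 1 - aa v k τ ^ 2 / HH v τ / k.factorial < ε / k.factorial := by linarith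
  rw [lt_div_iff₀ hf, sub_mul, div_mul_cancel₀ _ hf.ne'] at this
  linarith

end RS

end

section
open Real Set Filter MeasureTheory Topology

theorem ptwise {e e' : ℝ → ℝ} (hd : ∀ y, HasDerivAt e (e' y) y) (pe : PG e) (pe' : PG e') (y : ℝ) :
    e y ^ 2 * gam y ≤ 3 * (J (fun y => e y ^ 2) + J (fun y => e' y ^ 2)) := by
  set F' := fun y => (2 * (e y * e' y) - y * e y ^ 2) with hF'
  have pF' : PG F' := ((pe.mul pe').cmul 2).sub (PG.id.mul pe.sq)
  have dF : ∀ y, HasDerivAt (fun y => e y ^ 2 * gam y) (F' y * gam y) y := by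
    intro y
    refine (((hd y).pow 2).mul (gam_deriv y)).congr_deriv ?_
    simp only [hF', Pi.pow_apply]; push_cast; ring
  have h0 : Tendsto (fun y => e y ^ 2 * gam y) atBot (𝓝 0) :=
    tendsto_zero_of_hasDerivAt_of_integrableOn_Iic (a := y) (fun x _ => dF x) pF'.integrable.integrableOn
      pe.sq.integrable.integrableOn
  have h1 := integral_Iic_of_hasDerivAt_of_tendsto' (a := y) (fun x _ => dF x) pF'.integrable.integrableOn h0
  rw [sub_zero] at h1
  rw [← h1]
  have pA : PG (fun y => |F' y|) := ⟨pF'.cont.abs, by simpa using pF'.2⟩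
  have h2 : ∫ x in Iic y, F' x * gam x ≤ J (fun y => |F' y|) := by
    calc _ ≤ ∫ x in Iic y, |F' x| * gam x :=
          integral_mono pF'.integrable.integrableOn pA.integrable.integrableOn
            fun x => mul_le_mul_of_nonneg_right (le_abs_self _) (gam_pos x).le
      _ ≤ _ := setIntegral_le_integral pA.integrable (ae_of_all _ fun x => mul_nonneg (abs_nonneg _) (gam_pos x).le)
  have py2 : PG (fun y => y ^ 2 * e y ^ 2) := PG.id.sq.mul pe.sq
  have h3 : J (fun y => |F' y|) ≤ J (fun y => (3/2) * e y ^ 2 + (e' y ^ 2 + (1/2) * (y ^ 2 * e y ^ 2))) := by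
    refine J_mono pA ((pe.sq.cmul _).add (pe'.sq.add (py2.cmul _))) fun x => ?_
    rw [abs_le]
    simp only [hF']
    constructor
    · nlinarith [sq_nonneg (e x + e' x), mul_nonneg (sq_nonneg (x - 1)) (sq_nonneg (e x))]
    · nlinarith [sq_nonneg (e x - e' x), mul_nonneg (sq_nonneg (x + 1)) (sq_nonneg (e x))]
  rw [J_add (pe.sq.cmul _) (pe'.sq.add (py2.cmul _)), J_add pe'.sq (py2.cmul _), J_cmul, J_cmul] at h3
  have h4 : J (fun y => y ^ 2 * e y ^ 2) ≤ 2 * J (fun y => e y ^ 2) + 4 * J (fun y => e' y ^ 2) := by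
    have ib := J_ibp (f := fun y => y * e y ^ 2) (f' := fun y => e y ^ 2 + 2 * (y * (e y * e' y)))
      (fun y => ((hasDerivAt_id y).mul ((hd y).pow 2)).congr_deriv (by simp; ring)) (PG.id.mul pe.sq)
      (pe.sq.add ((PG.id.mul (pe.mul pe')).cmul 2))
    have e1 : (fun y => y * (y * e y ^ 2)) = fun y => y ^ 2 * e y ^ 2 := by ext; ring
    rw [e1] at ib
    have h5 : J (fun y => e y ^ 2 + 2 * (y * (e y * e' y))) ≤ J (fun y => e y ^ 2 + ((1/2) * (y ^ 2 * e y ^ 2) + 2 * e' y ^ 2)) := by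
      refine J_mono (pe.sq.add ((PG.id.mul (pe.mul pe')).cmul 2)) (pe.sq.add ((py2.cmul _).add (pe'.sq.cmul _))) fun x => ?_
      nlinarith [sq_nonneg (x * e x - 2 * e' x)]
    rw [J_add pe.sq ((py2.cmul _).add (pe'.sq.cmul _)), J_add (py2.cmul _) (pe'.sq.cmul _), J_cmul, J_cmul] at h5
    linarith
  have h6 : 0 ≤ J (fun y => e y ^ 2) := J_nonneg fun y => sq_nonneg _
  linarith

theorem RS.approx {v vy vyy vt : ℝ → ℝ → ℝ} {τ0 M L : ℝ} (h : RS v vy vyy vt τ0 M L) :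
    ∃ k : ℕ, 2 ≤ k ∧ ∀ ε > 0, ∃ T > τ0, ∀ τ ≥ T, ∃ κ : ℝ, κ ≠ 0 ∧
      ∀ y, |v τ y - κ * hn k y| ≤ ε * |κ| * exp (y ^ 2 / 4) := by
  obtain ⟨k, hk, hN, hβ⟩ := h.main_lim
  refine ⟨k, hk, fun ε hε => ?_⟩
  have hf : (0:ℝ) < k.factorial := by positivity
  -- total error
  have lim : Tendsto (fun τ => (1 - aa v k τ ^ 2 / HH v τ / k.factorial) + (HH vy τ / HH v τ - k * (aa v k τ ^ 2 / HH v τ / k.factorial)))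
      atTop (𝓝 ((1 - (k.factorial:ℝ) / k.factorial) + (k - k * ((k.factorial:ℝ) / k.factorial)))) :=
    ((hβ.div_const _).const_sub 1).add (hN.sub ((hβ.div_const _).const_mul _))
  rw [div_self hf.ne'] at lim
  simp only [mul_one, sub_self, add_zero] at lim
  set c := 3 * Real.sqrt (2 * Real.pi) with hc
  have hc0 : 0 < c := by positivity
  obtain ⟨T, hT⟩ := eventually_atTop.1 ((lim.eventually (gt_mem_nhds (show 0 < ε ^ 2 / (c * (2 * k.factorial)) by positivity))).and
    ((hβ.eventually (lt_mem_nhds (show (k.factorial:ℝ) / 2 < k.factorial by linarith))).and (eventually_gt_atTop τ0)))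
  refine ⟨max T (τ0 + 1), lt_of_lt_of_le (lt_add_one _) (le_max_right _ _), fun τ hτ => ?_⟩
  obtain ⟨h1, h2, h3⟩ := hT τ ((le_max_left _ _).trans hτ)
  have hH := h.Hpos h3
  set κ := aa v k τ / k.factorial with hκ
  have ha : aa v k τ = κ * k.factorial := by rw [hκ]; field_simp
  have pv := h.pv h3
  have pvy := h.pvy h3
  have J1 : J (fun y => (v τ y - κ * hn k y) ^ 2) = HH v τ - κ ^ 2 * k.factorial := by
    have e : (fun y => (v τ y - κ * hn k y) ^ 2) = fun y => (v τ y ^ 2 + (-2 * κ) * (v τ y * hn k y)) + κ ^ 2 * hn k y ^ 2 := by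
      ext; ring
    rw [e, J_add (pv.sq.add ((pv.mul (hn_PG k)).cmul _)) ((hn_PG k).sq.cmul _), J_add pv.sq ((pv.mul (hn_PG k)).cmul _),
      J_cmul, J_cmul, RS.hn_norm]
    change HH v τ + -2 * κ * aa v k τ + _ = _
    rw [ha]; ring
  have hkk : (k:ℝ) * (k-1).factorial = k.factorial := by
    rw [← Nat.mul_factorial_pred (by omega : k ≠ 0)]; push_cast; ring
  have J2 : J (fun y => (vy τ y - κ * (k * hn (k-1) y)) ^ 2) = HH vy τ - k * (κ ^ 2 * k.factorial) := by
    have e : (fun y => (vy τ y - κ * (k * hn (k-1) y)) ^ 2) = fun y => (vy τ y ^ 2 + (-2 * κ * k) * (vy τ y * hn (k-1) y))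
        + (κ * k) ^ 2 * hn (k-1) y ^ 2 := by
      ext; ring
    rw [e, J_add (pvy.sq.add ((pvy.mul (hn_PG _)).cmul _)) ((hn_PG _).sq.cmul _), J_add pvy.sq ((pvy.mul (hn_PG _)).cmul _),
      J_cmul, J_cmul, RS.hn_norm, J_hn_ibp (h.dy τ h3) pv pvy, Nat.sub_add_cancel (by omega)]
    change HH vy τ + -2 * κ * k * aa v k τ + _ = _
    rw [ha, ← hkk]; ring
  have hHκ : HH v τ < 2 * k.factorial * κ ^ 2 := by
    rw [lt_div_iff₀ hH, ha] at h2
    have : (k.factorial:ℝ) * (HH v τ) < k.factorial * (2 * k.factorial * κ ^ 2) := by nlinarith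
    exact lt_of_mul_lt_mul_left this hf.le
  have hκ0 : κ ≠ 0 := by
    rintro h0; rw [h0] at hHκ; simp at hHκ; linarith
  refine ⟨κ, hκ0, fun y => ?_⟩
  have p := ptwise (e := fun y => v τ y - κ * hn k y) (e' := fun y => vy τ y - κ * (k * hn (k-1) y))
    (fun y => (h.dy τ h3 y).sub ((hn_deriv k y).const_mul κ)) (pv.sub ((hn_PG k).cmul _))
    (pvy.sub (((hn_PG _).cmul _).cmul _)) y
  rw [J1, J2] at p
  have h1' : (HH v τ - κ ^ 2 * k.factorial) + (HH vy τ - k * (κ ^ 2 * k.factorial)) ≤ ε ^ 2 / (c * (2 * k.factorial)) * HH v τ := by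
    have := mul_lt_mul_of_pos_right h1 hH
    refine le_trans (le_of_eq ?_) this.le
    rw [ha]; field_simp
  have h4 : ε ^ 2 / (c * (2 * k.factorial)) * HH v τ ≤ ε ^ 2 / c * κ ^ 2 := by
    calc _ ≤ ε ^ 2 / (c * (2 * k.factorial)) * (2 * k.factorial * κ ^ 2) := mul_le_mul_of_nonneg_left hHκ.le (by positivity)
      _ = _ := by field_simp
  have h5 : (v τ y - κ * hn k y) ^ 2 * exp (-(y ^ 2) / 2) ≤ ε ^ 2 * κ ^ 2 := by
    have : (v τ y - κ * hn k y) ^ 2 * gam y ≤ 3 * (ε ^ 2 / c * κ ^ 2) := by linarith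
    unfold gam at this
    have h6 : 0 < Real.sqrt (2 * Real.pi) := by positivity
    have h7 := mul_le_mul_of_nonneg_left this h6.le
    calc _ = Real.sqrt (2 * Real.pi) * ((v τ y - κ * hn k y) ^ 2 * ((Real.sqrt (2 * Real.pi))⁻¹ * exp (-(y ^ 2) / 2))) := by field_simp
      _ ≤ _ := h7
      _ = _ := by rw [hc]; field_simp
  refine abs_le_of_sq_le_sq ?_ (by positivity)
  have e5 : (ε * |κ| * exp (y ^ 2 / 4)) ^ 2 = ε ^ 2 * κ ^ 2 * exp (y ^ 2 / 2) := by
    rw [mul_pow, mul_pow, sq_abs, ← exp_nat_mul]; congr 2; push_cast; ring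
  rw [e5]
  have : exp (-(y ^ 2) / 2) = (exp (y ^ 2 / 2))⁻¹ := by rw [← exp_neg]; congr 1; ring
  rwa [this, ← div_eq_mul_inv, div_le_iff₀ (exp_pos _)] at h5

end

section
open Real Set Filter MeasureTheory Topology

theorem second_max {f f' : ℝ → ℝ} {x c : ℝ} (h1 : ∀ᶠ y in 𝓝 x, HasDerivAt f (f' y) y)
    (h2 : HasDerivAt f' c x) (hm : IsLocalMax f x) : f' x = 0 ∧ c ≤ 0 := by
  have e1 : f' x = 0 := hm.hasDerivAt_eq_zero h1.self_of_nhds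
  refine ⟨e1, ?_⟩
  by_contra hc
  push Not at hc
  have hde : deriv f =ᶠ[𝓝 x] f' := h1.mono fun y hy => hy.deriv
  have hdd : deriv (deriv f) x = c := by rw [hde.deriv_eq]; exact h2.deriv
  have hmin := isLocalMin_of_deriv_deriv_pos (f := f) (x₀ := x) (by rw [hdd]; exact hc)
    (by rw [hde.self_of_nhds, e1]) h1.self_of_nhds.continuousAt
  have hconst : f =ᶠ[𝓝 x] fun _ => f x := by
    filter_upwards [hm, hmin] with y ha hb using le_antisymm ha hb
  have : deriv (deriv f) x = 0 := by
    have h3 : deriv f =ᶠ[𝓝 x] fun _ => 0 := by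
      filter_upwards [hconst.eventuallyEq_nhds] with y hy
      rw [hy.deriv_eq]; simp
    rw [h3.deriv_eq]; simp
  linarith

theorem left_max {f : ℝ → ℝ} {s d : ℝ} (h : HasDerivAt f d s) (hm : ∀ᶠ r in 𝓝[<] s, f r ≤ f s) : 0 ≤ d := by
  have h1 : Tendsto (slope f s) (𝓝[<] s) (𝓝 d) :=
    (hasDerivAt_iff_tendsto_slope.1 h).mono_left (nhdsWithin_mono _ fun r hr => ne_of_lt hr)
  refine ge_of_tendsto h1 ?_
  filter_upwards [hm, self_mem_nhdsWithin] with r hr hr2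
  rw [slope_def_field]
  exact div_nonneg_of_nonpos (by linarith) (sub_nonpos.2 (le_of_lt hr2))

/-- barrier -/
theorem barrier {Z Zs Zy Zyy : ℝ → ℝ → ℝ} {ε C : ℝ} {n : ℕ} (hε : 0 < ε)
    (hc : ContinuousOn (fun p : ℝ × ℝ => Z p.1 p.2) (Icc (-1/2) 0 ×ˢ univ))
    (hs : ∀ s, -1/2 < s → s ≤ 0 → ∀ y, HasDerivAt (fun r => Z r y) (Zs s y) s)
    (hy : ∀ s, -1/2 < s → s ≤ 0 → ∀ y, HasDerivAt (Z s) (Zy s y) y)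
    (hyy : ∀ s, -1/2 < s → s ≤ 0 → ∀ y, HasDerivAt (Zy s) (Zyy s y) y)
    (hpde : ∀ s, -1/2 < s → s ≤ 0 → ∀ y, Zs s y - Zyy s y ≤ ε * exp (y ^ 2 / 4) + |Z s y| + |Zy s y|)
    (hgr : ∀ s, -1/2 ≤ s → s ≤ 0 → ∀ y, |Z s y| ≤ C * (1 + |y|) ^ n)
    (hi : ∀ y, Z (-1/2) y ≤ ε * exp (y ^ 2 / 4)) :
    ∀ s, -1/2 ≤ s → s ≤ 0 → ∀ y, Z s y ≤ ε * exp (y ^ 2 / (4 - 6 * (s + 1/2)) + 10 * (s + 1/2)) := by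
  obtain ⟨K, hK, hKb⟩ := poly_le_exp (n + 1)
  set Ψ : ℝ → ℝ → ℝ := fun s y => exp (y ^ 2 / (4 - 6 * (s + 1/2)) + 10 * (s + 1/2)) with hΨ
  have hΨp : ∀ s y, 0 < Ψ s y := fun s y => exp_pos _
  have hΨge : ∀ s, -1/2 ≤ s → s ≤ 0 → ∀ y, exp (y ^ 2 / 4) ≤ Ψ s y := by
    intro s h1 h2 y
    apply exp_le_exp.2
    have : y ^ 2 / 4 ≤ y ^ 2 / (4 - 6 * (s + 1/2)) :=
      div_le_div_of_nonneg_left (sq_nonneg y) (by linarith) (by linarith)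
    linarith
  have C0 : 0 ≤ C := by
    have := (abs_nonneg _).trans (hgr 0 (by norm_num) le_rfl 0)
    simpa using this
  set R := C * K / ε + 1 with hR
  have hR0 : 0 < R := by positivity
  have out : ∀ s, -1/2 ≤ s → s ≤ 0 → ∀ y, R ≤ |y| → Z s y ≤ ε * Ψ s y := by
    intro s h1 h2 y hyR
    have h3 := hgr s h1 h2 y
    have h4 := hKb y
    have h5 : C * (1 + |y|) ^ n * (1 + |y|) ≤ C * (K * exp (y ^ 2 / 4)) := by
      rw [mul_assoc, ← pow_succ]; exact mul_le_mul_of_nonneg_left h4 C0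
    have h6 : C * K ≤ ε * (1 + |y|) := by
      have : C * K / ε ≤ 1 + |y| := by linarith
      rw [div_le_iff₀ hε] at this; linarith
    have h7 : C * (1 + |y|) ^ n * (1 + |y|) ≤ ε * exp (y ^ 2 / 4) * (1 + |y|) := by
      have := mul_le_mul_of_nonneg_right h6 (exp_pos (y ^ 2 / 4)).le
      linarith
    have h8 := le_of_mul_le_mul_right h7 (by positivity)
    have h9 := mul_le_mul_of_nonneg_left (hΨge s h1 h2 y) hε.le
    linarith [le_abs_self (Z s y)]
  have hΨc : ContinuousOn (fun p : ℝ × ℝ => Ψ p.1 p.2) (Icc (-1/2) 0 ×ˢ univ) := by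
    simp only [hΨ]
    refine ContinuousOn.rexp (ContinuousOn.add (ContinuousOn.div (by fun_prop) (by fun_prop) ?_) (by fun_prop))
    rintro ⟨s, y⟩ ⟨⟨h1, h2⟩, -⟩
    simp only at h2 ⊢
    intro h; linarith
  set S : Set (ℝ × ℝ) := Icc (-1/2) 0 ×ˢ Icc (-R) R
  have hSc : IsCompact S := isCompact_Icc.prod isCompact_Icc
  have hSsub : S ⊆ Icc (-1/2) 0 ×ˢ univ := prod_mono le_rfl (subset_univ _)
  have hθ : ContinuousOn (fun p : ℝ × ℝ => Z p.1 p.2 / Ψ p.1 p.2) S :=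
    (hc.mono hSsub).div (hΨc.mono hSsub) fun p _ => (hΨp _ _).ne'
  obtain ⟨⟨s, y⟩, hmem, hmax⟩ := hSc.exists_isMaxOn ⟨((0:ℝ), (0:ℝ)), ⟨by norm_num, by norm_num⟩, by simp [hR0.le]⟩ hθ
  have hsI := hmem.1
  have hyI := hmem.2
  simp only at hsI hyI
  set E := Z s y / Ψ s y with hE
  have hle : ∀ s' y', s' ∈ Icc (-1/2 : ℝ) 0 → y' ∈ Icc (-R) R → Z s' y' ≤ E * Ψ s' y' := by
    intro s' y' h1 h2
    have := hmax (show (s', y') ∈ S from ⟨h1, h2⟩)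
    simp only [mem_ofPred_eq] at this
    rwa [div_le_iff₀ (hΨp _ _)] at this
  have heq : Z s y = E * Ψ s y := by rw [hE]; field_simp [(hΨp s y).ne']
  have claim : E ≤ ε := by
    by_contra hcon
    push Not at hcon
    have hE0 : 0 < E := hε.trans hcon
    have hlt : ε * Ψ s y < Z s y := by rw [heq]; exact mul_lt_mul_of_pos_right hcon (hΨp _ _)
    have hs1 : -1/2 < s := by
      rcases eq_or_lt_of_le hsI.1 with h | h
      · exfalso
        rw [← h] at hlt
        have := mul_le_mul_of_nonneg_left (hΨge (-1/2) le_rfl (by norm_num) y) hε.le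
        linarith [hi y]
      · exact h
    have hy1 : |y| < R := by
      by_contra h
      push Not at h
      linarith [out s hsI.1 hsI.2 y h]
    obtain ⟨hy2, hy3⟩ := abs_lt.1 hy1
    set a := 1 / (4 - 6 * (s + 1/2)) with ha
    have hden : 1 ≤ 4 - 6 * (s + 1/2) := by linarith [hsI.2]
    have hden0 : 4 - 6 * (s + 1/2) ≠ 0 := by linarith
    have ha0 : 0 < a := by rw [ha]; positivity
    have ha1 : a ≤ 1 := by rw [ha, div_le_one (by linarith)]; exact hden
    have dΨy : ∀ y, HasDerivAt (Ψ s) (2 * a * y * Ψ s y) y := by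
      intro y
      have : HasDerivAt (fun y : ℝ => y ^ 2 / (4 - 6 * (s + 1/2)) + 10 * (s + 1/2)) (2 * a * y) y :=
        (((hasDerivAt_pow 2 y).div_const _).add_const _).congr_deriv (by rw [ha]; simp; ring)
      exact this.exp.congr_deriv (by simp only [hΨ]; ring)
    have dΨyy : HasDerivAt (fun y => 2 * a * y * Ψ s y) ((2 * a + 4 * a ^ 2 * y ^ 2) * Ψ s y) y := by
      have : HasDerivAt (fun y : ℝ => 2 * a * y) (2 * a) y := by simpa using (hasDerivAt_id y).const_mul (2 * a)
      exact (this.mul (dΨy y)).congr_deriv (by ring)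
    have dΨs : HasDerivAt (fun r => Ψ r y) ((6 * a ^ 2 * y ^ 2 + 10) * Ψ s y) s := by
      have h1 : HasDerivAt (fun r : ℝ => 4 - 6 * (r + 1/2)) (-6) s :=
        ((((hasDerivAt_id s).add_const (1/2)).const_mul 6).const_sub 4).congr_deriv (by simp)
      have h2 : HasDerivAt (fun r : ℝ => 10 * (r + 1/2)) 10 s :=
        (((hasDerivAt_id s).add_const (1/2)).const_mul 10).congr_deriv (by simp)
      have := ((((hasDerivAt_const s (y ^ 2)).div h1 hden0).add h2).exp)
      refine this.congr_deriv ?_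
      simp only [hΨ, Pi.add_apply, Pi.div_apply]
      rw [mul_comm]
      congr 1
      rw [ha]; field_simp; ring
    have hmy := second_max (f := fun z => Z s z - E * Ψ s z) (f' := fun z => Zy s z - E * (2 * a * z * Ψ s z))
      (x := y) (Eventually.of_forall fun z => (hy s hs1 hsI.2 z).sub ((dΨy z).const_mul E))
      ((hyy s hs1 hsI.2 y).sub (dΨyy.const_mul E)) (by
        filter_upwards [Icc_mem_nhds hy2 hy3] with z hz
        have := hle s z hsI hz
        rw [heq]; linarith)
    have hms := left_max ((hs s hs1 hsI.2 y).sub (dΨs.const_mul E)) (by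
        filter_upwards [Ioo_mem_nhdsLT hs1] with r hr
        have := hle r y ⟨hr.1.le, hr.2.le.trans hsI.2⟩ hyI
        simp only [Pi.sub_apply]
        rw [heq]; linarith)
    obtain ⟨m1, m2⟩ := hmy
    have hp := hpde s hs1 hsI.2 y
    have hZy : Zy s y = E * (2 * a * y * Ψ s y) := by linarith
    have hP := hΨp s y
    have hEP : 0 < E * Ψ s y := mul_pos hE0 hP
    have b1 : |Z s y| = E * Ψ s y := by rw [heq, abs_of_pos hEP]
    have b2 : |Zy s y| ≤ (1 + a ^ 2 * y ^ 2) * (E * Ψ s y) := by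
      rw [hZy, show E * (2 * a * y * Ψ s y) = (2 * a * y) * (E * Ψ s y) by ring, abs_mul, abs_of_pos hEP]
      refine mul_le_mul_of_nonneg_right ?_ hEP.le
      rw [abs_le]; constructor <;> nlinarith [sq_nonneg (a * y + 1), sq_nonneg (a * y - 1)]
    have b3 : ε * exp (y ^ 2 / 4) ≤ E * Ψ s y :=
      mul_le_mul hcon.le (hΨge s hsI.1 hsI.2 y) (exp_pos _).le hE0.le
    have b4 : (E * Ψ s y) * (2 * a ^ 2 * y ^ 2 + 10 - 2 * a) ≤ (E * Ψ s y) * (3 + a ^ 2 * y ^ 2) := by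
      rw [b1] at hp
      nlinarith
    have b5 := le_of_mul_le_mul_left b4 hEP
    nlinarith [sq_nonneg (a * y)]
  intro s' h1 h2 y'
  change Z s' y' ≤ ε * Ψ s' y'
  rcases le_or_gt R |y'| with h | h
  · exact out s' h1 h2 y' h
  · obtain ⟨h3, h4⟩ := abs_lt.1 h
    exact (hle s' y' ⟨h1, h2⟩ ⟨h3.le, h4.le⟩).trans (mul_le_mul_of_nonneg_right claim (hΨp _ _).le)

end

section
open Real Set Filter MeasureTheory Topology

theorem alt_aux {f : ℝ → ℝ} (pf : PG f) (h0 : J f = 0) (h1 : J (fun y => y * f y) = 0)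
    {p q : ℝ} (hpq : p < q) (hp : 0 < f p) (hq : f q < 0) :
    ∃ y0 y1 y2, y0 < y1 ∧ y1 < y2 ∧ f y0 * f y1 < 0 ∧ f y1 * f y2 < 0 := by
  by_contra hcon
  push Not at hcon
  have A : ∀ x, 0 < f x → x < q := by
    intro x hx
    by_contra h
    push Not at h
    rcases eq_or_lt_of_le h with e | e
    · rw [e] at hq; linarith
    · have := hcon p q x hpq e (mul_neg_of_pos_of_neg hp hq)
      have := mul_neg_of_neg_of_pos hq hx
      linarith
  set a := sSup {x | 0 < f x} with ha
  have hbdd : BddAbove {x | 0 < f x} := ⟨q, fun x hx => (A x hx).le⟩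
  have B : ∀ x, a < x → f x ≤ 0 := by
    intro x hx
    by_contra h
    push Not at h
    have := le_csSup hbdd (show x ∈ {x | 0 < f x} from h)
    linarith
  have Cc : ∀ x, x < a → 0 ≤ f x := by
    intro x hx
    by_contra h
    push Not at h
    obtain ⟨x', hx', hlt⟩ := exists_lt_of_lt_csSup (⟨p, hp⟩ : {x | 0 < f x}.Nonempty) hx
    have hx'' : 0 < f x' := hx'
    have := hcon x x' q hlt (A x' hx'') (mul_neg_of_neg_of_pos h hx'')
    have := mul_neg_of_pos_of_neg hx'' hq
    linarith
  have key : 0 < J (fun y => a * f y - y * f y) := by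
    refine J_pos ((pf.cmul a).sub (PG.id.mul pf)) (fun y => ?_) ?_
    · rw [← sub_mul]
      rcases lt_trichotomy y a with h | h | h
      · exact mul_nonneg (by linarith) (Cc y h)
      · rw [h]; simp
      · exact mul_nonneg_of_nonpos_of_nonpos (by linarith) (B y h)
    · by_cases hpa : p = a
      · refine ⟨q, ?_⟩
        rw [← sub_mul]; exact mul_ne_zero (by intro h; linarith) hq.ne
      · refine ⟨p, ?_⟩
        rw [← sub_mul]; exact mul_ne_zero (fun h => hpa (by linarith)) hp.ne'
  rw [J_sub (pf.cmul a) (PG.id.mul pf), J_cmul, h0, h1] at key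
  simp at key

theorem alt_exists {f : ℝ → ℝ} (pf : PG f) (h0 : J f = 0) (h1 : J (fun y => y * f y) = 0)
    (hne : ∃ y, f y ≠ 0) :
    ∃ y0 y1 y2, y0 < y1 ∧ y1 < y2 ∧ f y0 * f y1 < 0 ∧ f y1 * f y2 < 0 := by
  have Jneg : ∀ g : ℝ → ℝ, J (fun y => - g y) = - J g := fun g => by
    have := J_cmul (-1) g
    simpa using this
  have hp : ∃ p, 0 < f p := by
    by_contra h
    push Not at h
    have := J_pos pf.neg (fun y => by linarith [h y]) (by obtain ⟨y, hy⟩ := hne; exact ⟨y, neg_ne_zero.2 hy⟩)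
    rw [Jneg, h0] at this; simp at this
  have hq : ∃ q, f q < 0 := by
    by_contra h
    push Not at h
    have := J_pos pf h hne
    linarith
  obtain ⟨p, hp⟩ := hp
  obtain ⟨q, hq⟩ := hq
  rcases lt_trichotomy p q with h | h | h
  · exact alt_aux pf h0 h1 h hp hq
  · rw [h] at hp; linarith
  · have e : (fun y => y * (- f y)) = fun y => - (y * f y) := by ext; ring
    obtain ⟨y0, y1, y2, a, b, c, d⟩ := alt_aux (f := fun y => - f y) pf.neg (by rw [Jneg, h0, neg_zero])
      (by rw [e, Jneg, h1, neg_zero]) h (by linarith) (by linarith)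
    exact ⟨y0, y1, y2, a, b, by linarith, by linarith⟩

theorem hn_alt (k : ℕ) (hk : 2 ≤ k) :
    ∃ y0 y1 y2, y0 < y1 ∧ y1 < y2 ∧ hn k y0 * hn k y1 < 0 ∧ hn k y1 * hn k y2 < 0 := by
  refine alt_exists (hn_PG k) ?_ ?_ ?_
  · have := J_hn_hn 0 k
    rw [hn_zero, if_neg (by omega)] at this
    simpa using this
  · have := J_hn_hn 1 k
    rw [hn_one, if_neg (by omega)] at this
    simpa using this
  · by_contra h
    push Not at h
    have := RS.hn_norm k
    have e : (fun y => hn k y ^ 2) = fun _ => 0 * 1 := by ext y; rw [h y]; norm_num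
    rw [e, J_cmul, zero_mul] at this
    have : (0:ℝ) < k.factorial := by positivity
    linarith

structure Sol (w wt wx wxx : ℝ → ℝ → ℝ) : Prop where
  cw : ContinuousOn (fun p : ℝ × ℝ => w p.1 p.2) (Ioi 0 ×ˢ univ)
  cwt : ContinuousOn (fun p : ℝ × ℝ => wt p.1 p.2) (Ioi 0 ×ˢ univ)
  cwx : ContinuousOn (fun p : ℝ × ℝ => wx p.1 p.2) (Ioi 0 ×ˢ univ)
  cwxx : ContinuousOn (fun p : ℝ × ℝ => wxx p.1 p.2) (Ioi 0 ×ˢ univ)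
  per : ∀ t > (0:ℝ), ∀ x : ℝ, w t (x + 2 * π) = w t x
  dt : ∀ t > (0:ℝ), ∀ x : ℝ, HasDerivAt (fun s => w s x) (wt t x) t
  dx : ∀ t > (0:ℝ), ∀ x : ℝ, HasDerivAt (w t) (wx t x) x
  dxx : ∀ t > (0:ℝ), ∀ x : ℝ, HasDerivAt (wx t) (wxx t x) x
  lip : ∀ η > (0:ℝ), ∃ L : ℝ, 0 ≤ L ∧ ∀ t ≥ η, ∀ x, |wt t x - wxx t x| ≤ L * (|w t x| + |wx t x|)
  nz : ∀ t > (0:ℝ), ∃ x, w t x ≠ 0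

theorem per_bdd {f : ℝ → ℝ → ℝ} (hc : ContinuousOn (fun p : ℝ × ℝ => f p.1 p.2) (Ioi 0 ×ˢ univ))
    (hp : ∀ t > (0:ℝ), ∀ x : ℝ, f t (x + 2 * π) = f t x) {a b : ℝ} (ha : 0 < a) :
    ∃ M, ∀ t ∈ Icc a b, ∀ x, |f t x| ≤ M := by
  have hK : IsCompact (Icc a b ×ˢ Icc 0 (2 * π)) := isCompact_Icc.prod isCompact_Icc
  obtain ⟨M, hM⟩ := hK.exists_bound_of_continuousOn (hc.mono (prod_mono
    (fun t ht => lt_of_lt_of_le ha ht.1) (subset_univ _)))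
  refine ⟨M, fun t ht x => ?_⟩
  have hper : Function.Periodic (f t) (2 * π) := hp t (lt_of_lt_of_le ha ht.1)
  obtain ⟨y, hy, e⟩ := hper.exists_mem_Ico₀ (by positivity) x
  rw [e]
  exact hM (t, y) ⟨ht, Ico_subset_Icc_self hy⟩

namespace Sol
variable {w wt wx wxx : ℝ → ℝ → ℝ}

theorem neg (h : Sol w wt wx wxx) : Sol (fun t x => - w t x) (fun t x => - wt t x) (fun t x => - wx t x) (fun t x => - wxx t x) where
  cw := h.cw.neg
  cwt := h.cwt.neg
  cwx := h.cwx.neg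
  cwxx := h.cwxx.neg
  per := fun t ht x => by rw [h.per t ht x]
  dt := fun t ht x => (h.dt t ht x).neg
  dx := fun t ht x => (h.dx t ht x).neg
  dxx := fun t ht x => (h.dxx t ht x).neg
  lip := fun η hη => by
    obtain ⟨L, hL, hb⟩ := h.lip η hη
    refine ⟨L, hL, fun t ht x => ?_⟩
    rw [abs_neg, abs_neg, ← abs_neg]
    refine le_trans (le_of_eq ?_) (hb t ht x)
    congr 1; ring
  nz := fun t ht => by
    obtain ⟨x, hx⟩ := h.nz t ht
    exact ⟨x, neg_ne_zero.2 hx⟩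

theorem perx (h : Sol w wt wx wxx) : ∀ t > (0:ℝ), ∀ x : ℝ, wx t (x + 2 * π) = wx t x := by
  intro t ht x
  have h1 := (h.dx t ht (x + 2 * π)).comp_add_const x (2 * π)
  have e : (fun y => w t (y + 2 * π)) = w t := by ext y; exact h.per t ht y
  rw [e] at h1
  exact h1.unique (h.dx t ht x)

theorem perxx (h : Sol w wt wx wxx) : ∀ t > (0:ℝ), ∀ x : ℝ, wxx t (x + 2 * π) = wxx t x := by
  intro t ht x
  have h1 := (h.dxx t ht (x + 2 * π)).comp_add_const x (2 * π)
  have e : (fun y => wx t (y + 2 * π)) = wx t := by ext y; exact h.perx t ht y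
  rw [e] at h1
  exact h1.unique (h.dxx t ht x)

theorem pert (h : Sol w wt wx wxx) : ∀ t > (0:ℝ), ∀ x : ℝ, wt t (x + 2 * π) = wt t x := by
  intro t ht x
  have h1 := h.dt t ht (x + 2 * π)
  have e : (fun s => w s (x + 2 * π)) =ᶠ[𝓝 t] fun s => w s x := by
    filter_upwards [Ioi_mem_nhds ht] with s hs using h.per s hs x
  exact (h1.congr_of_eventuallyEq e.symm).unique (h.dt t ht x)

theorem bdd (h : Sol w wt wx wxx) {a b : ℝ} (ha : 0 < a) : ∃ M, 0 ≤ M ∧ ∀ t ∈ Icc a b, ∀ x,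
    |w t x| ≤ M ∧ |wt t x| ≤ M ∧ |wx t x| ≤ M ∧ |wxx t x| ≤ M := by
  obtain ⟨M1, h1⟩ := per_bdd h.cw h.per (b := b) ha
  obtain ⟨M2, h2⟩ := per_bdd h.cwt h.pert (b := b) ha
  obtain ⟨M3, h3⟩ := per_bdd h.cwx h.perx (b := b) ha
  obtain ⟨M4, h4⟩ := per_bdd h.cwxx h.perxx (b := b) ha
  refine ⟨max 0 (max (max M1 M2) (max M3 M4)), le_max_left _ _, fun t ht x => ?_⟩
  refine ⟨(h1 t ht x).trans ?_, (h2 t ht x).trans ?_, (h3 t ht x).trans ?_, (h4 t ht x).trans ?_⟩ <;> simp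

theorem nhd {t x : ℝ} (ht : 0 < t) : (Ioi (0:ℝ) ×ˢ (univ : Set ℝ)) ∈ 𝓝 (t, x) :=
  (isOpen_Ioi.prod isOpen_univ).mem_nhds ⟨ht, mem_univ _⟩

theorem chain (h : Sol w wt wx wxx) {T X : ℝ → ℝ} {T' X' τ : ℝ} (hT : HasDerivAt T T' τ) (hX : HasDerivAt X X' τ)
    (h0 : 0 < T τ) : HasDerivAt (fun σ => w (T σ) (X σ)) (T' * wt (T τ) (X τ) + X' * wx (T τ) (X τ)) τ := by
  have hs := hasStrictFDerivAt_uncurry_coprod (𝕜 := ℝ) (u := (T τ, X τ)) (f := w)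
    (f₁ := fun t x => ContinuousLinearMap.toSpanSingleton ℝ (wt t x))
    (f₂ := fun t x => ContinuousLinearMap.toSpanSingleton ℝ (wx t x))
    (by
      filter_upwards [nhd (x := X τ) h0] with p hp
      exact (h.dt p.1 hp.1 p.2).hasFDerivAt)
    (by
      filter_upwards [nhd (x := X τ) h0] with p hp
      exact (h.dx p.1 hp.1 p.2).hasFDerivAt)
    (by
      have := h.cwt.continuousAt (nhd (x := X τ) h0)
      exact ((ContinuousLinearMap.toSpanSingletonCLE (𝕜 := ℝ) (E := ℝ)).continuous.continuousAt).comp this)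
    (by
      have := h.cwx.continuousAt (nhd (x := X τ) h0)
      exact ((ContinuousLinearMap.toSpanSingletonCLE (𝕜 := ℝ) (E := ℝ)).continuous.continuousAt).comp this)
  have h2 := hs.hasFDerivAt.comp_hasDerivAt τ (hT.prodMk hX)
  refine h2.congr_deriv ?_
  simp [Function.HasUncurry.uncurry]

end Sol

end

section
open Real Set Filter MeasureTheory Topology

namespace Sol
variable {w wt wx wxx : ℝ → ℝ → ℝ}

theorem exp2 (τ : ℝ) : exp (-(2 * τ)) = exp (-τ) ^ 2 := by rw [← exp_nat_mul]; congr 1; push_cast; ring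

theorem contx {f : ℝ → ℝ → ℝ} (hc : ContinuousOn (fun p : ℝ × ℝ => f p.1 p.2) (Ioi 0 ×ˢ univ)) {t : ℝ} (ht : 0 < t) :
    Continuous (f t) := by
  rw [continuous_iff_continuousAt]
  intro x
  have := hc.continuousAt (nhd (x := x) ht)
  exact this.comp (f := fun x => (t, x)) (by fun_prop)

theorem contc {f : ℝ → ℝ → ℝ} (hc : ContinuousOn (fun p : ℝ × ℝ => f p.1 p.2) (Ioi 0 ×ˢ univ)) {T X : ℝ → ℝ} {τ : ℝ}
    (hT : ContinuousAt T τ) (hX : ContinuousAt X τ) (h0 : 0 < T τ) : ContinuousAt (fun σ => f (T σ) (X σ)) τ := by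
  have := hc.continuousAt (nhd (x := X τ) h0)
  exact ContinuousAt.comp (f := fun σ => (T σ, X σ)) (g := fun p : ℝ × ℝ => f p.1 p.2) this (hT.prodMk hX)

theorem dTau (t1 τ : ℝ) : HasDerivAt (fun τ : ℝ => t1 - exp (-(2 * τ)) / 2) (exp (-(2 * τ))) τ := by
  have h2 : HasDerivAt (fun τ : ℝ => -(2 * τ)) (-2) τ := ((hasDerivAt_id τ).const_mul 2).neg.congr_deriv (by simp)
  exact ((h2.exp.div_const 2).const_sub t1).congr_deriv (by ring)

theorem dX (x1 y τ : ℝ) : HasDerivAt (fun τ : ℝ => x1 + exp (-τ) * y) (-(exp (-τ) * y)) τ := by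
  have h2 : HasDerivAt (fun τ : ℝ => -τ) (-1) τ := (hasDerivAt_id τ).neg
  exact ((h2.exp.mul_const y).const_add x1).congr_deriv (by ring)

theorem dY (x1 l y : ℝ) : HasDerivAt (fun y : ℝ => x1 + l * y) l y := by
  simpa using ((hasDerivAt_id y).const_mul l).const_add x1

theorem quad (h : Sol w wt wx wxx) {t1 x1 M : ℝ} (ht : 0 < t1) (h0 : w t1 x1 = 0) (h1 : wx t1 x1 = 0)
    (hM : 0 ≤ M)
    (hb : ∀ t ∈ Icc (t1/2) t1, ∀ x, |w t x| ≤ M ∧ |wt t x| ≤ M ∧ |wx t x| ≤ M ∧ |wxx t x| ≤ M)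
    {t : ℝ} (htt : t ∈ Icc (t1/2) t1) (x : ℝ) : |w t x| ≤ M * (t1 - t) + M * (x - x1) ^ 2 := by
  have ht1 : t1 ∈ Icc (t1/2) t1 := ⟨by linarith, le_rfl⟩
  have A : ∀ z, |wx t1 z| ≤ M * |z - x1| := by
    intro z
    have := convex_univ.norm_image_sub_le_of_norm_hasDerivWithin_le (f := wx t1) (f' := wxx t1) (C := M) (x := x1) (y := z)
      (fun z _ => (h.dxx t1 ht z).hasDerivWithinAt) (fun z _ => (hb t1 ht1 z).2.2.2) (mem_univ _) (mem_univ _)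
    simpa [h1] using this
  have B : |w t1 x| ≤ M * (x - x1) ^ 2 := by
    have := (convex_uIcc x1 x).norm_image_sub_le_of_norm_hasDerivWithin_le (f := w t1) (f' := wx t1) (C := M * |x - x1|) (x := x1) (y := x)
      (fun z _ => (h.dx t1 ht z).hasDerivWithinAt) (fun z hz => by
        refine (A z).trans (mul_le_mul_of_nonneg_left ?_ hM)
        exact abs_sub_left_of_mem_uIcc hz) left_mem_uIcc right_mem_uIcc
    rw [h0, sub_zero, Real.norm_eq_abs, Real.norm_eq_abs, mul_assoc, abs_mul_abs_self] at this
    linarith [this, sq (x - x1)]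
  have Cc : |w t1 x - w t x| ≤ M * (t1 - t) := by
    have := (convex_Icc (t1/2) t1).norm_image_sub_le_of_norm_hasDerivWithin_le (f := fun s => w s x) (f' := fun s => wt s x) (C := M) (x := t) (y := t1)
      (fun z hz => (h.dt z (by linarith [hz.1]) x).hasDerivWithinAt) (fun z hz => (hb z hz x).2.1) htt ht1
    rwa [Real.norm_eq_abs, Real.norm_eq_abs, abs_of_nonneg (by linarith [htt.2] : 0 ≤ t1 - t)] at this
  have := abs_sub_abs_le_abs_sub (w t x) (w t1 x)
  rw [abs_sub_comm] at this
  linarith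

theorem toRS (h : Sol w wt wx wxx) {t1 x1 : ℝ} (ht : 0 < t1) (h0 : w t1 x1 = 0) (h1 : wx t1 x1 = 0) :
    ∃ τ0 M L, (∀ τ > τ0, exp (-(2 * τ)) ≤ t1) ∧
     (∀ t ∈ Icc (t1/2) t1, ∀ x, |w t x| ≤ M ∧ |wt t x| ≤ M ∧ |wx t x| ≤ M ∧ |wxx t x| ≤ M) ∧
     (∀ t ∈ Icc (t1/2) t1, ∀ x, |wt t x - wxx t x| ≤ L * (|w t x| + |wx t x|)) ∧
     RS (fun τ y => w (t1 - exp (-(2 * τ)) / 2) (x1 + exp (-τ) * y))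
     (fun τ y => exp (-τ) * wx (t1 - exp (-(2 * τ)) / 2) (x1 + exp (-τ) * y))
     (fun τ y => exp (-τ) * (exp (-τ) * wxx (t1 - exp (-(2 * τ)) / 2) (x1 + exp (-τ) * y)))
     (fun τ y => exp (-(2 * τ)) * wt (t1 - exp (-(2 * τ)) / 2) (x1 + exp (-τ) * y) +
        -(exp (-τ) * y) * wx (t1 - exp (-(2 * τ)) / 2) (x1 + exp (-τ) * y)) τ0 M L := by
  obtain ⟨M, hM, hb⟩ := h.bdd (a := t1 / 2) (b := t1) (by linarith)
  obtain ⟨L, hL, hlip⟩ := h.lip (t1 / 2) (by linarith)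
  have lim : Tendsto (fun τ : ℝ => exp (-(2 * τ))) atTop (𝓝 0) :=
      tendsto_exp_neg_atTop_nhds_zero.comp (tendsto_id.const_mul_atTop (by norm_num))
  obtain ⟨T, hT⟩ := eventually_atTop.1 (lim.eventually (gt_mem_nhds ht))
  set τ0 := max T 0
  have hτ0 : ∀ τ > τ0, exp (-(2 * τ)) ≤ t1 := fun τ hτ => (hT τ ((le_max_left _ _).trans hτ.le)).le
  have hτ1 : ∀ τ > τ0, exp (-τ) ≤ 1 := fun τ hτ => by
    rw [exp_le_one_iff]; have := (le_max_right T 0).trans hτ.le; linarith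
  have hI : ∀ τ > τ0, t1 - exp (-(2 * τ)) / 2 ∈ Icc (t1/2) t1 := fun τ hτ =>
    ⟨by linarith [hτ0 τ hτ], by linarith [exp_pos (-(2 * τ))]⟩
  have hpos : ∀ τ > τ0, 0 < t1 - exp (-(2 * τ)) / 2 := fun τ hτ => by linarith [(hI τ hτ).1]
  have cT : ∀ τ, ContinuousAt (fun τ : ℝ => t1 - exp (-(2 * τ)) / 2) τ := fun τ => by fun_prop
  have cX : ∀ y τ, ContinuousAt (fun τ : ℝ => x1 + exp (-τ) * y) τ := fun y τ => by fun_prop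
  have cE : ∀ τ, ContinuousAt (fun τ : ℝ => exp (-τ)) τ := fun τ => by fun_prop
  have sm : ∀ τ > τ0, ∀ z, |z| ≤ M → |exp (-τ) * z| ≤ M := fun τ hτ z hz => by
    rw [abs_mul, abs_of_pos (exp_pos _)]
    calc _ ≤ 1 * |z| := mul_le_mul_of_nonneg_right (hτ1 τ hτ) (abs_nonneg _)
      _ ≤ M := by linarith
  refine ⟨τ0, M, L, hτ0, hb, fun t ht x => hlip t ht.1 x, ?_⟩
  constructor
  · exact le_max_right _ _
  · exact hM
  · exact hL
  · intro τ hτ y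
    exact h.chain (dTau t1 τ) (dX x1 y τ) (hpos τ hτ)
  · intro τ hτ y
    exact (HasDerivAt.comp (h₂ := w _) y (h.dx _ (hpos τ hτ) _) (dY x1 (exp (-τ)) y)).congr_deriv (by ring)
  · intro τ hτ y
    exact ((HasDerivAt.comp (h₂ := wx _) y (h.dxx _ (hpos τ hτ) _) (dY x1 (exp (-τ)) y)).const_mul (exp (-τ))).congr_deriv (by ring)
  · intro τ hτ
    have c1 := contx h.cwt (hpos τ hτ)
    have c2 := contx h.cwx (hpos τ hτ)
    fun_prop
  · intro τ hτ
    have c2 := contx h.cwxx (hpos τ hτ)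
    fun_prop
  · intro τ hτ y
    exact (cE τ).mul (contc h.cwx (cT τ) (cX y τ) (hpos τ hτ))
  · intro τ hτ y
    exact (cE τ).mul ((cE τ).mul (contc h.cwxx (cT τ) (cX y τ) (hpos τ hτ)))
  · intro τ hτ y; exact (hb _ (hI τ hτ) _).1
  · intro τ hτ y; exact sm τ hτ _ (hb _ (hI τ hτ) _).2.2.1
  · intro τ hτ y; exact sm τ hτ _ (sm τ hτ _ (hb _ (hI τ hτ) _).2.2.2)
  · intro τ hτ y
    have a1 : |exp (-(2 * τ)) * wt (t1 - exp (-(2 * τ)) / 2) (x1 + exp (-τ) * y)| ≤ M := by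
      rw [exp2, pow_two, mul_assoc, ← pow_two, ← exp2]
      exact sm τ hτ _ (sm τ hτ _ (hb _ (hI τ hτ) _).2.1)
    have a2 : |-(exp (-τ) * y) * wx (t1 - exp (-(2 * τ)) / 2) (x1 + exp (-τ) * y)| ≤ M * |y| := by
      rw [show -(exp (-τ) * y) * wx (t1 - exp (-(2 * τ)) / 2) (x1 + exp (-τ) * y) =
        (exp (-τ) * wx (t1 - exp (-(2 * τ)) / 2) (x1 + exp (-τ) * y)) * (-y) by ring, abs_mul, abs_neg]
      exact mul_le_mul_of_nonneg_right (sm τ hτ _ (hb _ (hI τ hτ) _).2.2.1) (abs_nonneg _)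
    refine (abs_add_le _ _).trans ?_
    linarith
  · intro τ hτ y
    have l := hlip _ (hI τ hτ).1 (x1 + exp (-τ) * y)
    generalize wt (t1 - exp (-(2 * τ)) / 2) (x1 + exp (-τ) * y) = A at *
    generalize wxx (t1 - exp (-(2 * τ)) / 2) (x1 + exp (-τ) * y) = B at *
    generalize wx (t1 - exp (-(2 * τ)) / 2) (x1 + exp (-τ) * y) = C at *
    generalize w (t1 - exp (-(2 * τ)) / 2) (x1 + exp (-τ) * y) = D at *
    have e0 := exp_pos (-τ)
    have e1 := hτ1 τ hτ
    rw [exp2, show exp (-τ) ^ 2 * A + -(exp (-τ) * y) * C - (exp (-τ) * (exp (-τ) * B) - y * (exp (-τ) * C)) = exp (-τ) ^ 2 * (A - B) by ring,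
      abs_mul, abs_mul (exp (-τ)) C, abs_of_pos e0, abs_of_pos (by positivity : 0 < exp (-τ) ^ 2)]
    calc exp (-τ) ^ 2 * |A - B| ≤ exp (-τ) ^ 2 * (L * (|D| + |C|)) := mul_le_mul_of_nonneg_left l (by positivity)
      _ = L * exp (-τ) * (exp (-τ) * |D| + exp (-τ) * |C|) := by ring
      _ ≤ L * exp (-τ) * (|D| + exp (-τ) * |C|) := by
        refine mul_le_mul_of_nonneg_left ?_ (by positivity)
        nlinarith [abs_nonneg D]
  · intro τ hτ
    obtain ⟨x, hx⟩ := h.nz _ (hpos τ hτ)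
    refine ⟨(x - x1) / exp (-τ), ?_⟩
    have e0 := exp_pos (-τ)
    rwa [mul_div_cancel₀ _ e0.ne', add_sub_cancel]
  · intro τ hτ y
    have := h.quad ht h0 h1 hM hb (hI τ hτ) (x1 + exp (-τ) * y)
    refine this.trans ?_
    rw [add_sub_cancel_left, mul_pow, ← exp2]
    have e0 := exp_pos (-(2 * τ))
    rw [show M * exp (-(2 * τ)) * (1 + |y|) ^ 2 = M * exp (-(2 * τ)) * (1 + 2 * |y| + y ^ 2) by rw [← sq_abs y]; ring]
    have : 0 ≤ M * exp (-(2 * τ)) := by positivity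
    nlinarith [mul_nonneg this (abs_nonneg y)]

end Sol

end

section
open Real Set Filter MeasureTheory Topology

theorem sgn_aux {v κ a e X : ℝ} (hκ : κ ≠ 0) (h : |v - κ * a| ≤ e * |κ| * X) (ha : e * X < |a|) : 0 < v * (κ * a) := by
  have h1 : |v - κ * a| < |κ * a| := by
    rw [abs_mul]
    calc _ ≤ _ := h
      _ = |κ| * (e * X) := by ring
      _ < _ := mul_lt_mul_of_pos_left ha (abs_pos.2 hκ)
  have := sq_lt_sq.2 h1
  nlinarith [sq_nonneg v]

theorem sgn_aux2 {v0 v1 κ a0 a1 : ℝ} (h0 : 0 < v0 * (κ * a0)) (h1 : 0 < v1 * (κ * a1)) (h : a0 * a1 < 0) : v0 * v1 < 0 := by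
  have := mul_pos h0 h1
  by_contra hc
  push Not at hc
  have : v0 * (κ * a0) * (v1 * (κ * a1)) = (v0 * v1) * κ ^ 2 * (a0 * a1) := by ring
  have : (v0 * v1) * κ ^ 2 * (a0 * a1) ≤ 0 := mul_nonpos_of_nonneg_of_nonpos (by positivity) h.le
  linarith

namespace Sol
variable {w wt wx wxx : ℝ → ℝ → ℝ}

theorem alt (h : Sol w wt wx wxx) {t1 x1 : ℝ} (ht : 0 < t1) (h0 : w t1 x1 = 0) (h1 : wx t1 x1 = 0) {δ : ℝ} (hδ : 0 < δ) :
    ∃ ε > 0, ∀ t, t1 - ε < t → t < t1 → ∃ y0 y1 y2, y0 < y1 ∧ y1 < y2 ∧ x1 - δ < y0 ∧ y2 < x1 + δ ∧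
      w t y0 * w t y1 < 0 ∧ w t y1 * w t y2 < 0 := by
  obtain ⟨τ0, M, L, -, -, -, hR⟩ := h.toRS ht h0 h1
  obtain ⟨k, hk, hap⟩ := hR.approx
  obtain ⟨y0, y1, y2, h01, h12, s01, s12⟩ := hn_alt k hk
  have n0 : 0 < |hn k y0| := abs_pos.2 (fun e => by simp [e] at s01)
  have n1 : 0 < |hn k y1| := abs_pos.2 (fun e => by simp [e] at s01)
  have n2 : 0 < |hn k y2| := abs_pos.2 (fun e => by simp [e] at s12)
  obtain ⟨e, he, he0, he1, he2⟩ : ∃ e > 0, e * exp (y0 ^ 2 / 4) < |hn k y0| ∧ e * exp (y1 ^ 2 / 4) < |hn k y1| ∧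
      e * exp (y2 ^ 2 / 4) < |hn k y2| := by
    have l : ∀ X : ℝ, Tendsto (fun e : ℝ => e * X) (𝓝[>] 0) (𝓝 0) := fun X => by
      have : ContinuousAt (fun e : ℝ => e * X) 0 := by fun_prop
      have := this.tendsto
      rw [zero_mul] at this
      exact this.mono_left nhdsWithin_le_nhds
    obtain ⟨e, ⟨⟨a, b⟩, c⟩, d⟩ := ((((l (exp (y0 ^ 2 / 4))).eventually (gt_mem_nhds n0)).and
      ((l (exp (y1 ^ 2 / 4))).eventually (gt_mem_nhds n1))).and
      ((l (exp (y2 ^ 2 / 4))).eventually (gt_mem_nhds n2))).and self_mem_nhdsWithin |>.exists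
    exact ⟨e, d, a, b, c⟩
  obtain ⟨T, hT, hv⟩ := hap e he
  have lim : Tendsto (fun τ : ℝ => exp (-τ) * (|y0| + |y2|)) atTop (𝓝 0) := by
    have := tendsto_exp_neg_atTop_nhds_zero.mul_const (|y0| + |y2|)
    rwa [zero_mul] at this
  obtain ⟨T', hT'⟩ := eventually_atTop.1 (lim.eventually (gt_mem_nhds hδ))
  refine ⟨exp (-(2 * max T T')) / 2, by positivity, fun t hlt hgt => ?_⟩
  set τ := - log (2 * (t1 - t)) / 2 with hτ
  have ex : exp (-(2 * τ)) = 2 * (t1 - t) := by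
    rw [hτ, show -(2 * (-log (2 * (t1 - t)) / 2)) = log (2 * (t1 - t)) by ring, exp_log (by linarith)]
  have hmax : max T T' ≤ τ := by
    have : exp (-(2 * τ)) ≤ exp (-(2 * max T T')) := by rw [ex]; linarith
    rw [exp_le_exp] at this; linarith
  obtain ⟨κ, hκ, hy⟩ := hv τ ((le_max_left _ _).trans hmax)
  have hδ' := hT' τ ((le_max_right _ _).trans hmax)
  have et : t1 - exp (-(2 * τ)) / 2 = t := by rw [ex]; ring
  simp only [et] at hy
  have p := exp_pos (-τ)
  refine ⟨x1 + exp (-τ) * y0, x1 + exp (-τ) * y1, x1 + exp (-τ) * y2, by nlinarith, by nlinarith, ?_, ?_,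
    sgn_aux2 (sgn_aux hκ (hy y0) he0) (sgn_aux hκ (hy y1) he1) s01,
    sgn_aux2 (sgn_aux hκ (hy y1) he1) (sgn_aux hκ (hy y2) he2) s12⟩
  · have : exp (-τ) * (-y0) ≤ exp (-τ) * (|y0| + |y2|) :=
      mul_le_mul_of_nonneg_left (by linarith [neg_abs_le y0, abs_nonneg y2]) p.le
    linarith
  · have : exp (-τ) * y2 ≤ exp (-τ) * (|y0| + |y2|) :=
      mul_le_mul_of_nonneg_left (by linarith [le_abs_self y2, abs_nonneg y0]) p.le
    linarith

end Sol

end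

section
open Real Set Filter MeasureTheory Topology

theorem hP_exp (k : ℕ) : ∃ K : ℝ, 0 ≤ K ∧ ∀ s y, |s| ≤ 1/2 → |hP k s y| + |k * hP (k - 1) s y| ≤ K * exp (y ^ 2 / 4) := by
  obtain ⟨C1, hC1, h1⟩ := hP_growth k
  obtain ⟨C2, hC2, h2⟩ := hP_growth (k - 1)
  obtain ⟨K1, hK1, g1⟩ := poly_le_exp k
  obtain ⟨K2, hK2, g2⟩ := poly_le_exp (k - 1)
  refine ⟨C1 * K1 + k * (C2 * K2), by positivity, fun s y hs => ?_⟩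
  have a := (h1 s y hs).trans (mul_le_mul_of_nonneg_left (g1 y) hC1)
  have b := (h2 s y hs).trans (mul_le_mul_of_nonneg_left (g2 y) hC2)
  have c := mul_le_mul_of_nonneg_left b (Nat.cast_nonneg (α := ℝ) k)
  rw [abs_mul, Nat.abs_cast]
  linarith

namespace Sol
variable {w wt wx wxx : ℝ → ℝ → ℝ}

theorem propag (h : Sol w wt wx wxx) {t1 x1 lam c σ M L K : ℝ} {k : ℕ} (hk : 2 ≤ k) (ht : 0 < t1) (hl : 0 < lam) (hl1 : lam ≤ 1)
    (hlt : lam ^ 2 ≤ t1) (hσ : |σ| = 1)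
    (hM : ∀ t ∈ Icc (t1/2) t1, ∀ x, |w t x| ≤ M) (hL0 : 0 ≤ L)
    (hL : ∀ t ∈ Icc (t1/2) t1, ∀ x, |wt t x - wxx t x| ≤ L * (|w t x| + |wx t x|))
    (hK : ∀ s y, |s| ≤ 1/2 → |hP k s y| + |k * hP (k - 1) s y| ≤ K * exp (y ^ 2 / 4))
    {ε : ℝ} (hε : 0 < ε) (l1 : lam * L ≤ 1) (l2 : lam * L * K ≤ ε)
    (hi : ∀ y, c * w (t1 - lam ^ 2 / 2) (x1 + lam * y) - σ * hn k y ≤ ε * exp (y ^ 2 / 4)) (y : ℝ) :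
    c * w t1 (x1 + lam * y) - σ * y ^ k ≤ ε * exp (y ^ 2 + 5) := by
  obtain ⟨m, rfl⟩ : ∃ m, k = m + 2 := ⟨k - 2, by omega⟩
  have hI : ∀ s, -1/2 ≤ s → s ≤ 0 → t1 + lam ^ 2 * s ∈ Icc (t1/2) t1 := fun s h1 h2 => by
    have : 0 < lam ^ 2 := by positivity
    constructor <;> nlinarith
  have hp : ∀ s, -1/2 ≤ s → s ≤ 0 → 0 < t1 + lam ^ 2 * s := fun s h1 h2 => by linarith [(hI s h1 h2).1]
  obtain ⟨C, hC, hCb⟩ := hP_growth (m + 2)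
  have hT : ∀ s, HasDerivAt (fun s : ℝ => t1 + lam ^ 2 * s) (lam ^ 2) s := fun s => by
    simpa using ((hasDerivAt_id s).const_mul (lam ^ 2)).const_add t1
  have hX : ∀ y, HasDerivAt (fun y : ℝ => x1 + lam * y) lam y := fun s => by
    simpa using ((hasDerivAt_id s).const_mul lam).const_add x1
  have B := barrier (Z := fun s y => c * w (t1 + lam ^ 2 * s) (x1 + lam * y) - σ * hP (m + 2) s y)
    (Zs := fun s y => c * (lam ^ 2 * wt (t1 + lam ^ 2 * s) (x1 + lam * y)) - σ * ((m + 2 : ℕ) * (((m + 2 : ℕ):ℝ) - 1) * hP (m + 2 - 2) s y))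
    (Zy := fun s y => c * (wx (t1 + lam ^ 2 * s) (x1 + lam * y) * lam) - σ * ((m + 2 : ℕ) * hP (m + 2 - 1) s y))
    (Zyy := fun s y => c * (wxx (t1 + lam ^ 2 * s) (x1 + lam * y) * lam * lam) - σ * ((m + 2 : ℕ) * ((m + 1 : ℕ) * hP (m + 1 - 1) s y)))
    (ε := ε) (C := |c| * M + C) (n := m + 2) hε ?_ ?_ ?_ ?_ ?_ ?_ ?_ 0 (by norm_num) le_rfl y
  · simp only [mul_zero, add_zero, hP_zero] at B
    convert B using 3
    norm_num
  · refine ContinuousOn.sub (ContinuousOn.mul continuousOn_const ?_) (continuousOn_const.mul (hP_cont _).continuousOn)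
    exact h.cw.comp (f := fun p : ℝ × ℝ => (t1 + lam ^ 2 * p.1, x1 + lam * p.2)) (by fun_prop)
      (fun p hp' => ⟨hp p.1 hp'.1.1 hp'.1.2, mem_univ _⟩)
  · intro s h1 h2 y
    have := h.chain (hT s) (hasDerivAt_const s (x1 + lam * y)) (hp s h1.le h2)
    exact ((this.congr_deriv (by ring)).const_mul c).sub ((hP_ds (m+2) s y).const_mul σ)
  · intro s h1 h2 y
    exact ((HasDerivAt.comp (h₂ := w _) y (h.dx _ (hp s h1.le h2) _) (hX y)).const_mul c).sub ((hP_dy (m+2) s y).const_mul σ)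
  · intro s h1 h2 y
    exact (((HasDerivAt.comp (h₂ := wx _) y (h.dxx _ (hp s h1.le h2) _) (hX y)).mul_const lam).const_mul c).sub
      (((hP_dy (m+1) s y).const_mul _).const_mul σ)
  · intro s h1 h2 y
    have hs : |s| ≤ 1/2 := by rw [abs_le]; constructor <;> linarith
    have a1 := hL _ (hI s h1.le h2) (x1 + lam * y)
    have a2 := hK s y hs
    simp only [Nat.add_sub_cancel, show m + 2 - 1 = m + 1 from rfl] at a2 ⊢
    set W := w (t1 + lam ^ 2 * s) (x1 + lam * y)
    set Wx := wx (t1 + lam ^ 2 * s) (x1 + lam * y)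
    set Wt := wt (t1 + lam ^ 2 * s) (x1 + lam * y)
    set Wxx := wxx (t1 + lam ^ 2 * s) (x1 + lam * y)
    set P := hP (m + 2) s y
    set Q := hP (m + 1) s y
    have b1 : |c * W| ≤ |c * W - σ * P| + |P| := by
      have := abs_add_le (c * W - σ * P) (σ * P)
      rw [abs_mul σ P, hσ, one_mul] at this
      simpa using this
    have b2 : |c * (Wx * lam)| ≤ |c * (Wx * lam) - σ * ((m + 2 : ℕ) * Q)| + |(m + 2 : ℕ) * Q| := by
      have := abs_add_le (c * (Wx * lam) - σ * ((m + 2 : ℕ) * Q)) (σ * ((m + 2 : ℕ) * Q))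
      rw [abs_mul σ _, hσ, one_mul] at this
      simpa using this
    have e : (c * (lam ^ 2 * Wt) - σ * ((m + 2 : ℕ) * (((m + 2 : ℕ):ℝ) - 1) * hP m s y)) - (c * (Wxx * lam * lam) - σ * ((m + 2 : ℕ) * ((m + 1 : ℕ) * hP m s y)))
      = c * lam ^ 2 * (Wt - Wxx) := by push_cast; ring
    rw [e]
    set A1 := |c * W - σ * P|
    set A2 := |c * (Wx * lam) - σ * ((m + 2 : ℕ) * Q)|
    have e1 : |c * W| = |c| * |W| := abs_mul _ _
    have e2 : |c * (Wx * lam)| = |c| * |Wx| * lam := by rw [abs_mul, abs_mul, abs_of_pos hl]; ring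
    have hlL : 0 ≤ lam * L := by positivity
    have hA : 0 ≤ A1 + A2 := by positivity
    calc c * lam ^ 2 * (Wt - Wxx) ≤ |c * lam ^ 2 * (Wt - Wxx)| := le_abs_self _
      _ = |c| * lam ^ 2 * |Wt - Wxx| := by rw [abs_mul, abs_mul, abs_of_pos (show 0 < lam ^ 2 by positivity)]
      _ ≤ |c| * lam ^ 2 * (L * (|W| + |Wx|)) := mul_le_mul_of_nonneg_left a1 (by positivity)
      _ = lam * L * (lam * (|c| * |W|) + |c| * |Wx| * lam) := by ring
      _ ≤ lam * L * (|c| * |W| + |c| * |Wx| * lam) := by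
          apply mul_le_mul_of_nonneg_left _ hlL
          have : lam * (|c| * |W|) ≤ 1 * (|c| * |W|) := mul_le_mul_of_nonneg_right hl1 (by positivity)
          linarith
      _ ≤ lam * L * (A1 + A2 + K * exp (y ^ 2 / 4)) := mul_le_mul_of_nonneg_left (by linarith) hlL
      _ = lam * L * (A1 + A2) + lam * L * K * exp (y ^ 2 / 4) := by ring
      _ ≤ 1 * (A1 + A2) + ε * exp (y ^ 2 / 4) := add_le_add (mul_le_mul_of_nonneg_right l1 hA)
          (mul_le_mul_of_nonneg_right l2 (exp_pos _).le)
      _ = _ := by ring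
  · intro s h1 h2 y
    have hs : |s| ≤ 1/2 := by rw [abs_le]; constructor <;> linarith
    have a1 := hM _ (hI s h1 h2) (x1 + lam * y)
    have a2 := hCb s y hs
    have : 1 ≤ (1 + |y|) ^ (m + 2) := one_le_pow₀ (by linarith [abs_nonneg y])
    have M0 : 0 ≤ M := (abs_nonneg _).trans a1
    calc _ ≤ |c * w (t1 + lam ^ 2 * s) (x1 + lam * y)| + |σ * hP (m + 2) s y| := abs_sub _ _
      _ = |c| * |w (t1 + lam ^ 2 * s) (x1 + lam * y)| + |hP (m + 2) s y| := by rw [abs_mul, abs_mul σ, hσ, one_mul]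
      _ ≤ |c| * M * 1 + C * (1 + |y|) ^ (m + 2) := by rw [mul_one]; exact add_le_add (mul_le_mul_of_nonneg_left a1 (abs_nonneg _)) a2
      _ ≤ |c| * M * (1 + |y|) ^ (m + 2) + C * (1 + |y|) ^ (m + 2) := by
        have := mul_le_mul_of_nonneg_left this (show 0 ≤ |c| * M by positivity); linarith
      _ = _ := by ring
  · intro y
    have := hi y
    rw [hn] at this
    have e : t1 + lam ^ 2 * (-1/2) = t1 - lam ^ 2 / 2 := by ring
    simp only [e]
    exact this

theorem iso (h : Sol w wt wx wxx) {t1 x1 : ℝ} (ht : 0 < t1) (h0 : w t1 x1 = 0) (h1 : wx t1 x1 = 0) :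
    ∃ η > 0, ∀ x, 0 < |x - x1| → |x - x1| < η → w t1 x ≠ 0 := by
  obtain ⟨τ0, M, L, hτ0, hM, hL, hR⟩ := h.toRS ht h0 h1
  obtain ⟨k, hk, hap⟩ := hR.approx
  obtain ⟨K, hK0, hK⟩ := hP_exp k
  set ε := exp (-6) / 4 with hε
  have hεp : 0 < ε := by positivity
  obtain ⟨T, hT, hv⟩ := hap ε hεp
  have l : ∀ X : ℝ, Tendsto (fun e : ℝ => e * X) (𝓝[>] 0) (𝓝 0) := fun X => by
    have : ContinuousAt (fun e : ℝ => e * X) 0 := by fun_prop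
    have := this.tendsto
    rw [zero_mul] at this
    exact this.mono_left nhdsWithin_le_nhds
  have ev : ∀ᶠ lam in 𝓝[>] (0:ℝ), (0 < lam ∧ lam * 1 < exp (-T)) ∧ (lam * L < 1 ∧ lam * (L * K) < ε) :=
    (Eventually.and self_mem_nhdsWithin ((l 1).eventually (gt_mem_nhds (exp_pos _)))).and
    (((l L).eventually (gt_mem_nhds one_pos)).and ((l (L * K)).eventually (gt_mem_nhds hεp)))
  obtain ⟨η, hη, hηs⟩ := mem_nhdsGT_iff_exists_Ioo_subset.1 ev
  refine ⟨η, hη, fun x hx hxη hw => ?_⟩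
  set lam := |x - x1| with hlam
  obtain ⟨⟨-, q1⟩, q2, q3⟩ : (0 < lam ∧ lam * 1 < exp (-T)) ∧ (lam * L < 1 ∧ lam * (L * K) < ε) := hηs ⟨hx, hxη⟩
  set τ := - log lam with hτ
  have ex : exp (-τ) = lam := by rw [hτ, neg_neg, exp_log hx]
  have hTτ : T ≤ τ := by
    have : exp (-τ) ≤ exp (-T) := by rw [ex]; linarith
    rw [exp_le_exp] at this; linarith
  have ex2 : exp (-(2 * τ)) = lam ^ 2 := by rw [exp2, ex]
  obtain ⟨κ, hκ, hy⟩ := hv τ hTτ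
  have hl1 : lam ≤ 1 := by
    rw [← ex, exp_le_one_iff]; linarith [hR.h0]
  have hlt := hτ0 τ (by linarith)
  rw [ex2] at hlt
  simp only [ex, ex2] at hy
  have hy' : ∀ y, |κ⁻¹ * w (t1 - lam ^ 2 / 2) (x1 + lam * y) - hn k y| ≤ ε * exp (y ^ 2 / 4) := fun y => by
    have := mul_le_mul_of_nonneg_left (hy y) (abs_nonneg κ⁻¹)
    rw [← abs_mul, mul_sub, ← mul_assoc κ⁻¹ κ, inv_mul_cancel₀ hκ, one_mul] at this
    refine this.trans (le_of_eq ?_)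
    rw [abs_inv]
    have := abs_pos.2 hκ
    field_simp
  have A := h.propag (x1 := x1) (c := κ⁻¹) (σ := 1) hk ht hx hl1 hlt (by simp) (fun t ht x => (hM t ht x).1) hR.hL hL hK hεp q2.le (by rw [mul_assoc]; exact q3.le)
    (fun y => by rw [one_mul]; exact (le_abs_self _).trans (hy' y)) ((x - x1) / lam)
  have B := h.propag (x1 := x1) (c := -κ⁻¹) (σ := -1) hk ht hx hl1 hlt (by simp) (fun t ht x => (hM t ht x).1) hR.hL hL hK hεp q2.le (by rw [mul_assoc]; exact q3.le)
    (fun y => by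
      have := (neg_le_abs _).trans (hy' y)
      linarith) ((x - x1) / lam)
  have ey : x1 + lam * ((x - x1) / lam) = x := by rw [mul_div_cancel₀ _ hx.ne']; ring
  have ea : |(x - x1) / lam| = 1 := by rw [abs_div, hlam, abs_abs, div_self hx.ne']
  have esq : ((x - x1) / lam) ^ 2 = 1 := by rw [← sq_abs, ea, one_pow]
  rw [ey, hw, esq, hε] at A B
  have eE : exp (-6) / 4 * exp (1 + 5) = 1 / 4 := by
    rw [div_mul_eq_mul_div, ← exp_add]; norm_num
  rw [eE] at A B
  have ep : |((x - x1) / lam) ^ k| = 1 := by rw [abs_pow, ea, one_pow]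
  rcases abs_cases (((x - x1) / lam) ^ k) with ⟨h, -⟩ | ⟨h, -⟩ <;> linarith

end Sol

end

section
open Real Set Filter MeasureTheory Topology

namespace Sol
variable {w wt wx wxx : ℝ → ℝ → ℝ}

theorem mp1 (h : Sol w wt wx wxx) {t1 t2 a b : ℝ} (ht : 0 < t1)
    (hini : ∀ x ∈ Icc a b, w t1 x ≤ 0) (hlat : ∀ t ∈ Icc t1 t2, w t a < 0 ∧ w t b < 0) :
    ∀ t ∈ Icc t1 t2, ∀ x ∈ Icc a b, w t x ≤ 0 := by
  intro t' ht' x' hx'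
  by_contra hc
  push Not at hc
  obtain ⟨L, hL, hlip⟩ := h.lip t1 ht
  have hK : IsCompact (Icc t1 t2 ×ˢ Icc a b) := isCompact_Icc.prod isCompact_Icc
  have hcont : ContinuousOn (fun p : ℝ × ℝ => exp (-((L + 1) * p.1)) * w p.1 p.2) (Icc t1 t2 ×ˢ Icc a b) := by
    refine ContinuousOn.mul (by fun_prop) (h.cw.mono (prod_mono (fun t ht' => lt_of_lt_of_le ht ht'.1) (subset_univ _)))
  obtain ⟨⟨t, x⟩, ⟨htm, hxm⟩, hmax⟩ := hK.exists_isMaxOn ⟨(t', x'), ht', hx'⟩ hcont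
  have hmax' : ∀ s ∈ Icc t1 t2, ∀ y ∈ Icc a b, exp (-((L + 1) * s)) * w s y ≤ exp (-((L + 1) * t)) * w t x :=
    fun s hs y hy => hmax (show (s, y) ∈ Icc t1 t2 ×ˢ Icc a b from ⟨hs, hy⟩)
  have hwp : 0 < w t x := by
    have := hmax' t' ht' x' hx'
    have h2 : 0 < exp (-((L + 1) * t')) * w t' x' := mul_pos (exp_pos _) hc
    exact (mul_pos_iff_of_pos_left (exp_pos _)).1 (h2.trans_le this)
  simp only at htm hxm
  have htp : 0 < t := ht.trans_le htm.1
  have htt : t1 < t := by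
    rcases eq_or_lt_of_le htm.1 with e | e
    · have := hini x hxm; rw [e] at this; linarith
    · exact e
  have hxa : a < x := by
    rcases eq_or_lt_of_le hxm.1 with e | e
    · have := (hlat t htm).1; rw [e] at this; linarith
    · exact e
  have hxb : x < b := by
    rcases eq_or_lt_of_le hxm.2 with e | e
    · have := (hlat t htm).2; rw [← e] at this; linarith
    · exact e
  obtain ⟨s1, s2⟩ := second_max (f := w t) (f' := wx t) (c := wxx t x) (x := x) (Eventually.of_forall (h.dx t htp)) (h.dxx t htp x) (by
    filter_upwards [Ioo_mem_nhds hxa hxb] with y hy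
    exact le_of_mul_le_mul_left (hmax' t htm y ⟨hy.1.le, hy.2.le⟩) (exp_pos _))
  have hE : HasDerivAt (fun r : ℝ => exp (-((L + 1) * r))) (exp (-((L + 1) * t)) * (-(L + 1))) t := by
    have := (((hasDerivAt_id t).const_mul (L + 1)).neg).exp
    exact this.congr_deriv (by simp)
  have s3 := left_max (hE.mul (h.dt t htp x)) (by
    filter_upwards [Ioo_mem_nhdsLT htt] with r hr
    exact hmax' r ⟨hr.1.le, hr.2.le.trans htm.2⟩ x hxm)
  have s4 := hlip t htm.1 x
  rw [s1, abs_zero, add_zero, abs_of_pos hwp] at s4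
  have s5 := (abs_le.1 s4).2
  have s6 : 0 ≤ exp (-((L + 1) * t)) * (wt t x - (L + 1) * w t x) := by linarith
  have s7 := (mul_nonneg_iff_of_pos_left (exp_pos _)).1 s6
  nlinarith

theorem mp2 (h : Sol w wt wx wxx) {t1 t2 a b x1 : ℝ} (ht : 0 < t1)
    (hini1 : ∀ x ∈ Icc a x1, w t1 x ≤ 0) (hini2 : ∀ x ∈ Icc x1 b, 0 ≤ w t1 x)
    (hlat : ∀ t ∈ Icc t1 t2, w t a < 0 ∧ 0 < w t b) :
    ∀ t ∈ Icc t1 t2, ∀ x ∈ Icc a b, ∀ y ∈ Icc a b, x < y → 0 < w t x → w t y < 0 → False := by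
  intro t' ht' x' hx' y' hy' hxy' hc1 hc2
  obtain ⟨L, hL, hlip⟩ := h.lip t1 ht
  set S : Set (ℝ × ℝ × ℝ) := (Icc t1 t2 ×ˢ (Icc a b ×ˢ Icc a b)) ∩ {p | p.2.1 ≤ p.2.2} with hS
  have hK : IsCompact S := (isCompact_Icc.prod (isCompact_Icc.prod isCompact_Icc)).inter_right
    (isClosed_le (by fun_prop) (by fun_prop))
  set K := 2 * L + 1 with hKd
  have hcont : ContinuousOn (fun p : ℝ × ℝ × ℝ => exp (-(K * p.1)) * (max (w p.1 p.2.1) 0 * max (-w p.1 p.2.2) 0)) S := by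
    refine ContinuousOn.mul (by fun_prop) (ContinuousOn.mul (ContinuousOn.sup ?_ continuousOn_const) (ContinuousOn.sup (ContinuousOn.neg ?_) continuousOn_const))
    · exact h.cw.comp (f := fun p : ℝ × ℝ × ℝ => (p.1, p.2.1)) (by fun_prop) (fun p hp => ⟨lt_of_lt_of_le ht hp.1.1.1, mem_univ _⟩)
    · exact h.cw.comp (f := fun p : ℝ × ℝ × ℝ => (p.1, p.2.2)) (by fun_prop) (fun p hp => ⟨lt_of_lt_of_le ht hp.1.1.1, mem_univ _⟩)
  obtain ⟨⟨t, x, y⟩, ⟨⟨htm, hxm, hym⟩, hxy⟩, hmax⟩ := hK.exists_isMaxOn ⟨(t', x', y'), ⟨ht', hx', hy'⟩, hxy'.le⟩ hcont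
  have hmax' : ∀ s ∈ Icc t1 t2, ∀ p ∈ Icc a b, ∀ q ∈ Icc a b, p ≤ q →
      exp (-(K * s)) * (max (w s p) 0 * max (-w s q) 0) ≤ exp (-(K * t)) * (max (w t x) 0 * max (-w t y) 0) :=
    fun s hs p hp q hq hpq => hmax (show (s, p, q) ∈ S from ⟨⟨hs, hp, hq⟩, hpq⟩)
  simp only at htm hxm hym
  have hxy1 : x ≤ y := hxy
  have hpos : 0 < max (w t x) 0 * max (-w t y) 0 := by
    have := hmax' t' ht' x' hx' y' hy' hxy'.le
    have h2 : 0 < exp (-(K * t')) * (max (w t' x') 0 * max (-w t' y') 0) :=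
      mul_pos (exp_pos _) (mul_pos (lt_max_of_lt_left hc1) (lt_max_of_lt_left (by linarith)))
    exact (mul_pos_iff_of_pos_left (exp_pos _)).1 (h2.trans_le this)
  have hA : 0 < w t x := by
    by_contra hn
    rw [max_eq_right (not_lt.1 hn), zero_mul] at hpos
    exact lt_irrefl _ hpos
  have hB : 0 < -w t y := by
    by_contra hn
    rw [max_eq_right (not_lt.1 hn), mul_zero] at hpos
    exact lt_irrefl _ hpos
  rw [max_eq_left hA.le, max_eq_left hB.le] at hmax'
  have htp : 0 < t := ht.trans_le htm.1
  have hxlt : x < y := lt_of_le_of_ne hxy1 (fun e => by rw [e] at hA; linarith)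
  have htt : t1 < t := by
    rcases eq_or_lt_of_le htm.1 with e | e
    · have h1 : x1 < x := by
        by_contra hn
        have := hini1 x ⟨hxm.1, not_lt.1 hn⟩
        rw [e] at this; linarith
      have h2 : y < x1 := by
        by_contra hn
        have := hini2 y ⟨not_lt.1 hn, hym.2⟩
        rw [e] at this; linarith
      linarith
    · exact e
  have hxa : a < x := by
    rcases eq_or_lt_of_le hxm.1 with e | e
    · have := (hlat t htm).1; rw [e] at this; linarith
    · exact e
  have hyb : y < b := by
    rcases eq_or_lt_of_le hym.2 with e | e
    · have := (hlat t htm).2; rw [← e] at this; linarith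
    · exact e
  obtain ⟨s1, s2⟩ := second_max (f := w t) (f' := wx t) (c := wxx t x) (x := x) (Eventually.of_forall (h.dx t htp)) (h.dxx t htp x) (by
    filter_upwards [Ioo_mem_nhds hxa hxlt] with z hz
    have := le_of_mul_le_mul_left (hmax' t htm z ⟨hz.1.le, hz.2.le.trans hym.2⟩ y hym hz.2.le) (exp_pos _)
    rw [max_eq_left hB.le] at this
    exact (le_max_left _ _).trans (le_of_mul_le_mul_right this hB))
  obtain ⟨r1, r2⟩ := second_max (f := fun z => - w t z) (f' := fun z => - wx t z) (c := - wxx t y) (x := y)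
    (Eventually.of_forall (fun z => (h.dx t htp z).neg)) (h.dxx t htp y).neg (by
    filter_upwards [Ioo_mem_nhds hxlt hyb] with z hz
    have := le_of_mul_le_mul_left (hmax' t htm x hxm z ⟨hxm.1.trans hz.1.le, hz.2.le⟩ hz.1.le) (exp_pos _)
    rw [max_eq_left hA.le] at this
    exact (le_max_left _ _).trans (le_of_mul_le_mul_left this hA))
  have hE : HasDerivAt (fun r : ℝ => exp (-(K * r))) (exp (-(K * t)) * (-K)) t := by
    have := (((hasDerivAt_id t).const_mul K).neg).exp
    exact this.congr_deriv (by simp)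
  have s3 := left_max (hE.mul ((h.dt t htp x).mul (h.dt t htp y).neg)) (by
    have c1 := (h.dt t htp x).continuousAt.eventually (lt_mem_nhds hA)
    have c2 := (h.dt t htp y).neg.continuousAt.eventually (lt_mem_nhds hB)
    filter_upwards [Ioo_mem_nhdsLT htt, nhdsWithin_le_nhds c1, nhdsWithin_le_nhds c2] with r hr d1 d2
    have d3 : 0 < - w r y := d2
    have := hmax' r ⟨hr.1.le, hr.2.le.trans htm.2⟩ x hxm y hym hxy1
    rw [max_eq_left d1.le, max_eq_left d3.le] at this
    exact this)
  have s4 := hlip t htm.1 x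
  rw [s1, abs_zero, add_zero, abs_of_pos hA] at s4
  have s5 := (abs_le.1 s4).2
  have r4 := hlip t htm.1 y
  rw [neg_eq_zero.1 r1, abs_zero, add_zero, ← abs_neg (w t y), abs_of_pos hB] at r4
  have r5 := (abs_le.1 r4).1
  have s6 : 0 ≤ exp (-(K * t)) * (-K * (w t x * -w t y) + (wt t x * -w t y + w t x * -wt t y)) := by
    refine s3.trans (le_of_eq ?_)
    simp only [Pi.mul_apply, Pi.neg_apply]
    ring
  have s7 := (mul_nonneg_iff_of_pos_left (exp_pos _)).1 s6
  have q1 : wt t x * -w t y ≤ L * w t x * -w t y := mul_le_mul_of_nonneg_right (by linarith) hB.le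
  have q2 : w t x * -wt t y ≤ w t x * (L * -w t y) := mul_le_mul_of_nonneg_left (by linarith) hA.le
  have q3 := mul_pos hA hB
  rw [hKd] at s7
  nlinarith

end Sol

end

section
open Real Set Filter MeasureTheory Topology

theorem simple_sgn {f : ℝ → ℝ} {x d : ℝ} (h : HasDerivAt f d x) (h0 : f x = 0) (hd : 0 < d) :
    (∀ᶠ y in 𝓝[>] x, 0 < f y) ∧ (∀ᶠ y in 𝓝[<] x, f y < 0) := by
  have h1 := hasDerivAt_iff_tendsto_slope.1 h
  have h2 := h1.eventually (lt_mem_nhds hd)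
  constructor
  · filter_upwards [h2.filter_mono (nhdsWithin_mono x (fun y (hy : x < y) => hy.ne')), self_mem_nhdsWithin] with y hy hxy
    rw [slope_def_field, h0, sub_zero] at hy
    exact (div_pos_iff_of_pos_right (sub_pos.2 hxy)).1 hy
  · filter_upwards [h2.filter_mono (nhdsWithin_mono x (fun y (hy : y < x) => hy.ne)), self_mem_nhdsWithin] with y hy hxy
    rw [slope_def_field, h0, sub_zero] at hy
    by_contra hn
    have := div_nonpos_of_nonneg_of_nonpos (not_lt.1 hn) (sub_nonpos.2 (le_of_lt hxy))
    linarith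

namespace Sol
variable {w wt wx wxx : ℝ → ℝ → ℝ}

theorem contw (h : Sol w wt wx wxx) {t : ℝ} (ht : 0 < t) : Continuous (w t) :=
  continuous_iff_continuousAt.2 fun x => (h.dx t ht x).continuousAt

theorem isoAll (h : Sol w wt wx wxx) {t1 x1 : ℝ} (ht : 0 < t1) (h0 : w t1 x1 = 0) :
    ∃ η > 0, ∀ x, 0 < |x - x1| → |x - x1| < η → w t1 x ≠ 0 := by
  by_cases h1 : wx t1 x1 = 0
  · exact h.iso ht h0 h1
  · have := (h.dx t1 ht x1).eventually_ne (c := 0) h1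
    rw [eventually_nhdsWithin_iff, Metric.eventually_nhds_iff] at this
    obtain ⟨η, hη, hx⟩ := this
    refine ⟨η, hη, fun x a b => hx (by rwa [Real.dist_eq]) (fun e => ?_)⟩
    rw [mem_singleton_iff.1 e] at a
    simp at a

theorem alt' (h : Sol w wt wx wxx) {t1 x1 t0 a b : ℝ} (ht : 0 < t1) (h0 : w t1 x1 = 0) (h1 : wx t1 x1 = 0)
    (ha : a < x1) (hb : x1 < b) (ht0 : t0 < t1) :
    ∃ t, t0 < t ∧ t < t1 ∧ ∃ y0 y1 y2, y0 < y1 ∧ y1 < y2 ∧ a < y0 ∧ y2 < b ∧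
      w t y0 * w t y1 < 0 ∧ w t y1 * w t y2 < 0 := by
  obtain ⟨ε, hε, hh⟩ := h.alt ht h0 h1 (δ := min (x1 - a) (b - x1)) (by simp [ha, hb])
  obtain ⟨t, hlt, hgt⟩ := exists_between (show max t0 (t1 - ε) < t1 by simp [ht0, hε])
  obtain ⟨y0, y1, y2, q1, q2, q3, q4, q5⟩ := hh t ((le_max_right _ _).trans_lt hlt) hgt
  exact ⟨t, (le_max_left _ _).trans_lt hlt, hgt, y0, y1, y2, q1, q2,
    by linarith [min_le_left (x1 - a) (b - x1)], by linarith [min_le_right (x1 - a) (b - x1)], q5⟩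

/-- same sign box: no zeros afterwards -/
theorem box1 (h : Sol w wt wx wxx) {t1 t2 a b : ℝ} (ht : 0 < t1)
    (hini : ∀ x ∈ Icc a b, w t1 x ≤ 0) (hlat : ∀ t ∈ Icc t1 t2, w t a < 0 ∧ w t b < 0) :
    ∀ t, t1 < t → t ≤ t2 → ∀ x ∈ Icc a b, w t x ≠ 0 := by
  intro t h1 h2 x hx hw
  have mp := h.mp1 ht hini hlat
  have htm : t ∈ Icc t1 t2 := ⟨h1.le, h2⟩
  have htp : 0 < t := ht.trans h1
  have hxa : a < x := by
    rcases eq_or_lt_of_le hx.1 with e | e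
    · have := (hlat t htm).1; rw [e] at this; linarith
    · exact e
  have hxb : x < b := by
    rcases eq_or_lt_of_le hx.2 with e | e
    · have := (hlat t htm).2; rw [← e] at this; linarith
    · exact e
  have hm : IsLocalMax (w t) x := by
    filter_upwards [Ioo_mem_nhds hxa hxb] with y hy
    rw [hw]; exact mp t htm y ⟨hy.1.le, hy.2.le⟩
  have hwx := hm.hasDerivAt_eq_zero (h.dx t htp x)
  obtain ⟨s, s1, s2, y0, y1, y2, q1, q2, q3, q4, q5, q6⟩ := h.alt' htp hw hwx hxa hxb h1
  have m0 := mp s ⟨s1.le, s2.le.trans h2⟩ y0 ⟨q3.le, by linarith⟩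
  have m1 := mp s ⟨s1.le, s2.le.trans h2⟩ y1 ⟨by linarith, by linarith⟩
  have := mul_nonneg_of_nonpos_of_nonpos m0 m1
  linarith

theorem box2 (h : Sol w wt wx wxx) {t1 t2 a b x1 : ℝ} (ht : 0 < t1)
    (hini1 : ∀ x ∈ Icc a x1, w t1 x ≤ 0) (hini2 : ∀ x ∈ Icc x1 b, 0 ≤ w t1 x)
    (hlat : ∀ t ∈ Icc t1 t2, w t a < 0 ∧ 0 < w t b) :
    ∀ t, t1 < t → t ≤ t2 → ∀ p ∈ Icc a b, ∀ q ∈ Icc a b, w t p = 0 → w t q = 0 → p = q := by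
  intro t h1 h2
  have mp := h.mp2 ht hini1 hini2 hlat
  have htm : t ∈ Icc t1 t2 := ⟨h1.le, h2⟩
  have htp : 0 < t := ht.trans h1
  have pos : ∀ x ∈ Icc a b, w t x = 0 → a < x ∧ x < b ∧ 0 < wx t x := by
    intro x hx hw
    have hxa : a < x := by
      rcases eq_or_lt_of_le hx.1 with e | e
      · have := (hlat t htm).1; rw [e] at this; linarith
      · exact e
    have hxb : x < b := by
      rcases eq_or_lt_of_le hx.2 with e | e
      · have := (hlat t htm).2; rw [← e] at this; linarith
      · exact e
    refine ⟨hxa, hxb, ?_⟩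
    rcases lt_trichotomy (wx t x) 0 with hd | hd | hd
    · exfalso
      obtain ⟨e1, e2⟩ := simple_sgn (h.dx t htp x).neg (by simp [hw]) (by linarith : 0 < - wx t x)
      obtain ⟨y, hy, hym⟩ := (e1.and (Ioo_mem_nhdsGT hxb)).exists
      obtain ⟨z, hz, hzm⟩ := (e2.and (Ioo_mem_nhdsLT hxa)).exists
      simp only [Pi.neg_apply] at hy hz
      exact mp t htm z ⟨hzm.1.le, by linarith [hzm.2]⟩ y ⟨by linarith [hym.1], hym.2.le⟩ (hzm.2.trans hym.1) (by linarith) (by linarith)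
    · exfalso
      obtain ⟨s, s1, s2, y0, y1, y2, q1, q2, q3, q4, q5, q6⟩ := h.alt' htp hw hd hxa hxb h1
      have hs : s ∈ Icc t1 t2 := ⟨s1.le, s2.le.trans h2⟩
      rcases mul_neg_iff.1 q5 with ⟨A, B⟩ | ⟨A, B⟩
      · exact mp s hs y0 ⟨q3.le, by linarith⟩ y1 ⟨by linarith, by linarith⟩ q1 A B
      · rcases mul_neg_iff.1 q6 with ⟨A', B'⟩ | ⟨A', B'⟩
        · exact mp s hs y1 ⟨by linarith, by linarith⟩ y2 ⟨by linarith, by linarith⟩ q2 A' B'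
        · linarith
    · exact hd
  have key : ∀ p ∈ Icc a b, ∀ q ∈ Icc a b, w t p = 0 → w t q = 0 → p < q → False := by
    intro p hp q hq wp wq hpq
    obtain ⟨pa, pb, pd⟩ := pos p hp wp
    obtain ⟨qa, qb, qd⟩ := pos q hq wq
    obtain ⟨m, m1, m2⟩ := exists_between hpq
    obtain ⟨y, hy, hym⟩ := ((simple_sgn (h.dx t htp p) wp pd).1.and (Ioo_mem_nhdsGT m1)).exists
    obtain ⟨z, hz, hzm⟩ := ((simple_sgn (h.dx t htp q) wq qd).2.and (Ioo_mem_nhdsLT m2)).exists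
    exact mp t htm y ⟨by linarith [hym.1], by linarith [hym.2]⟩ z ⟨by linarith [hzm.1], by linarith [hzm.2]⟩
      (by linarith [hym.2, hzm.1]) hy hz
  intro p hp q hq wp wq
  rcases lt_trichotomy p q with e | e | e
  · exact (key p hp q hq wp wq e).elim
  · exact e
  · exact (key q hq p hp wq wp e).elim

theorem sgn_right {f : ℝ → ℝ} (hf : Continuous f) {x b : ℝ} (h0 : f x = 0) (hne : ∀ y, x < y → y ≤ b → f y ≠ 0)
    (hb : 0 < f b) : ∀ y ∈ Icc x b, 0 ≤ f y := by
  intro y hy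
  by_contra hc
  push Not at hc
  obtain ⟨z, hz, e⟩ := intermediate_value_Icc hy.2 hf.continuousOn (show (0:ℝ) ∈ Icc (f y) (f b) from ⟨hc.le, hb.le⟩)
  rcases eq_or_lt_of_le hy.1 with e' | e'
  · rw [← e'] at hc; linarith
  · exact hne z (e'.trans_le hz.1) hz.2 e

theorem sgn_left {f : ℝ → ℝ} (hf : Continuous f) {x a : ℝ} (h0 : f x = 0) (hne : ∀ y, a ≤ y → y < x → f y ≠ 0)
    (ha : 0 < f a) : ∀ y ∈ Icc a x, 0 ≤ f y := by
  intro y hy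
  by_contra hc
  push Not at hc
  obtain ⟨z, hz, e⟩ := intermediate_value_Icc' hy.1 hf.continuousOn (show (0:ℝ) ∈ Icc (f y) (f a) from ⟨hc.le, ha.le⟩)
  rcases eq_or_lt_of_le hy.2 with e' | e'
  · rw [e'] at hc; linarith
  · exact hne z hz.1 (hz.2.trans_lt e') e

theorem after_neg (h : Sol w wt wx wxx) {t1 x1 a b : ℝ} (ht : 0 < t1) (h0 : w t1 x1 = 0)
    (ha : a < x1) (hb : x1 < b) (hne : ∀ x ∈ Icc a b, x ≠ x1 → w t1 x ≠ 0) (hsa : w t1 a < 0) :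
    ∃ ε > 0, ∀ t, t1 < t → t < t1 + ε →
      ∀ p ∈ Icc a b, ∀ q ∈ Icc a b, w t p = 0 → w t q = 0 → p = q := by
  have hc := h.contw ht
  have evt : ∀ {P : ℝ → Prop}, (∀ᶠ t in 𝓝 t1, P t) → ∃ ε > 0, ∀ t ∈ Icc t1 (t1 + ε), P t := by
    intro P hP
    obtain ⟨ε, hε, hh⟩ := Metric.eventually_nhds_iff.1 hP
    refine ⟨ε / 2, by linarith, fun t ht => hh ?_⟩
    rw [Real.dist_eq, abs_of_nonneg (by linarith [ht.1])]; linarith [ht.2]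
  have ca : ∀ᶠ t in 𝓝 t1, w t a < 0 := (h.dt t1 ht a).continuousAt.eventually (gt_mem_nhds hsa)
  have il : ∀ x ∈ Icc a x1, w t1 x ≤ 0 := fun x hx => by
    have := sgn_left (f := fun x => - w t1 x) hc.neg (by simp [h0]) (fun y h1 h2 => neg_ne_zero.2 (hne y ⟨h1, by linarith⟩ h2.ne)) (by linarith) x hx
    linarith
  rcases lt_or_gt_of_ne (hne b ⟨by linarith, le_rfl⟩ hb.ne') with hsb | hsb
  · have cb : ∀ᶠ t in 𝓝 t1, w t b < 0 := (h.dt t1 ht b).continuousAt.eventually (gt_mem_nhds hsb)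
    obtain ⟨ε, hε, hh⟩ := evt (ca.and cb)
    refine ⟨ε, hε, fun t h1 h2 p hp q hq wp => ?_⟩
    refine absurd wp (h.box1 ht (fun x hx => ?_) hh t h1 h2.le p hp)
    rcases le_total x x1 with e | e
    · exact il x ⟨hx.1, e⟩
    · have := sgn_right (f := fun x => - w t1 x) hc.neg (by simp [h0]) (fun y h1 h2 => neg_ne_zero.2 (hne y ⟨by linarith, h2⟩ h1.ne')) (by linarith) x ⟨e, hx.2⟩
      linarith
  · have cb : ∀ᶠ t in 𝓝 t1, 0 < w t b := (h.dt t1 ht b).continuousAt.eventually (lt_mem_nhds hsb)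
    obtain ⟨ε, hε, hh⟩ := evt (ca.and cb)
    refine ⟨ε, hε, fun t h1 h2 => ?_⟩
    exact h.box2 ht il (sgn_right hc h0 (fun y h1 h2 => (hne y ⟨by linarith, h2⟩ h1.ne')) hsb) hh t h1 h2.le

theorem after (h : Sol w wt wx wxx) {t1 x1 : ℝ} (ht : 0 < t1) (h0 : w t1 x1 = 0) :
    ∃ δ > 0, ∃ ε > 0, ∀ t, t1 < t → t < t1 + ε →
      ∀ p ∈ Icc (x1 - δ) (x1 + δ), ∀ q ∈ Icc (x1 - δ) (x1 + δ), w t p = 0 → w t q = 0 → p = q := by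
  obtain ⟨η, hη, hx⟩ := h.isoAll ht h0
  have hne : ∀ x ∈ Icc (x1 - η / 2) (x1 + η / 2), x ≠ x1 → w t1 x ≠ 0 := fun x hxm hxx =>
    hx x (abs_pos.2 (sub_ne_zero.2 hxx)) (by rw [abs_lt]; constructor <;> linarith [hxm.1, hxm.2])
  refine ⟨η / 2, by linarith, ?_⟩
  rcases lt_or_gt_of_ne (hne (x1 - η / 2) ⟨by linarith, by linarith⟩ (by linarith)) with hs | hs
  · exact h.after_neg ht h0 (by linarith) (by linarith) hne hs
  · obtain ⟨ε, hε, hh⟩ := h.neg.after_neg ht (by simp [h0]) (by linarith) (by linarith) (fun x a b => neg_ne_zero.2 (hne x a b)) (by linarith)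
    exact ⟨ε, hε, fun t a b p hp q hq wp wq => hh t a b p hp q hq (by simp [wp]) (by simp [wq])⟩

theorem before2 (h : Sol w wt wx wxx) {t1 x1 δ : ℝ} (ht : 0 < t1) (h0 : w t1 x1 = 0) (h1 : wx t1 x1 = 0) (hδ : 0 < δ) :
    ∃ ε > 0, ∀ t, t1 - ε < t → t < t1 → ∃ p q, p < q ∧ x1 - δ < p ∧ q < x1 + δ ∧ w t p = 0 ∧ w t q = 0 := by
  obtain ⟨ε, hε, hh⟩ := h.alt ht h0 h1 hδ
  refine ⟨min ε t1, lt_min hε ht, fun t hlt hgt => ?_⟩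
  obtain ⟨y0, y1, y2, q1, q2, q3, q4, q5, q6⟩ := hh t (by linarith [min_le_left ε t1]) hgt
  have hc := h.contw (t := t) (by linarith [min_le_right ε t1])
  have zr : ∀ a b, a < b → w t a * w t b < 0 → ∃ z, a < z ∧ z < b ∧ w t z = 0 := by
    intro a b hab hm
    rcases mul_neg_iff.1 hm with ⟨A, B⟩ | ⟨A, B⟩
    · obtain ⟨z, hz, e⟩ := intermediate_value_Ioo' hab.le hc.continuousOn (show (0:ℝ) ∈ Ioo (w t b) (w t a) from ⟨B, A⟩)
      exact ⟨z, hz.1, hz.2, e⟩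
    · obtain ⟨z, hz, e⟩ := intermediate_value_Ioo hab.le hc.continuousOn (show (0:ℝ) ∈ Ioo (w t a) (w t b) from ⟨A, B⟩)
      exact ⟨z, hz.1, hz.2, e⟩
  obtain ⟨p, p1, p2, p3⟩ := zr y0 y1 q1 q5
  obtain ⟨q, p4, p5, p6⟩ := zr y1 y2 q2 q6
  exact ⟨p, q, p2.trans p4, q3.trans p1, p5.trans q4, p3, p6⟩

theorem before1_pos (h : Sol w wt wx wxx) {t1 x1 δ : ℝ} (ht : 0 < t1) (h0 : w t1 x1 = 0) (h1 : 0 < wx t1 x1) (hδ : 0 < δ) :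
    ∃ ε > 0, ∀ t, t1 - ε < t → t < t1 → ∃ p, x1 - δ < p ∧ p < x1 + δ ∧ w t p = 0 := by
  obtain ⟨e1, e2⟩ := simple_sgn (h.dx t1 ht x1) h0 h1
  obtain ⟨b, hb, hbm⟩ := (e1.and (Ioo_mem_nhdsGT (show x1 < x1 + δ by linarith))).exists
  obtain ⟨a, ha, ham⟩ := (e2.and (Ioo_mem_nhdsLT (show x1 - δ < x1 by linarith))).exists
  have ca : ∀ᶠ t in 𝓝 t1, w t a < 0 := (h.dt t1 ht a).continuousAt.eventually (gt_mem_nhds ha)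
  have cb : ∀ᶠ t in 𝓝 t1, 0 < w t b := (h.dt t1 ht b).continuousAt.eventually (lt_mem_nhds hb)
  obtain ⟨ε, hε, hh⟩ := Metric.eventually_nhds_iff.1 (ca.and (cb.and (lt_mem_nhds ht)))
  refine ⟨ε, hε, fun t hlt hgt => ?_⟩
  obtain ⟨A, B, C⟩ := hh (y := t) (by rw [Real.dist_eq, abs_lt]; constructor <;> linarith)
  obtain ⟨z, hz, e⟩ := intermediate_value_Icc (ham.2.trans hbm.1).le (h.contw C).continuousOn (show (0:ℝ) ∈ Icc (w t a) (w t b) from ⟨A.le, B.le⟩)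
  exact ⟨z, ham.1.trans_le hz.1, hz.2.trans_lt hbm.2, e⟩

theorem before1 (h : Sol w wt wx wxx) {t1 x1 δ : ℝ} (ht : 0 < t1) (h0 : w t1 x1 = 0) (hδ : 0 < δ) :
    ∃ ε > 0, ∀ t, t1 - ε < t → t < t1 → ∃ p, x1 - δ < p ∧ p < x1 + δ ∧ w t p = 0 := by
  rcases lt_trichotomy (wx t1 x1) 0 with hd | hd | hd
  · obtain ⟨ε, hε, hh⟩ := h.neg.before1_pos (x1 := x1) ht (by simp [h0]) (by linarith) hδ
    refine ⟨ε, hε, fun t a b => ?_⟩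
    obtain ⟨p, p1, p2, p3⟩ := hh t a b
    exact ⟨p, p1, p2, neg_eq_zero.1 p3⟩
  · obtain ⟨ε, hε, hh⟩ := h.before2 ht h0 hd hδ
    refine ⟨ε, hε, fun t a b => ?_⟩
    obtain ⟨p, q, p1, p2, p3, p4, p5⟩ := hh t a b
    exact ⟨p, p2, by linarith, p4⟩
  · exact h.before1_pos ht h0 hd hδ

end Sol

end

section
open Real Set Filter MeasureTheory Topology


def zset (f : ℝ → ℝ) (c : ℝ) : Set ℝ := {x | x ∈ Ico c (c + 2 * π) ∧ f x = 0}

theorem zset_le {f : ℝ → ℝ} (hf : Function.Periodic f (2 * π)) (c c' : ℝ) : (zset f c).encard ≤ (zset f c').encard := by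
  have hp : 0 < 2 * π := by positivity
  refine encard_le_encard_of_injOn (f := toIcoMod hp c') ?_ ?_
  · rintro x ⟨hx, h0⟩
    refine ⟨toIcoMod_mem_Ico hp c' x, ?_⟩
    rw [toIcoMod, hf.sub_zsmul_eq]
    exact h0
  · rintro x ⟨hx, -⟩ y ⟨hy, -⟩ e
    have := congrArg (toIcoMod hp c) e
    rw [toIcoMod_toIcoMod, toIcoMod_toIcoMod, (toIcoMod_eq_self hp).2 hx, (toIcoMod_eq_self hp).2 hy] at this
    exact this

theorem zeroNum_eq {f : ℝ → ℝ} (hf : Function.Periodic f (2 * π)) (c : ℝ) : zeroNum f = (zset f c).encard := by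
  have : zeroNum f = (zset f 0).encard := by
    unfold zeroNum zset
    rw [zero_add]
  rw [this]
  exact le_antisymm (zset_le hf _ _) (zset_le hf _ _)

namespace Sol
variable {w wt wx wxx : ℝ → ℝ → ℝ}

theorem fin (h : Sol w wt wx wxx) {t1 : ℝ} (ht : 0 < t1) (c : ℝ) : (zset (w t1) c).Finite := by
  by_contra hinf
  obtain ⟨x, hx, hacc⟩ := Set.Infinite.exists_accPt_of_subset_isCompact (s := zset (w t1) c) hinf (isCompact_Icc (a := c) (b := c + 2 * π))
    (fun x hx => ⟨hx.1.1, hx.1.2.le⟩)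
  rw [accPt_iff_frequently] at hacc
  by_cases h0 : w t1 x = 0
  · obtain ⟨η, hη, hh⟩ := h.isoAll ht h0
    obtain ⟨y, ⟨hy1, hy2⟩, hy3⟩ := (hacc.and_eventually (Metric.ball_mem_nhds x hη)).exists
    rw [Real.dist_eq] at hy3
    exact hh y (abs_pos.2 (sub_ne_zero.2 hy1)) hy3 hy2.2
  · obtain ⟨y, ⟨hy1, hy2⟩, hy3⟩ := (hacc.and_eventually ((h.contw ht).continuousAt.eventually_ne h0)).exists
    exact hy3 hy2.2

theorem zN (h : Sol w wt wx wxx) {t : ℝ} (ht : 0 < t) (c : ℝ) : zeroNum (w t) = (zset (w t) c).encard :=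
  zeroNum_eq (h.per t ht) c

theorem evtAfter (h : Sol w wt wx wxx) {t1 : ℝ} (ht : 0 < t1) : ∀ᶠ t in 𝓝[>] t1, zeroNum (w t) ≤ zeroNum (w t1) := by
  obtain ⟨c, hc⟩ := h.nz t1 ht
  have hF := h.fin ht c
  have hA : ∀ p : ℝ, ∃ δ > 0, w t1 p = 0 → ∃ ε > 0, ∀ t, t1 < t → t < t1 + ε →
      ∀ r ∈ Icc (p - δ) (p + δ), ∀ q ∈ Icc (p - δ) (p + δ), w t r = 0 → w t q = 0 → r = q := by
    intro p
    by_cases h0 : w t1 p = 0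
    · obtain ⟨δ, hδ, hh⟩ := h.after ht h0
      exact ⟨δ, hδ, fun _ => hh⟩
    · exact ⟨1, one_pos, fun e => absurd e h0⟩
  choose δ hδ hD using hA
  have hU : ∀ᶠ t in 𝓝[>] t1, ∀ p ∈ zset (w t1) c, 
      ∀ r ∈ Icc (p - δ p) (p + δ p), ∀ q ∈ Icc (p - δ p) (p + δ p), w t r = 0 → w t q = 0 → r = q := by
    rw [eventually_all_finite hF]
    intro p hp
    obtain ⟨ε, hε, hh⟩ := hD p hp.2
    filter_upwards [Ioo_mem_nhdsGT (show t1 < t1 + ε by linarith)] with t ht using hh t ht.1 ht.2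
  set K : Set ℝ := Icc c (c + 2 * π) \ ⋃ p ∈ zset (w t1) c, Ioo (p - δ p) (p + δ p) with hK
  have hKc : IsCompact K := isCompact_Icc.diff (isOpen_biUnion fun p _ => isOpen_Ioo)
  have hKe : ∀ᶠ t in 𝓝 t1, ∀ y ∈ K, w t y ≠ 0 := by
    refine hKc.eventually_forall_of_forall_eventually fun y hy => ?_
    have hne : w t1 y ≠ 0 := by
      intro h0
      have hy1 := hy.1
      rcases eq_or_lt_of_le hy1.2 with e | e
      · rw [e, h.per t1 ht] at h0; exact hc h0
      · refine hy.2 (mem_biUnion (show y ∈ zset (w t1) c from ⟨⟨hy1.1, e⟩, h0⟩) ⟨by linarith [hδ y], by linarith [hδ y]⟩)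
    exact (h.cw.continuousAt (nhd (x := y) ht)).eventually_ne hne
  filter_upwards [hU, nhdsWithin_le_nhds hKe, self_mem_nhdsWithin] with t hu hk htt
  have htt' : t1 < t := htt
  rw [h.zN ht c, h.zN (ht.trans htt') c]
  have hex : ∀ y, ∃ p, y ∈ zset (w t) c → p ∈ zset (w t1) c ∧ y ∈ Ioo (p - δ p) (p + δ p) := by
    intro y
    by_cases hy : y ∈ zset (w t) c
    · have : y ∉ K := fun hn => hk y hn hy.2
      rw [hK, Set.mem_sdiff] at this
      push Not at this
      have := this ⟨hy.1.1, hy.1.2.le⟩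
      obtain ⟨p, hp, hpy⟩ := mem_iUnion₂.1 this
      exact ⟨p, fun _ => ⟨hp, hpy⟩⟩
    · exact ⟨0, fun e => absurd e hy⟩
  choose f hf using hex
  refine encard_le_encard_of_injOn (f := f) (fun y hy => (hf y hy).1) ?_
  intro y hy z hz e
  have h1 := hf y hy
  have h2 := hf z hz
  rw [← e] at h2
  exact hu (f y) h1.1 y (Ioo_subset_Icc_self h1.2) z (Ioo_subset_Icc_self h2.2) hy.2 hz.2

theorem evtBefore (h : Sol w wt wx wxx) {t1 : ℝ} (ht : 0 < t1) :
    (∀ᶠ t in 𝓝[<] t1, zeroNum (w t1) ≤ zeroNum (w t)) ∧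
    ((∃ x, w t1 x = 0 ∧ wx t1 x = 0) → ∀ᶠ t in 𝓝[<] t1, zeroNum (w t1) + 1 ≤ zeroNum (w t)) := by
  obtain ⟨c, hc⟩ := h.nz t1 ht
  have hF := h.fin ht c
  have hδ : ∀ᶠ δ in 𝓝[>] (0:ℝ), ∀ p ∈ zset (w t1) c, ∀ q ∈ zset (w t1) c, p ≠ q → 2 * δ < |p - q| := by
    rw [eventually_all_finite hF]
    intro p hp
    rw [eventually_all_finite hF]
    intro q hq
    by_cases e : p = q
    · exact Eventually.of_forall fun _ h => absurd e h
    · have := abs_pos.2 (sub_ne_zero.2 e)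
      filter_upwards [Ioo_mem_nhdsGT (show 0 < |p - q| / 2 by linarith)] with δ hd _
      linarith [hd.2]
  have hδ2 : ∀ᶠ δ in 𝓝[>] (0:ℝ), ∀ p ∈ zset (w t1) c, c < p - δ ∧ p + δ < c + 2 * π := by
    rw [eventually_all_finite hF]
    intro p hp
    have hcp : c < p := lt_of_le_of_ne hp.1.1 (fun e => hc (e ▸ hp.2))
    filter_upwards [Ioo_mem_nhdsGT (show 0 < p - c by linarith), Ioo_mem_nhdsGT (show 0 < c + 2 * π - p by linarith [hp.1.2])] with δ h1 h2
    exact ⟨by linarith [h1.2], by linarith [h2.2]⟩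
  obtain ⟨δ, ⟨hd1, hd2⟩, hd0⟩ := ((hδ.and hδ2).and self_mem_nhdsWithin).exists
  have hd0 : 0 < δ := hd0
  have hU : ∀ᶠ t in 𝓝[<] t1, ∀ p ∈ zset (w t1) c, ∃ q, p - δ < q ∧ q < p + δ ∧ w t q = 0 := by
    rw [eventually_all_finite hF]
    intro p hp
    obtain ⟨ε, hε, hh⟩ := h.before1 ht hp.2 hd0
    filter_upwards [Ioo_mem_nhdsLT (show t1 - ε < t1 by linarith)] with t ht using hh t ht.1 ht.2
  have hpos : ∀ᶠ t in 𝓝[<] t1, 0 < t := nhdsWithin_le_nhds (lt_mem_nhds ht)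
  have inj : ∀ p ∈ zset (w t1) c, ∀ q ∈ zset (w t1) c, ∀ z, p - δ < z → z < p + δ → q - δ < z → z < q + δ → p = q := by
    intro p hp q hq z z1 z2 z3 z4
    by_contra e
    have := hd1 p hp q hq e
    have : |p - q| < 2 * δ := by rw [abs_lt]; constructor <;> linarith
    linarith
  constructor
  · filter_upwards [hU, hpos] with t hu htp
    rw [h.zN ht c, h.zN htp c]
    have : ∀ p, ∃ q, p ∈ zset (w t1) c → p - δ < q ∧ q < p + δ ∧ w t q = 0 := fun p => by
      by_cases hp : p ∈ zset (w t1) c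
      · obtain ⟨q, hq⟩ := hu p hp
        exact ⟨q, fun _ => hq⟩
      · exact ⟨0, fun e => absurd e hp⟩
    choose f hf using this
    refine encard_le_encard_of_injOn (f := f) (fun p hp => ?_) (fun p hp q hq e => ?_)
    · obtain ⟨a, b, d⟩ := hf p hp
      obtain ⟨a', b'⟩ := hd2 p hp
      exact ⟨⟨by linarith, by linarith⟩, d⟩
    · have a := hf p hp
      have b := hf q hq
      rw [← e] at b
      exact inj p hp q hq (f p) a.1 a.2.1 b.1 b.2.1
  · rintro ⟨x, hx0, hx1⟩
    have hper : Function.Periodic (fun y => (w t1 y, wx t1 y)) (2 * π) := fun y => by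
      simp only [h.per t1 ht y, h.perx t1 ht y]
    obtain ⟨x0, hxm, e⟩ := hper.exists_mem_Ico (by positivity) x c
    simp only [hx0, hx1, Prod.mk.injEq] at e
    have hx0m : x0 ∈ zset (w t1) c := ⟨hxm, e.1.symm⟩
    obtain ⟨ε, hε, hh⟩ := h.before2 ht e.1.symm e.2.symm hd0
    filter_upwards [hU, hpos, Ioo_mem_nhdsLT (show t1 - ε < t1 by linarith)] with t hu htp htm
    rw [h.zN ht c, h.zN htp c]
    have : ∀ p, ∃ q, p ∈ zset (w t1) c → p - δ < q ∧ q < p + δ ∧ w t q = 0 := fun p => by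
      by_cases hp : p ∈ zset (w t1) c
      · obtain ⟨q, hq⟩ := hu p hp
        exact ⟨q, fun _ => hq⟩
      · exact ⟨0, fun e => absurd e hp⟩
    choose f hf using this
    obtain ⟨r, r1, r2, r3, r4⟩ : ∃ r, x0 - δ < r ∧ r < x0 + δ ∧ w t r = 0 ∧ r ≠ f x0 := by
      obtain ⟨p, q, a1, a2, a3, a4, a5⟩ := hh t htm.1 htm.2
      by_cases e : p = f x0
      · exact ⟨q, by linarith, a3, a5, by rw [← e]; exact a1.ne'⟩
      · exact ⟨p, a2, by linarith, a4, e⟩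
    have finj : InjOn f (zset (w t1) c) := fun p hp q hq e => by
      have a := hf p hp
      have b := hf q hq
      rw [← e] at b
      exact inj p hp q hq (f p) a.1 a.2.1 b.1 b.2.1
    have hr : r ∉ f '' zset (w t1) c := by
      rintro ⟨p, hp, ep⟩
      have a := hf p hp
      rw [ep] at a
      have := inj p hp x0 hx0m r a.1 a.2.1 r1 r2
      rw [this] at ep
      exact r4 ep.symm
    rw [← finj.encard_image, ← encard_insert_of_notMem hr]
    apply encard_le_encard
    rintro z (rfl | ⟨p, hp, rfl⟩)
    · obtain ⟨a', b'⟩ := hd2 x0 hx0m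
      exact ⟨⟨by linarith, by linarith⟩, r3⟩
    · obtain ⟨a, b, d⟩ := hf p hp
      obtain ⟨a', b'⟩ := hd2 p hp
      exact ⟨⟨by linarith, by linarith⟩, d⟩

theorem anti (h : Sol w wt wx wxx) {s t : ℝ} (hs : 0 < s) (hst : s ≤ t) : zeroNum (w t) ≤ zeroNum (w s) := by
  by_contra hc
  push Not at hc
  set A : Set ℝ := {r | s ≤ r ∧ zeroNum (w s) < zeroNum (w r)} with hA
  have hne : A.Nonempty := ⟨t, hst, hc⟩
  have hbd : BddBelow A := ⟨s, fun r hr => hr.1⟩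
  set m := sInf A with hm
  have hsm : s ≤ m := le_csInf hne fun r hr => hr.1
  have hmp : 0 < m := hs.trans_le hsm
  have lo : ∀ r, s ≤ r → r < m → zeroNum (w r) ≤ zeroNum (w s) := fun r h1 h2 => by
    by_contra hn
    push Not at hn
    exact absurd (csInf_le hbd (show r ∈ A from ⟨h1, hn⟩)) (not_le.2 h2)
  have hmA : zeroNum (w m) ≤ zeroNum (w s) := by
    rcases eq_or_lt_of_le hsm with e | e
    · rw [← e]
    · obtain ⟨r, hr, hr2⟩ := ((h.evtBefore hmp).1.and (Ioo_mem_nhdsLT e)).exists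
      exact hr.trans (lo r hr2.1.le hr2.2)
  obtain ⟨u, hu, hus⟩ := mem_nhdsGT_iff_exists_Ioo_subset.1 (h.evtAfter hmp)
  have : u ≤ m := by
    refine le_csInf hne fun r hr => ?_
    by_contra hn
    push Not at hn
    have hmr : m ≤ r := csInf_le hbd hr
    rcases eq_or_lt_of_le hmr with e | e
    · have := hr.2; rw [← e] at this; exact absurd hmA (not_le.2 this)
    · have h3 : zeroNum (w r) ≤ zeroNum (w m) := hus ⟨e, hn⟩
      exact absurd (h3.trans hmA) (not_le.2 hr.2)
  exact absurd this (not_le.2 hu)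

theorem main (h : Sol w wt wx wxx) {t0 x0 s t : ℝ} (ht : 0 < t0) (h0 : w t0 x0 = 0) (h1 : wx t0 x0 = 0)
    (hs : 0 < s) (hst : s < t0) (htt : t0 < t) : zeroNum (w t) < zeroNum (w s) := by
  obtain ⟨r, hr, hr2⟩ := (((h.evtBefore ht).2 ⟨x0, h0, h1⟩).and (Ioo_mem_nhdsLT hst)).exists
  have hfin : zeroNum (w t0) ≠ ⊤ := by
    rw [h.zN ht 0]; exact (h.fin ht 0).encard_lt_top.ne
  calc zeroNum (w t) ≤ zeroNum (w t0) := h.anti ht htt.le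
    _ < zeroNum (w t0) + 1 := by
      exact (ENat.lt_add_one_iff hfin).2 le_rfl
    _ ≤ zeroNum (w r) := hr
    _ ≤ zeroNum (w s) := h.anti hs hr2.1.le

end Sol

theorem mvt_abs {f f' : ℝ → ℝ} {M B a b : ℝ} (hf : ∀ x, HasDerivAt f (f' x) x) (hB : ∀ x ∈ Icc (-M) M, |f' x| ≤ B)
    (ha : |a| ≤ M) (hb : |b| ≤ M) : |f a - f b| ≤ B * |a - b| := by
  have := (convex_Icc (-M) M).norm_image_sub_le_of_norm_hasDerivWithin_le (f := f) (f' := f') (C := B)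
    (fun x _ => (hf x).hasDerivWithinAt) (fun x hx => hB x hx) (abs_le.1 hb) (abs_le.1 ha)
  simpa [Real.norm_eq_abs] using this

end

theorem stmt5
    (g gu gp guu gup gpu gpp : ℝ → ℝ → ℝ → ℝ)
    (hg_cont : Continuous (fun p : ℝ × ℝ × ℝ => g p.1 p.2.1 p.2.2))
    (hgC2 : ∀ t : ℝ, ContDiff ℝ 2 (fun q : ℝ × ℝ => g t q.1 q.2))
    (hgu : ∀ t u p : ℝ, HasDerivAt (fun v => g t v p) (gu t u p) u)
    (hgp : ∀ t u p : ℝ, HasDerivAt (fun q => g t u q) (gp t u p) p)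
    (hguu : ∀ t u p : ℝ, HasDerivAt (fun v => gu t v p) (guu t u p) u)
    (hgup : ∀ t u p : ℝ, HasDerivAt (fun q => gu t u q) (gup t u p) p)
    (hgpu : ∀ t u p : ℝ, HasDerivAt (fun v => gp t v p) (gpu t u p) u)
    (hgpp : ∀ t u p : ℝ, HasDerivAt (fun q => gp t u q) (gpp t u p) p)
    (hadm : Admissible g ∧ Admissible gu ∧ Admissible gp ∧
      Admissible guu ∧ Admissible gup ∧ Admissible gpu ∧ Admissible gpp)
    (u₁ u₂ u₁t u₁x u₁xx u₂t u₂x u₂xx : ℝ → ℝ → ℝ)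
    (hu₁_cont : ContinuousOn (fun p : ℝ × ℝ => u₁ p.1 p.2) (Set.Ici 0 ×ˢ Set.univ))
    (hu₂_cont : ContinuousOn (fun p : ℝ × ℝ => u₂ p.1 p.2) (Set.Ici 0 ×ˢ Set.univ))
    (hu₁t_cont : ContinuousOn (fun p : ℝ × ℝ => u₁t p.1 p.2) (Set.Ioi 0 ×ˢ Set.univ))
    (hu₁x_cont : ContinuousOn (fun p : ℝ × ℝ => u₁x p.1 p.2) (Set.Ioi 0 ×ˢ Set.univ))
    (hu₁xx_cont : ContinuousOn (fun p : ℝ × ℝ => u₁xx p.1 p.2) (Set.Ioi 0 ×ˢ Set.univ))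
    (hu₂t_cont : ContinuousOn (fun p : ℝ × ℝ => u₂t p.1 p.2) (Set.Ioi 0 ×ˢ Set.univ))
    (hu₂x_cont : ContinuousOn (fun p : ℝ × ℝ => u₂x p.1 p.2) (Set.Ioi 0 ×ˢ Set.univ))
    (hu₂xx_cont : ContinuousOn (fun p : ℝ × ℝ => u₂xx p.1 p.2) (Set.Ioi 0 ×ˢ Set.univ))
    (hu₁per : ∀ t ≥ (0:ℝ), ∀ x : ℝ, u₁ t (x + 2 * Real.pi) = u₁ t x)
    (hu₂per : ∀ t ≥ (0:ℝ), ∀ x : ℝ, u₂ t (x + 2 * Real.pi) = u₂ t x)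
    (hu₁_dt : ∀ t > (0:ℝ), ∀ x : ℝ, HasDerivAt (fun s => u₁ s x) (u₁t t x) t)
    (hu₁_dx : ∀ t > (0:ℝ), ∀ x : ℝ, HasDerivAt (fun y => u₁ t y) (u₁x t x) x)
    (hu₁_dxx : ∀ t > (0:ℝ), ∀ x : ℝ, HasDerivAt (fun y => u₁x t y) (u₁xx t x) x)
    (hu₂_dt : ∀ t > (0:ℝ), ∀ x : ℝ, HasDerivAt (fun s => u₂ s x) (u₂t t x) t)
    (hu₂_dx : ∀ t > (0:ℝ), ∀ x : ℝ, HasDerivAt (fun y => u₂ t y) (u₂x t x) x)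
    (hu₂_dxx : ∀ t > (0:ℝ), ∀ x : ℝ, HasDerivAt (fun y => u₂x t y) (u₂xx t x) x)
    (heq₁ : ∀ t > (0:ℝ), ∀ x : ℝ, u₁t t x = u₁xx t x + g t (u₁ t x) (u₁x t x))
    (heq₂ : ∀ t > (0:ℝ), ∀ x : ℝ, u₂t t x = u₂xx t x + g t (u₂ t x) (u₂x t x))
    (hbdd : ∀ η > (0:ℝ), ∃ M : ℝ, ∀ t ≥ η, ∀ x : ℝ,
      |u₁ t x| ≤ M ∧ |u₁x t x| ≤ M ∧ |u₂ t x| ≤ M ∧ |u₂x t x| ≤ M)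
    (hdist : ∀ t ≥ (0:ℝ), ∃ x : ℝ, u₁ t x ≠ u₂ t x)
    (t₀ : ℝ) (ht₀ : 0 < t₀) (x₀ : ℝ)
    (hmul : u₁ t₀ x₀ - u₂ t₀ x₀ = 0 ∧ u₁x t₀ x₀ - u₂x t₀ x₀ = 0) :
    ∀ s t : ℝ, 0 < s → s < t₀ → t₀ < t →
      zeroNum (fun x => u₁ t x - u₂ t x) < zeroNum (fun x => u₁ s x - u₂ s x) := by
  intro s t hs hst htt
  have hsub : (Set.Ioi (0:ℝ) ×ˢ (Set.univ : Set ℝ)) ⊆ Set.Ici 0 ×ˢ Set.univ :=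
    prod_mono Ioi_subset_Ici_self subset_rfl
  have hSol : Sol (fun t x => u₁ t x - u₂ t x) (fun t x => u₁t t x - u₂t t x) (fun t x => u₁x t x - u₂x t x)
      (fun t x => u₁xx t x - u₂xx t x) := by
    constructor
    · exact (hu₁_cont.mono hsub).sub (hu₂_cont.mono hsub)
    · exact hu₁t_cont.sub hu₂t_cont
    · exact hu₁x_cont.sub hu₂x_cont
    · exact hu₁xx_cont.sub hu₂xx_cont
    · intro t ht x
      simp only [hu₁per t ht.le x, hu₂per t ht.le x]
    · intro t ht x
      exact (hu₁_dt t ht x).sub (hu₂_dt t ht x)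
    · intro t ht x
      exact (hu₁_dx t ht x).sub (hu₂_dx t ht x)
    · intro t ht x
      exact (hu₁_dxx t ht x).sub (hu₂_dxx t ht x)
    · intro η hη
      obtain ⟨M, hM⟩ := hbdd η hη
      have hK : IsCompact (Icc (-M) M ×ˢ Icc (-M) M) := isCompact_Icc.prod isCompact_Icc
      obtain ⟨B1, hB1⟩ := (hadm.2.1 _ hK).1
      obtain ⟨B2, hB2⟩ := (hadm.2.2.1 _ hK).1
      refine ⟨max 0 (max B1 B2), le_max_left _ _, fun t ht x => ?_⟩
      obtain ⟨m1, m2, m3, m4⟩ := hM t ht x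
      have htp : 0 < t := lt_of_lt_of_le hη ht
      have e : (u₁t t x - u₂t t x) - (u₁xx t x - u₂xx t x) =
          (g t (u₁ t x) (u₁x t x) - g t (u₂ t x) (u₁x t x)) + (g t (u₂ t x) (u₁x t x) - g t (u₂ t x) (u₂x t x)) := by
        rw [heq₁ t htp x, heq₂ t htp x]; ring
      have k1 := mvt_abs (f := fun v => g t v (u₁x t x)) (f' := fun v => gu t v (u₁x t x)) (B := B1)
        (fun v => hgu t v _) (fun v hv => hB1 t (v, u₁x t x) ⟨hv, abs_le.1 m2⟩) m1 m3
      have k2 := mvt_abs (f := fun q => g t (u₂ t x) q) (f' := fun q => gp t (u₂ t x) q) (B := B2)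
        (fun v => hgp t _ v) (fun v hv => hB2 t (u₂ t x, v) ⟨abs_le.1 m3, hv⟩) m2 m4
      have l1 : B1 ≤ max 0 (max B1 B2) := (le_max_left _ _).trans (le_max_right _ _)
      have l2 : B2 ≤ max 0 (max B1 B2) := (le_max_right _ _).trans (le_max_right _ _)
      rw [e, mul_add]
      exact (abs_add_le _ _).trans (add_le_add (k1.trans (mul_le_mul_of_nonneg_right l1 (abs_nonneg _)))
        (k2.trans (mul_le_mul_of_nonneg_right l2 (abs_nonneg _))))
    · intro t ht
      obtain ⟨x, hx⟩ := hdist t ht.le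
      exact ⟨x, sub_ne_zero.2 hx⟩
  exact hSol.main ht₀ hmul.1 hmul.2 hs hst htt
end

section
/- For every t ∈ ℝ, the series ∑_{k=1}^∞ (cos(2^{−k} π t) − 1) converges absolutely and ∫₀ᵗ f(s) ds = ∑_{k=1}^∞ (cos(2^{−k} π t) − 1); in particular φ(t) = exp(∫₀ᵗ f(s) ds) for all t ∈ ℝ. -/
open Filter intervalIntegral

noncomputable def fAP (t : ℝ) : ℝ :=
  -∑' k : ℕ, (1 / 2 ^ (k + 1) : ℝ) * Real.pi *
    Real.sin ((1 / 2 ^ (k + 1) : ℝ) * Real.pi * t)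

noncomputable def phiAP (t : ℝ) : ℝ :=
  Real.exp (∑' k : ℕ, (Real.cos ((1 / 2 ^ (k + 1) : ℝ) * Real.pi * t) - 1))

theorem stmt14 :
    ∀ t : ℝ,
      Summable (fun k : ℕ => |Real.cos ((1 / 2 ^ (k + 1) : ℝ) * Real.pi * t) - 1|) ∧
      (∫ s in (0:ℝ)..t, fAP s) =
        ∑' k : ℕ, (Real.cos ((1 / 2 ^ (k + 1) : ℝ) * Real.pi * t) - 1) ∧
      phiAP t = Real.exp (∫ s in (0:ℝ)..t, fAP s) := by
  have hu : Summable (fun k : ℕ => (1 / 2 ^ (k + 1) : ℝ) * Real.pi) := by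
    apply Summable.mul_right
    have h := (summable_nat_add_iff 1).2 summable_geometric_two
    refine h.congr fun k => ?_
    rw [one_div_pow]
  have hg : ∀ (k : ℕ) (y : ℝ), HasDerivAt
      (fun t : ℝ => Real.cos ((1 / 2 ^ (k + 1) : ℝ) * Real.pi * t) - 1)
      (-((1 / 2 ^ (k + 1) : ℝ) * Real.pi * Real.sin ((1 / 2 ^ (k + 1) : ℝ) * Real.pi * y))) y := by
    intro k y
    have h1 : HasDerivAt (fun t : ℝ => (1 / 2 ^ (k + 1) : ℝ) * Real.pi * t)
        ((1 / 2 ^ (k + 1) : ℝ) * Real.pi) y := by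
      simpa using (hasDerivAt_id y).const_mul ((1 / 2 ^ (k + 1) : ℝ) * Real.pi)
    exact (h1.cos.sub_const 1).congr_deriv (by ring)
  have hb0 : ∀ (k : ℕ) (y : ℝ), ‖(1 / 2 ^ (k + 1) : ℝ) * Real.pi *
      Real.sin ((1 / 2 ^ (k + 1) : ℝ) * Real.pi * y)‖ ≤ (1 / 2 ^ (k + 1) : ℝ) * Real.pi := by
    intro k y
    have hp : 0 ≤ (1 / 2 ^ (k + 1) : ℝ) * Real.pi := by positivity
    rw [norm_mul, Real.norm_of_nonneg hp]
    exact mul_le_of_le_one_right hp (Real.abs_sin_le_one _)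
  have hb : ∀ (k : ℕ) (y : ℝ), ‖-((1 / 2 ^ (k + 1) : ℝ) * Real.pi *
      Real.sin ((1 / 2 ^ (k + 1) : ℝ) * Real.pi * y))‖ ≤ (1 / 2 ^ (k + 1) : ℝ) * Real.pi := by
    intro k y
    rw [norm_neg]
    exact hb0 k y
  have h0 : Summable (fun k : ℕ => Real.cos ((1 / 2 ^ (k + 1) : ℝ) * Real.pi * 0) - 1) := by
    simpa using (summable_zero : Summable (fun _ : ℕ => (0 : ℝ)))
  have hc : Continuous fAP := by
    unfold fAP
    refine (continuous_tsum (fun k => ?_) hu hb0).neg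
    fun_prop
  have hd : ∀ y : ℝ, HasDerivAt
      (fun t : ℝ => ∑' k : ℕ, (Real.cos ((1 / 2 ^ (k + 1) : ℝ) * Real.pi * t) - 1)) (fAP y) y := by
    intro y
    refine (hasDerivAt_tsum hu hg hb h0 y).congr_deriv ?_
    rw [tsum_neg, fAP]
  intro t
  have hI : (∫ s in (0:ℝ)..t, fAP s) =
      ∑' k : ℕ, (Real.cos ((1 / 2 ^ (k + 1) : ℝ) * Real.pi * t) - 1) := by
    rw [integral_eq_sub_of_hasDerivAt (fun y _ => hd y) (hc.intervalIntegrable _ _)]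
    simp
  refine ⟨(summable_of_summable_hasDerivAt hu hg hb h0 t).abs, hI, ?_⟩
  rw [hI, phiAP]
end

section
/- There exists a sequence of real numbers tₙ → ∞ such that φ(tₙ) → 0 as n → ∞; equivalently, liminf_{t → ∞} φ(t) = 0. -/
open Filter

lemma cos_two_pow_pi_div_three (j : ℕ) : Real.cos (2 ^ j * (Real.pi / 3)) ^ 2 = 1 / 4 := by
  induction j with
  | zero => simp [Real.cos_pi_div_three]; norm_num
  | succ k ih =>
    rw [pow_succ (2:ℝ) k, mul_comm ((2:ℝ) ^ k) 2, mul_assoc, Real.cos_two_mul, ih]; norm_num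

lemma cos_two_pow_le (j : ℕ) : Real.cos (2 ^ j * (Real.pi / 3)) ≤ 1 / 2 := by
  nlinarith [cos_two_pow_pi_div_three j]

lemma phi_summable (t : ℝ) :
    Summable (fun k : ℕ => 1 - Real.cos ((1 / 2 ^ (k + 1) : ℝ) * Real.pi * t)) := by
  have hs : Summable (fun k : ℕ => ((Real.pi * t) ^ 2 / 8) * (1 / 4 : ℝ) ^ k) :=
    (summable_geometric_of_lt_one (by norm_num) (by norm_num)).mul_left _
  refine Summable.of_nonneg_of_le (fun k => ?_) (fun k => ?_) hs
  · linarith [Real.cos_le_one ((1 / 2 ^ (k + 1) : ℝ) * Real.pi * t)]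
  · have h := Real.one_sub_sq_div_two_le_cos (x := (1 / 2 ^ (k + 1) : ℝ) * Real.pi * t)
    have e : ((1 / 2 ^ (k + 1) : ℝ) * Real.pi * t) ^ 2 / 2
        = ((Real.pi * t) ^ 2 / 8) * (1 / 4 : ℝ) ^ k := by
      have : (4:ℝ) ^ k = (2 ^ k) ^ 2 := by rw [← pow_mul, mul_comm, pow_mul]; norm_num
      rw [one_div_pow, this, pow_succ (2:ℝ) k]
      field_simp
      try ring
    linarith

lemma phi_bound (n : ℕ) : phiAP (2 ^ n / 3) ≤ Real.exp (-((n : ℝ) / 2)) := by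
  unfold phiAP
  apply Real.exp_le_exp.mpr
  have h := (phi_summable (2 ^ n / 3)).sum_le_tsum (Finset.range n) (fun k _ => by
    linarith [Real.cos_le_one ((1 / 2 ^ (k + 1) : ℝ) * Real.pi * (2 ^ n / 3))])
  have h2 : ∑ k ∈ Finset.range n, (1 / 2 : ℝ) ≤ ∑ k ∈ Finset.range n,
      (1 - Real.cos ((1 / 2 ^ (k + 1) : ℝ) * Real.pi * (2 ^ n / 3))) := by
    refine Finset.sum_le_sum (fun k hk => ?_)
    have hk' : k < n := Finset.mem_range.mp hk
    obtain ⟨j, rfl⟩ := Nat.exists_eq_add_of_le (Nat.succ_le_of_lt hk')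
    have e : (1 / 2 ^ (k + 1) : ℝ) * Real.pi * (2 ^ (k.succ + j) / 3)
        = 2 ^ j * (Real.pi / 3) := by
      rw [Nat.succ_eq_add_one, pow_add _ (k + 1) j]
      field_simp
    rw [e]
    linarith [cos_two_pow_le j]
  have h3 : ∑' k : ℕ, (Real.cos ((1 / 2 ^ (k + 1) : ℝ) * Real.pi * (2 ^ n / 3)) - 1)
      = -∑' k : ℕ, (1 - Real.cos ((1 / 2 ^ (k + 1) : ℝ) * Real.pi * (2 ^ n / 3))) := by
    rw [← tsum_neg]; simp
  rw [h3]
  simp only [Finset.sum_const, Finset.card_range, nsmul_eq_mul] at h2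
  linarith

theorem stmt17 :
    (∃ t : ℕ → ℝ, Tendsto t atTop atTop ∧
      Tendsto (fun n => phiAP (t n)) atTop (nhds 0)) ∧
    Filter.liminf phiAP Filter.atTop = 0 := by
  have ht : Tendsto (fun n : ℕ => (2 : ℝ) ^ n / 3) atTop atTop :=
    (tendsto_pow_atTop_atTop_of_one_lt (by norm_num)).atTop_div_const (by norm_num)
  have hp : Tendsto (fun n : ℕ => phiAP (2 ^ n / 3)) atTop (nhds 0) := by
    refine squeeze_zero (fun n => (Real.exp_pos _).le) phi_bound ?_
    refine Real.tendsto_exp_atBot.comp (tendsto_neg_atTop_atBot.comp ?_)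
    exact tendsto_natCast_atTop_atTop.atTop_div_const (by norm_num)
  refine ⟨⟨_, ht, hp⟩, ?_⟩
  have hnn : ∀ t, 0 ≤ phiAP t := fun t => (Real.exp_pos _).le
  have hf : ∀ ε : ℝ, 0 < ε → ∃ᶠ t in atTop, phiAP t ≤ ε := fun ε hε =>
    ht.frequently ((hp.eventually (eventually_le_nhds hε)).frequently)
  apply le_antisymm
  · refine le_of_forall_pos_le_add (fun ε hε => ?_)
    rw [zero_add]
    exact liminf_le_of_frequently_le (hf ε hε) ⟨0, by simpa using ⟨0, fun t _ => hnn t⟩⟩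
  · refine le_liminf_of_le ?_ (Eventually.of_forall hnn)
    exact IsCoboundedUnder.of_frequently_le (hf 1 one_pos)
end

section
/- The function u : ℝ × ℝ → ℝ defined by u(t,x) = φ(t) sin(x + t) is infinitely differentiable, 2π-periodic in x, satisfies u(0,x) = sin x, and solves the linear parabolic equation ∂ₜu(t,x) = ∂ₓₓu(t,x) + ∂ₓu(t,x) + (f(t) + 1) u(t,x) for all (t,x) ∈ ℝ × ℝ. -/
open Filter

theorem aux_hasDeriv (a b c : ℕ → ℝ) (hc : Summable fun k => |c k|) (ha : ∀ k, |a k| ≤ 2) (t : ℝ) :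
    HasDerivAt (fun t => ∑' k, c k * Real.sin (a k * t + b k))
      (∑' k, (c k * a k) * Real.sin (a k * t + (b k + Real.pi / 2))) t := by
  refine hasDerivAt_tsum (u := fun k => |c k| * 2) (hc.mul_right 2)
    (g := fun k t => c k * Real.sin (a k * t + b k))
    (g' := fun k t => (c k * a k) * Real.sin (a k * t + (b k + Real.pi / 2))) ?_ ?_ (y₀ := 0) ?_ t
  · intro k y
    have h1 : HasDerivAt (fun t => a k * t + b k) (a k * 1) y :=
      ((hasDerivAt_id y).const_mul (a k)).add_const (b k)
    have h2 := (h1.sin).const_mul (c k)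
    refine h2.congr_deriv ?_
    rw [← add_assoc, Real.sin_add_pi_div_two]
    ring
  · intro k y
    rw [Real.norm_eq_abs, abs_mul, abs_mul]
    have h1 := Real.abs_sin_le_one (a k * y + (b k + Real.pi / 2))
    calc _ ≤ |c k| * 2 * 1 := by gcongr; exact ha k
      _ = _ := by ring
  · refine Summable.of_norm_bounded hc ?_
    intro k
    rw [Real.norm_eq_abs, abs_mul]
    exact mul_le_of_le_one_right (abs_nonneg _) (Real.abs_sin_le_one _)

theorem aux_contDiff (a : ℕ → ℝ) (ha : ∀ k, |a k| ≤ 2) (n : ℕ) :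
    ∀ (b c : ℕ → ℝ), (Summable fun k => |c k|) →
    ContDiff ℝ n (fun t => ∑' k, c k * Real.sin (a k * t + b k)) := by
  induction n with
  | zero =>
    intro b c hc
    refine contDiff_zero.2 ?_
    exact continuous_iff_continuousAt.2 fun t => (aux_hasDeriv a b c hc ha t).continuousAt
  | succ n ih =>
    intro b c hc
    push_cast
    refine contDiff_succ_iff_deriv.2 ⟨fun t => (aux_hasDeriv a b c hc ha t).differentiableAt, by simp, ?_⟩
    have : deriv (fun t => ∑' k, c k * Real.sin (a k * t + b k)) = fun t =>
        ∑' k, (c k * a k) * Real.sin (a k * t + (b k + Real.pi / 2)) :=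
      funext fun t => (aux_hasDeriv a b c hc ha t).deriv
    rw [this]
    refine ih (fun k => b k + Real.pi / 2) (fun k => c k * a k) ?_
    refine Summable.of_nonneg_of_le (fun _ => abs_nonneg _) (fun k => ?_) (hc.mul_right 2)
    rw [abs_mul]
    gcongr
    exact ha k

theorem aux_sum : Summable fun k : ℕ => (1 / 2 ^ (k + 1) : ℝ) * Real.pi := by
  refine Summable.mul_right _ ?_
  have := (summable_geometric_two).mul_left (1/2)
  refine this.congr fun k => ?_
  rw [pow_succ, one_div_pow]
  field_simp

theorem aux_f : ContDiff ℝ (⊤ : ℕ∞) fAP := by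
  refine contDiff_infty.2 fun n => ?_
  have h := aux_contDiff (fun k => (1 / 2 ^ (k + 1) : ℝ) * Real.pi) (fun k => ?_) n (fun _ => 0)
    (fun k => (1 / 2 ^ (k + 1) : ℝ) * Real.pi) (aux_sum.congr fun k => ?_)
  · simp only [add_zero] at h
    exact h.neg
  · rw [abs_of_nonneg (by positivity)]
    have : (1 / 2 ^ (k + 1) : ℝ) ≤ 1 / 2 := by
      rw [pow_succ]
      have : (1:ℝ) ≤ 2 ^ k := one_le_pow₀ (by norm_num)
      exact one_div_le_one_div_of_le (by norm_num) (by linarith)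
    nlinarith [Real.pi_le_four, Real.pi_pos]
  · rw [abs_of_nonneg (by positivity)]

theorem aux_G (t : ℝ) : HasDerivAt
    (fun t => ∑' k : ℕ, (Real.cos ((1 / 2 ^ (k + 1) : ℝ) * Real.pi * t) - 1)) (fAP t) t := by
  unfold fAP
  rw [← tsum_neg]
  refine hasDerivAt_tsum (u := fun k : ℕ => (1 / 2 ^ (k + 1) : ℝ) * Real.pi) aux_sum
    (g := fun (k : ℕ) t => (Real.cos ((1 / 2 ^ (k + 1) : ℝ) * Real.pi * t) - 1))
    (g' := fun (k : ℕ) t => -((1 / 2 ^ (k + 1) : ℝ) * Real.pi *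
      Real.sin ((1 / 2 ^ (k + 1) : ℝ) * Real.pi * t))) ?_ ?_ (y₀ := 0) ?_ t
  · intro k y
    have h1 := (((hasDerivAt_id y).const_mul ((1 / 2 ^ (k + 1) : ℝ) * Real.pi)).cos).sub_const 1
    refine h1.congr_deriv ?_
    simp only [id]
    ring
  · intro k y
    rw [norm_neg, Real.norm_eq_abs, abs_mul, abs_of_nonneg (by positivity : 0 ≤ (1 / 2 ^ (k + 1) : ℝ) * Real.pi)]
    exact mul_le_of_le_one_right (by positivity) (Real.abs_sin_le_one _)
  · simp [summable_zero]

theorem aux_phi (t : ℝ) : HasDerivAt phiAP (phiAP t * fAP t) t := (aux_G t).exp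

theorem aux_phi_smooth : ContDiff ℝ (⊤ : ℕ∞) phiAP := by
  refine ContDiff.exp ?_
  refine contDiff_infty_iff_deriv.2 ⟨fun t => (aux_G t).differentiableAt, ?_⟩
  rw [funext fun t => (aux_G t).deriv]
  exact aux_f

theorem stmt18 :
    ContDiff ℝ (⊤ : ℕ∞) (fun p : ℝ × ℝ => phiAP p.1 * Real.sin (p.2 + p.1)) ∧
    (∀ t x : ℝ, phiAP t * Real.sin ((x + 2 * Real.pi) + t) = phiAP t * Real.sin (x + t)) ∧
    (∀ x : ℝ, phiAP 0 * Real.sin (x + 0) = Real.sin x) ∧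
    (∀ t x : ℝ,
      deriv (fun s => phiAP s * Real.sin (x + s)) t =
        deriv (deriv (fun y => phiAP t * Real.sin (y + t))) x +
        deriv (fun y => phiAP t * Real.sin (y + t)) x +
        (fAP t + 1) * (phiAP t * Real.sin (x + t))) := by
  refine ⟨?_, ?_, ?_, ?_⟩
  · exact (aux_phi_smooth.comp contDiff_fst).mul (contDiff_snd.add contDiff_fst).sin
  · intro t x
    rw [show x + 2 * Real.pi + t = x + t + 2 * Real.pi by ring, Real.sin_add_two_pi]
  · intro x
    simp [phiAP]
  · intro t x
    have hs : ∀ y, HasDerivAt (fun y => phiAP t * Real.sin (y + t)) (phiAP t * Real.cos (y + t)) y := by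
      intro y
      simpa using (((hasDerivAt_id y).add_const t).sin).const_mul (phiAP t)
    have hc : HasDerivAt (fun y => phiAP t * Real.cos (y + t)) (phiAP t * -Real.sin (x + t)) x := by
      simpa using (((hasDerivAt_id x).add_const t).cos).const_mul (phiAP t)
    have ht := (aux_phi t).mul (((hasDerivAt_id t).const_add x).sin)
    have e : deriv (fun s => phiAP s * Real.sin (x + s)) t = _ := ht.deriv
    rw [e, funext fun y => (hs y).deriv, hc.deriv]
    simp only [id]
    ring
end
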